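/- Let F_n = A ∗ B (each factor of rank at least 3), let ψ = ψ_A ∗ ψ_B where ψ_A, ψ_B are fully irreducible atoroidal automorphisms of A and B respectively, and let φ be a fully irreducible atoroidal automorphism of F_n. For all sufficiently large m, l, let Q = ⟨φ^m, ψ^l⟩ < Out(F_n) be the resulting purely atoroidal subgroup with hyperbolic extension G of F_n by Q, and let G₂ = π⁻¹(⟨ψ^l⟩) where π: G → Q is the quotient map. Then A is quasiconvex in G₁ = π⁻¹(⟨φ^m⟩) but A is distorted in A ⋊_{ψ_A^l} ℤ < G₂; hence A is not quasiconvex in G. -/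

import Mathlib

/-! ### Core coarse-geometric definitions
Gromov products, hyperbolicity, Gromov boundaries, Cannon–Thurston maps,
word metrics, quasi-isometric embeddings, laminations. -/

/-- The Gromov product of `x` and `y` with respect to the basepoint `o`,
for a distance function `d`. -/
noncomputable def gprod {X : Type*} (d : X → X → ℝ) (o x y : X) : ℝ :=
  (d x o + d y o - d x y) / 2

/-- A distance function is (Gromov) hyperbolic: the four point condition. -/
def IsHypD {X : Type*} (d : X → X → ℝ) : Prop :=
  ∃ δ : ℝ, 0 ≤ δ ∧ ∀ o x y z : X,
    min (gprod d o x y) (gprod d o y z) ≤ gprod d o x z + δ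

/-- A sequence tends to infinity if its Gromov products tend to infinity. -/
def SeqToInf {X : Type*} (d : X → X → ℝ) (s : ℕ → X) : Prop :=
  ∀ (o : X) (M : ℝ), ∃ N : ℕ, ∀ m n : ℕ, N ≤ m → N ≤ n → M ≤ gprod d o (s m) (s n)

/-- Two sequences tending to infinity determine the same boundary point. -/
def SeqFellow {X : Type*} (d : X → X → ℝ) (s t : ℕ → X) : Prop :=
  ∀ (o : X) (M : ℝ), ∃ N : ℕ, ∀ m n : ℕ, N ≤ m → N ≤ n → M ≤ gprod d o (s m) (t n)

/-- Sequences in `X` tending to infinity. -/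
def BdryPre {X : Type*} (d : X → X → ℝ) : Type _ := { s : ℕ → X // SeqToInf d s }

/-- The (sequential model of the) Gromov boundary of `(X, d)`. -/
def Bdry {X : Type*} (d : X → X → ℝ) : Type _ :=
  Quot fun s t : BdryPre d => SeqFellow d s.1 t.1

/-- The boundary point represented by a sequence tending to infinity. -/
def Bdry.mk {X : Type*} {d : X → X → ℝ} (s : BdryPre d) : Bdry d := Quot.mk _ s

/-- A sequence in `X` converges to the boundary point `ξ`. -/
def ConvTo {X : Type*} (d : X → X → ℝ) (s : ℕ → X) (ξ : Bdry d) : Prop :=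
  ∃ h : SeqToInf d s, Bdry.mk ⟨s, h⟩ = ξ

/-- The visual topology on the Gromov boundary. -/
noncomputable instance bdryTopology {X : Type*} (d : X → X → ℝ) :
    TopologicalSpace (Bdry d) :=
  TopologicalSpace.generateFrom
    { U | ∃ (o : X) (M : ℝ) (s : BdryPre d),
        U = { η | ∃ t : BdryPre d, Bdry.mk t = η ∧
          ∀ m n : ℕ, M ≤ gprod d o (s.1 m) (t.1 n) } }

/-- `g` is a Cannon–Thurston map for `f : (Y,dY) → (X,dX)`: it is continuous and,
whenever a sequence in `Y` converges to a boundary point `ξ`, the image sequence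
converges to `g ξ`. -/
def IsCTMapD {Y X : Type*} (dY : Y → Y → ℝ) (dX : X → X → ℝ)
    (f : Y → X) (g : Bdry dY → Bdry dX) : Prop :=
  Continuous g ∧
    ∀ (s : ℕ → Y) (ξ : Bdry dY), ConvTo dY s ξ → ConvTo dX (fun n => f (s n)) (g ξ)

/-- `f : (Y,dY) → (X,dX)` admits a Cannon–Thurston map. -/
def AdmitsCT {Y X : Type*} (dY : Y → Y → ℝ) (dX : X → X → ℝ) (f : Y → X) : Prop :=
  ∃ g, IsCTMapD dY dX f g

/-- The limit set of `A ⊆ X` in the Gromov boundary of `(X,d)`. -/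
def limitSetD {X : Type*} (d : X → X → ℝ) (A : Set X) : Set (Bdry d) :=
  { ξ | ∃ s : ℕ → X, (∀ n, s n ∈ A) ∧ ConvTo d s ξ }

/-- Quasi-isometric embedding with multiplicative/additive constant `k`. -/
def IsQIEmbWith {Y X : Type*} (dY : Y → Y → ℝ) (dX : X → X → ℝ) (k : ℝ) (f : Y → X) : Prop :=
  ∀ y y' : Y, dY y y' / k - k ≤ dX (f y) (f y') ∧ dX (f y) (f y') ≤ k * dY y y' + k

/-- Quasi-isometric embedding. -/
def IsQIEmbD {Y X : Type*} (dY : Y → Y → ℝ) (dX : X → X → ℝ) (f : Y → X) : Prop :=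
  ∃ k : ℝ, 1 ≤ k ∧ IsQIEmbWith dY dX k f

/-- `A` is contained in a finite (`d`-)neighborhood of `B`. -/
def InFiniteNbhd {X : Type*} (d : X → X → ℝ) (A B : Set X) : Prop :=
  ∃ D : ℝ, ∀ a ∈ A, ∃ b ∈ B, d a b ≤ D

/-- The word length of `g` with respect to `S` (inverses of generators allowed). -/
noncomputable def wordLength {G : Type*} [Group G] (S : Set G) (g : G) : ℕ :=
  sInf { n : ℕ | ∃ l : List G, (∀ x ∈ l, x ∈ S ∨ x⁻¹ ∈ S) ∧ l.length = n ∧ l.prod = g }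

/-- The word metric on `G` with respect to `S`. -/
noncomputable def wordDist {G : Type*} [Group G] (S : Set G) (g h : G) : ℝ :=
  wordLength S (g⁻¹ * h)

/-- `S` is a finite generating set of `G`. -/
def GenSet {G : Type*} [Group G] (S : Set G) : Prop :=
  S.Finite ∧ Subgroup.closure S = ⊤

/-- A finitely generated group is hyperbolic if some (equivalently, any) of its
word metrics with respect to a finite generating set is Gromov hyperbolic. -/
def IsHypGroup (G : Type*) [Group G] : Prop :=
  ∃ S : Set G, GenSet S ∧ IsHypD (wordDist S)

/-- The standard distance on `ℤ` (to parametrize (quasi)geodesic lines). -/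
noncomputable def zdist : ℤ → ℤ → ℝ := fun m n => |(m : ℝ) - (n : ℝ)|

/-- A quasigeodesic line in `(Y,dY)`. -/
def IsQGLine {Y : Type*} (dY : Y → Y → ℝ) (α : ℤ → Y) : Prop :=
  IsQIEmbD zdist dY α

/-- `α` is a leaf of the Cannon–Thurston lamination of `f`, whose CT map is `g`:
a quasigeodesic line whose two distinct endpoints at infinity are identified by `g`. -/
def IsLeafD {Y X : Type*} (dY : Y → Y → ℝ) (dX : X → X → ℝ)
    (f : Y → X) (g : Bdry dY → Bdry dX) (α : ℤ → Y) : Prop :=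
  IsQGLine dY α ∧
  ∃ ξp ξm : Bdry dY,
    ConvTo dY (fun n : ℕ => α (n : ℤ)) ξp ∧ ConvTo dY (fun n : ℕ => α (-(n : ℤ))) ξm ∧
    ξp ≠ ξm ∧ g ξp = g ξm

/-- A finitely generated subgroup `H ≤ G` is qi embedded (= quasiconvex when `G` is
hyperbolic, = undistorted): the inclusion is a quasi-isometric embedding for word
metrics coming from finite generating sets (this does not depend on the choices). -/
def QIEmbSubgroup {G : Type*} [Group G] (H : Subgroup G) : Prop :=
  ∃ (S : Set G) (T : Set ↥H), GenSet S ∧ GenSet T ∧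
    IsQIEmbD (wordDist T) (wordDist S) (Subtype.val : ↥H → G)

/-- A group is virtually cyclic (elementary). -/
def VirtCyclic (G : Type*) [Group G] : Prop :=
  ∃ H : Subgroup G, (∃ g : G, H = Subgroup.zpowers g) ∧ H.index ≠ 0

/-- A geodesic metric space. -/
def IsGeodesicMS (X : Type*) [MetricSpace X] : Prop :=
  ∀ x y : X, ∃ γ : ℝ → X, γ 0 = x ∧ γ (dist x y) = y ∧
    ∀ s ∈ Set.Icc (0:ℝ) (dist x y), ∀ t ∈ Set.Icc (0:ℝ) (dist x y),
      dist (γ s) (γ t) = |s - t|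

/-- An automorphism `a` of `K` is hyperbolic (atoroidal): the mapping torus
`K ⋊_a ℤ` is a hyperbolic group. -/
def AtoroidalAut {K : Type*} [Group K] (a : MulAut K) : Prop :=
  IsHypGroup (K ⋊[zpowersHom (MulAut K) a] Multiplicative ℤ)

/-- `A` is a free factor of `K`: there is `B ≤ K` with `K = A ∗ B` (internally). -/
def IsFreeFactor {K : Type*} [Group K] (A : Subgroup K) : Prop :=
  ∃ B : Subgroup K, Function.Bijective (Monoid.Coprod.lift A.subtype B.subtype)

/-- `a` is fully irreducible: no positive power of `a` preserves the conjugacy class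
of a proper (nontrivial) free factor of `K`. -/
def FullyIrreducibleAut {K : Type*} [Group K] (a : MulAut K) : Prop :=
  ∀ p : ℕ, 0 < p → ∀ A : Subgroup K, IsFreeFactor A → A ≠ ⊥ → A ≠ ⊤ →
    ∀ k : K, A.map ((a ^ p : MulAut K) : K ≃* K).toMonoidHom ≠
      A.map (MulAut.conj k).toMonoidHom

section TreeLenBasics

/-- Abstract length function on a group, modelled on word length in a free group. -/
structure TreeLen {K : Type*} [Group K] (l : K → ℕ) : Prop where
  one : l 1 = 0
  inv : ∀ x, l x⁻¹ = l x
  eq_one : ∀ x, l x = 0 → x = 1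
  mul_le : ∀ x y, l (x * y) ≤ l x + l y
  par : ∀ x y, Even (l x + l y + l (x * y))
  fin : ∀ n, {x | l x ≤ n}.Finite
  split : ∀ x n, n ≤ l x → ∃ a b, x = a * b ∧ l a = n ∧ l b + n = l x
  hyp : ∀ x y z, l y + l (x⁻¹ * z) ≤ max (l x + l (y⁻¹ * z)) (l z + l (x⁻¹ * y))

/-- tree distance -/
def td {K : Type*} [Group K] (l : K → ℕ) (x y : K) : ℕ := l (x⁻¹ * y)

variable {K : Type*} [Group K] {l : K → ℕ}

namespace TreeLen

theorem d_self (h : TreeLen l) (x : K) : td l x x = 0 := by simp [td, h.one]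

theorem d_comm (h : TreeLen l) (x y : K) : td l x y = td l y x := by
  unfold td; rw [← h.inv]; simp

theorem d_tri (h : TreeLen l) (x y z : K) : td l x z ≤ td l x y + td l y z := by
  unfold td
  have := h.mul_le (x⁻¹ * y) (y⁻¹ * z)
  simpa [mul_assoc] using this

theorem d_left (g x y : K) : td l (g * x) (g * y) = td l x y := by
  unfold td; simp [mul_assoc]

theorem d_one (x : K) : td l 1 x = l x := by simp [td]

theorem d_one' (h : TreeLen l) (x : K) : td l x 1 = l x := by simp [td, h.inv]

theorem d_mul (g x : K) : td l g (g * x) = l x := by simp [td]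

theorem d_eq (h : TreeLen l) {x y : K} (hh : td l x y = 0) : x = y := by
  have := h.eq_one _ hh
  rw [inv_mul_eq_one] at this; exact this

theorem d_par (h : TreeLen l) (x y z : K) : (td l x y + td l y z + td l x z) % 2 = 0 := by
  have := h.par (x⁻¹ * y) (y⁻¹ * z)
  rw [Nat.even_iff] at this
  simpa [td, mul_assoc] using this

theorem four (h : TreeLen l) (o x y z : K) :
    td l o y + td l x z ≤ max (td l o x + td l y z) (td l o z + td l x y) := by
  have := h.hyp (o⁻¹ * x) (o⁻¹ * y) (o⁻¹ * z)
  simpa [td, mul_assoc] using this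

theorem d_split (h : TreeLen l) (x y : K) (n : ℕ) (hn : n ≤ td l x y) :
    ∃ m, td l x m = n ∧ td l x m + td l m y = td l x y := by
  obtain ⟨a, b, hab, ha, hb⟩ := h.split _ n hn
  refine ⟨x * a, ?_, ?_⟩
  · simp [td, ha]
  · have : td l (x * a) y = l b := by
      unfold td
      have : (x * a)⁻¹ * y = b := by
        rw [mul_inv_rev, mul_assoc, hab]; simp
      rw [this]
    rw [this]
    simp only [td] at *
    simp [ha]; omega

/-- split an element in three -/
theorem split3 (h : TreeLen l) (x : K) (i j : ℕ) (hij : i + j ≤ l x) :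
    ∃ a b c, x = a * b * c ∧ l a = i ∧ l b = j ∧ l a + l b + l c = l x := by
  obtain ⟨a, y, hx, ha, hb⟩ := h.split x i (by omega)
  obtain ⟨b, c, hy, hb', hc⟩ := h.split y j (by omega)
  exact ⟨a, b, c, by rw [hx, hy, mul_assoc], ha, hb', by omega⟩

/-- additivity of reduced products -/
theorem add_red (h : TreeLen l) (u v w : K) (h1 : l (u * v) = l u + l v)
    (h2 : l (v * w) = l v + l w) (hv : v ≠ 1) : l (u * v * w) = l u + l v + l w := by
  have h4 := h.four 1 u (u * v) (u * v * w)
  have hv : l v ≠ 0 := fun hh => hv (h.eq_one _ hh)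
  have e1 : td l u (u * v * w) = l (v * w) := by simp [td, mul_assoc]
  have e2 : td l u (u * v) = l v := by simp [td]
  have e3 : td l (u * v) (u * v * w) = l w := by simp [td, mul_assoc]
  rw [e1, e2, e3, d_one, d_one, d_one, h1, h2] at h4
  have := h.mul_le (u * v) w
  omega

/-- cut lemma -/
theorem cut (h : TreeLen l) (D : ℕ) (z : ℕ → K) (r : ℕ) (m : K)
    (hst : ∀ i < r, td l (z i) (z (i + 1)) ≤ D)
    (hm : td l (z 0) m + td l m (z r) = td l (z 0) (z r)) :
    ∃ i ≤ r, td l (z i) m ≤ D := by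
  induction r with
  | zero =>
    refine ⟨0, le_rfl, ?_⟩
    rw [h.d_self, h.d_comm m] at hm; omega
  | succ r ih =>
    by_cases hh : td l (z 0) m + td l m (z r) = td l (z 0) (z r)
    · obtain ⟨i, hi, h'⟩ := ih (fun i hi => hst i (by omega)) hh
      exact ⟨i, by omega, h'⟩
    · refine ⟨r, by omega, ?_⟩
      have h5 := hst r (by omega)
      have h6 := h.four m (z 0) (z r) (z (r+1))
      have h7 := h.d_tri (z 0) m (z r)
      have := h.d_comm m (z r)
      have := h.d_comm m (z 0)
      have := h.d_comm (z (r+1)) (z r)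
      omega

/-- geodesic path between two points -/
theorem geod (h : TreeLen l) (x y : K) : ∃ z : ℕ → K, z 0 = x ∧ z (td l x y) = y ∧
    (∀ i < td l x y, td l (z i) (z (i + 1)) = 1) ∧
    ∀ i ≤ td l x y, td l x (z i) = i ∧ i + td l (z i) y = td l x y := by
  induction hn : td l x y generalizing x with
  | zero =>
    have := h.d_eq hn
    subst this
    exact ⟨fun _ => x, rfl, rfl, by simp, by simp [h.d_self]⟩
  | succ n ih =>
    obtain ⟨m, h1, h2⟩ := h.d_split x y 1 (by omega)
    obtain ⟨z, h3, h4, h5, h6⟩ := ih m (by omega)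
    refine ⟨fun i => if i = 0 then x else z (i - 1), by simp, by simpa using h4, ?_, ?_⟩
    · intro i hi
      by_cases h0 : i = 0
      · subst h0; simp [h3, h1]
      · obtain ⟨j, rfl⟩ := Nat.exists_eq_succ_of_ne_zero h0
        have := h5 j (by omega)
        simpa using this
    · intro i hi
      by_cases h0 : i = 0
      · subst h0; simp [h.d_self]; omega
      · obtain ⟨j, rfl⟩ := Nat.exists_eq_succ_of_ne_zero h0
        have := h6 j (by omega)
        have t1 := h.d_tri x m (z j)
        have t2 := h.d_tri x (z j) y
        simp only [Nat.succ_eq_add_one, Nat.add_eq_zero_iff, one_ne_zero, and_false, ite_false,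
          Nat.add_sub_cancel]
        omega

/-- pulling back along an isomorphism -/
theorem comap {L : Type*} [Group L] (h : TreeLen l) (e : L ≃* K) : TreeLen (fun x => l (e x)) where
  one := by simp [h.one]
  inv x := by simp [h.inv]
  eq_one x hx := by
    have := h.eq_one _ hx
    simpa using this
  mul_le x y := by simpa using h.mul_le (e x) (e y)
  par x y := by simpa using h.par (e x) (e y)
  fin n := by
    have := (h.fin n).preimage (f := e) e.injective.injOn
    exact this
  split x n hn := by
    obtain ⟨a, b, h1, h2, h3⟩ := h.split (e x) n hn
    exact ⟨e.symm a, e.symm b, by rw [← map_mul, ← h1]; simp, by simpa using h2, by simpa using h3⟩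
  hyp x y z := by simpa using h.hyp (e x) (e y) (e z)

/-- homomorphisms between groups with tree lengths are Lipschitz. -/
theorem lip {L : Type*} [Group L] {l' : L → ℕ} (h : TreeLen l) (h' : TreeLen l') (f : K →* L) :
    ∃ C : ℕ, 1 ≤ C ∧ ∀ x, l' (f x) ≤ C * l x := by
  obtain ⟨C, hC⟩ := ((h.fin 1).image (fun x => l' (f x))).bddAbove
  refine ⟨C + 1, by omega, fun x => ?_⟩
  induction hn : l x generalizing x with
  | zero => rw [h.eq_one x hn]; simp [h'.one]
  | succ n ih =>
    obtain ⟨a, b, h1, h2, h3⟩ := h.split x 1 (by omega)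
    have := ih b (by omega)
    have h4 : l' (f a) ≤ C := hC ⟨a, by simp [h2], rfl⟩
    rw [h1, map_mul]
    have := h'.mul_le (f a) (f b)
    nlinarith

/-- bounded cancellation -/
theorem bcl {L : Type*} [Group L] {l' : L → ℕ} (h : TreeLen l) (h' : TreeLen l') (e : K ≃* L) :
    ∃ B : ℕ, ∀ a m b, td l a m + td l m b = td l a b →
      td l' (e a) (e m) + td l' (e m) (e b) ≤ td l' (e a) (e b) + B := by
  obtain ⟨C, hC1, hC⟩ := h.lip h' e.toMonoidHom
  obtain ⟨D, hD1, hD⟩ := h'.lip h e.symm.toMonoidHom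
  refine ⟨2 * (C * D), fun a m b hm => ?_⟩
  obtain ⟨z, z0, zr, zst, zd⟩ := h'.geod (e a) (e b)
  have := h.cut D (fun i => e.symm (z i)) (td l' (e a) (e b)) m ?_ ?_
  · obtain ⟨i, hi, hz⟩ := this
    have h1 : td l' (z i) (e m) ≤ C * D := by
      have := hC ((e.symm (z i))⁻¹ * m)
      simp only [td] at hz ⊢
      simp at this
      exact this.trans (Nat.mul_le_mul le_rfl hz)
    have h2 := (zd i hi).2
    have h3 := (zd i hi).1
    have t1 := h'.d_tri (e a) (z i) (e m)
    have t2 := h'.d_tri (e m) (z i) (e b)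
    have t3 := h'.d_comm (e m) (z i)
    omega
  · intro i hi
    have h1 := zst i hi
    have := hD ((z i)⁻¹ * (z (i+1)))
    simp only [td] at h1 ⊢
    rw [h1] at this
    simpa using this
  · simpa [z0, zr] using hm

end TreeLen

/-- longest common prefix -/
def lcpLen {α : Type*} [DecidableEq α] : List α → List α → ℕ
  | a :: x, b :: y => if a = b then lcpLen x y + 1 else 0
  | _, _ => 0

theorem lcpLen_min {α : Type*} [DecidableEq α] : ∀ x y z : List α,
    min (lcpLen x y) (lcpLen y z) ≤ lcpLen x z
  | [], _, _ => by simp [lcpLen]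
  | _ :: _, [], _ => by simp [lcpLen]
  | _ :: _, _ :: _, [] => by simp [lcpLen]
  | a :: x, b :: y, c :: z => by
    have := lcpLen_min x y z
    simp only [lcpLen]
    split_ifs <;> simp_all

theorem lcpLen_le {α : Type*} [DecidableEq α] : ∀ x y : List α, lcpLen x y ≤ x.length ∧ lcpLen x y ≤ y.length
  | [], _ => by simp [lcpLen]
  | _ :: _, [] => by simp [lcpLen]
  | a :: x, b :: y => by
    have := lcpLen_le x y
    simp only [lcpLen]
    split_ifs <;> simp_all

theorem norm_lcp {α : Type*} [DecidableEq α] : ∀ x y : List (α × Bool), FreeGroup.IsReduced x →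
    FreeGroup.IsReduced y →
    ((FreeGroup.mk x)⁻¹ * FreeGroup.mk y).norm + 2 * lcpLen x y = x.length + y.length
  | [], y, _, hy => by
    simp [lcpLen, FreeGroup.norm, hy.reduce_eq, ← FreeGroup.one_eq_mk]
  | a :: x, [], hx, _ => by
    rw [← FreeGroup.one_eq_mk, mul_one, FreeGroup.norm_inv_eq]
    simp [lcpLen, FreeGroup.norm, hx.reduce_eq]
  | a :: x, b :: y, hx, hy => by
    simp only [lcpLen]
    by_cases hab : a = b
    · subst hab
      have ih := norm_lcp x y (by unfold FreeGroup.IsReduced at *; exact hx.tail)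
        (by unfold FreeGroup.IsReduced at *; exact hy.tail)
      have : (FreeGroup.mk (a :: x))⁻¹ * FreeGroup.mk (a :: y) = (FreeGroup.mk x)⁻¹ * FreeGroup.mk y := by
        have e : ∀ z : List (α × Bool), FreeGroup.mk (a :: z) = FreeGroup.mk [a] * FreeGroup.mk z := by
          intro z; rw [FreeGroup.mul_mk]; rfl
        rw [e x, e y]; group
      rw [this]
      simp only [List.length_cons, if_true]; omega
    · simp only [hab, ite_false]
      rw [FreeGroup.inv_mk, FreeGroup.mul_mk]
      have : FreeGroup.IsReduced (FreeGroup.invRev (a :: x) ++ b :: y) := by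
        have hx' : FreeGroup.IsReduced (FreeGroup.invRev (a :: x)) := by
          rw [FreeGroup.isReduced_iff_reduce_eq, FreeGroup.reduce_invRev, hx.reduce_eq]
        unfold FreeGroup.IsReduced at *
        rw [List.isChain_append]
        refine ⟨hx', hy, ?_⟩
        intro u hu v hv
        simp [FreeGroup.invRev] at hu hv
        subst hv; subst hu
        simp only
        intro h1
        by_contra h2
        apply hab
        ext
        · exact h1
        · revert h2; cases a.2 <;> cases b.2 <;> simp
      unfold FreeGroup.norm
      rw [FreeGroup.toWord_mk, this.reduce_eq]
      simp

theorem treeLen_norm {α : Type*} [DecidableEq α] [Finite α] :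
    TreeLen (FreeGroup.norm : FreeGroup α → ℕ) := by
  have key : ∀ x y : FreeGroup α, (x⁻¹ * y).norm + 2 * lcpLen x.toWord y.toWord = x.norm + y.norm := by
    intro x y
    have := norm_lcp x.toWord y.toWord FreeGroup.isReduced_toWord FreeGroup.isReduced_toWord
    simpa [FreeGroup.mk_toWord, FreeGroup.norm] using this
  refine ⟨by simp, by simp, by simp, FreeGroup.norm_mul_le, ?_, ?_, ?_, ?_⟩
  · intro x y
    have := key x⁻¹ y
    simp at this
    rw [Nat.even_iff]; omega
  · intro n
    have : {L : List (α × Bool) | L.length ≤ n}.Finite := List.finite_length_le _ n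
    exact this.preimage (f := FreeGroup.toWord) FreeGroup.toWord_injective.injOn
  · intro x n hn
    refine ⟨FreeGroup.mk (x.toWord.take n), FreeGroup.mk (x.toWord.drop n), ?_, ?_, ?_⟩
    · rw [FreeGroup.mul_mk, List.take_append_drop, FreeGroup.mk_toWord]
    · have : FreeGroup.IsReduced (x.toWord.take n) := by
        have := FreeGroup.isReduced_toWord (x := x)
        unfold FreeGroup.IsReduced at *
        exact this.take n
      unfold FreeGroup.norm at *
      rw [FreeGroup.toWord_mk, this.reduce_eq]; simp; omega
    · have : FreeGroup.IsReduced (x.toWord.drop n) := by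
        have := FreeGroup.isReduced_toWord (x := x)
        unfold FreeGroup.IsReduced at *
        exact this.drop n
      unfold FreeGroup.norm at *
      rw [FreeGroup.toWord_mk, this.reduce_eq]; simp; omega
  · intro x y z
    have h1 := key x y
    have h2 := key x z
    have h3 := key y z
    have h4 := lcpLen_min x.toWord y.toWord z.toWord
    omega

end TreeLenBasics

section RegionLemma

/-- A labelled side: a geodesic from `a` to `b` with a secondary distance `f`. -/
structure TSide (K : Type*) where
  f : K → K → ℕ
  a : K
  b : K

variable {K : Type*} [Group K] {l : K → ℕ}

/-- `x` then `y` on the side. -/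
def TSide.On (l : K → ℕ) (s : TSide K) (x y : K) : Prop :=
  td l s.a x + td l x y + td l y s.b = td l s.a s.b

/-- overlaps of the sides are stretched -/
def TSide.Good (l : K → ℕ) (C : ℕ) (s t : TSide K) : Prop :=
  ∀ x y, s.On l x y → t.On l y x → 3 * td l x y ≤ s.f x y + t.f y x + C

/-- bounded cancellation for `f` -/
def TSide.Bc (l : K → ℕ) (B : ℕ) (s : TSide K) : Prop :=
  ∀ a m b, td l a m + td l m b = td l a b → s.f a m + s.f m b ≤ s.f a b + B

/-- twice the Gromov product of consecutive sides -/
def TSide.cc (l : K → ℕ) (s t : TSide K) : ℕ :=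
  td l s.a t.a + td l t.a t.b - td l s.a t.b

/-- length -/
def TSide.len (l : K → ℕ) (s : TSide K) : ℕ := td l s.a s.b

theorem TSide.find (h : TreeLen l) (o : K) : ∀ (post : List (TSide K)) (s t : TSide K) (k : ℕ),
    List.IsChain (fun s t : TSide K => s.b = t.a) (s :: t :: post) →
    (∀ z ∈ (s :: t :: post).getLast?, z.a = o ∧ z.b = o) →
    td l o s.a + td l s.a s.b ≤ k + td l o s.b →
    (2 * s.len l ≤ k + s.cc l t) ∨ ∃ pre s1 s2 s3 post', s :: t :: post = pre ++ s1 :: s2 :: s3 :: post' ∧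
      2 * s2.len l ≤ s1.cc l s2 + s2.cc l s3
  | [], s, t, k, hc, hl, hk => by
    left
    simp at hc hl
    rw [hc, hl.1] at hk
    simp only [TSide.len, TSide.cc, hc, hl]
    have := h.d_comm o s.a
    have := h.d_self o
    omega
  | u :: post, s, t, k, hc, hl, hk => by
    by_cases h1 : 2 * s.len l ≤ k + s.cc l t
    · exact Or.inl h1
    right
    have hst : s.b = t.a := by simp at hc; exact hc.1
    have := TSide.find h o post t u (s.cc l t) (by simp at hc ⊢; exact hc.2) (by simpa using hl) (by
      simp only [TSide.len, TSide.cc, hst] at *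
      have h4 := h.four t.a s.a o t.b
      have := h.d_comm o s.a
      have := h.d_comm o t.a
      have := h.d_comm t.a s.a
      have := h.d_tri s.a t.a t.b
      omega)
    rcases this with h2 | ⟨pre, s1, s2, s3, post', h2, h3⟩
    · exact ⟨[], s, t, u, post, by simp, h2⟩
    · exact ⟨s :: pre, s1, s2, s3, post', by simp [h2], h3⟩

theorem TSide.On.shrink (h : TreeLen l) {s s' : TSide K} (hs : s.On l s'.a s'.b) {x y : K}
    (hxy : s'.On l x y) : s.On l x y := by
  unfold TSide.On at *
  have := h.d_tri s.a s'.a x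
  have := h.d_tri y s'.b s.b
  have := h.d_tri s.a x s.b
  have := h.d_tri x y s.b
  omega

theorem TSide.Good.shrink (h : TreeLen l) {C : ℕ} {s s' t t' : TSide K} (hs : s.On l s'.a s'.b)
    (ht : t.On l t'.a t'.b) (hsf : s'.f = s.f) (htf : t'.f = t.f) (hg : s.Good l C t) :
    s'.Good l C t' := by
  intro x y hx hy
  rw [hsf, htf]
  exact hg x y (hs.shrink h hx) (ht.shrink h hy)

theorem TSide.on_self (h : TreeLen l) (s : TSide K) : s.On l s.a s.b := by
  unfold TSide.On
  simp [h.d_self]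

theorem region_aux (h : TreeLen l) (o : K) (B C : ℕ) : ∀ (n : ℕ) (L : List (TSide K)), L.length = n + 2 →
    List.IsChain (fun s t : TSide K => s.b = t.a) L →
    (∀ z ∈ L.head?, z.a = o ∧ z.b = o) → (∀ z ∈ L.getLast?, z.a = o ∧ z.b = o) →
    L.Pairwise (TSide.Good l C) → (∀ s ∈ L, s.Bc l B) →
    3 * (L.map (TSide.len l)).sum ≤ 2 * (L.map (fun s => s.f s.a s.b)).sum + (4 * C + 6 * B) * n
  | 0, L, hL, hc, hh, hl, _, _ => by
    match L, hL with
    | [s, t], _ =>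
      simp at hh hl
      simp [TSide.len, hh, hl, h.d_self]
  | n + 1, L, hL, hc, hh, hl, hp, hb => by
    have : ∃ pre s1 s2 s3 post', L = pre ++ s1 :: s2 :: s3 :: post' ∧
      2 * s2.len l ≤ s1.cc l s2 + s2.cc l s3 := by
      match L, hL with
      | z :: s :: t :: post, _ =>
        simp at hh
        have := TSide.find h o post s t (z.cc l s) (by simp at hc ⊢; exact hc.2) (by simpa using hl) (by
          have : z.b = s.a := by simp at hc; exact hc.1
          rw [← this, hh.2, h.d_self]; omega)
        rcases this with h2 | ⟨pre, s1, s2, s3, post', h2, h3⟩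
        · exact ⟨[], z, s, t, post, by simp, h2⟩
        · exact ⟨z :: pre, s1, s2, s3, post', by simp [h2], h3⟩
    obtain ⟨pre, s1, s2, s3, post, rfl, hcons⟩ := this
    have h12 : s1.b = s2.a := by
      have := (List.isChain_append.1 hc).2.1
      simp at this; exact this.1
    have h23 : s2.b = s3.a := by
      have := (List.isChain_append.1 hc).2.1
      simp at this; exact this.2.1
    have hpar := h.d_par s1.a s2.a s2.b
    have hc1 : ∃ c1, s1.cc l s2 = 2 * c1 := by
      refine ⟨s1.cc l s2 / 2, ?_⟩
      unfold TSide.cc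
      have := h.d_tri s1.a s2.a s2.b
      omega
    obtain ⟨c1, hc1⟩ := hc1
    have hc1' : c1 ≤ td l s2.a s2.b := by
      unfold TSide.cc at hc1
      have := h.d_tri s1.a s2.b s2.a
      have := h.d_comm s2.b s2.a
      omega
    obtain ⟨m, hm1, hm2⟩ := h.d_split s2.a s2.b c1 hc1'
    have hms1 : td l s1.a m + td l m s1.b = td l s1.a s1.b := by
      rw [h12]
      unfold TSide.cc at hc1
      have := h.four s1.a s2.a m s2.b
      have := h.d_tri s1.a m s2.a
      have := h.d_tri s1.a s2.a s2.b
      have := h.d_comm m s2.a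
      have := h.four s2.a s1.a m s2.b
      have := h.d_comm s2.a s1.a
      omega
    have hms3 : td l s3.a m + td l m s3.b = td l s3.a s3.b := by
      rw [← h23]
      unfold TSide.len TSide.cc at hcons
      rw [← h23] at hcons
      unfold TSide.cc at hc1
      have := h.d_tri s2.b m s3.b
      have := h.d_tri s2.a s2.b s3.b
      have := h.d_comm m s2.b
      have := h.d_comm m s2.a
      have := h.d_comm s2.b s2.a
      have := h.four s2.b m s2.a s3.b
      omega
    set s1' : TSide K := ⟨s1.f, s1.a, m⟩ with hs1'
    set s3' : TSide K := ⟨s3.f, m, s3.b⟩ with hs3'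
    have on1 : s1.On l s1'.a s1'.b := by
      simp only [TSide.On, hs1', h.d_self]; omega
    have on3 : s3.On l s3'.a s3'.b := by
      simp only [TSide.On, hs3', h.d_self]; omega
    have ih := region_aux h o B C n (pre ++ s1' :: s3' :: post) (by
      simp at hL ⊢; omega) (by
      rw [List.isChain_append] at hc ⊢
      obtain ⟨q1, q2, q3⟩ := hc
      refine ⟨q1, ?_, ?_⟩
      · rw [List.isChain_cons] at q2
        have q2 := q2.2
        rw [List.isChain_cons] at q2
        have q2 := q2.2
        rw [List.isChain_cons] at q2
        rw [List.isChain_cons, List.isChain_cons]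
        refine ⟨by simp [hs1', hs3'], ?_, q2.2⟩
        simpa [hs3'] using q2.1
      · simpa [hs1'] using q3) (by
      cases pre with
      | nil =>
        simp at hh ⊢
        have e := hms1
        have := h.d_self o
        rw [hh.1, hh.2, this] at e
        have e' := h.d_eq (x := m) (y := o) (by omega)
        simp [hs1', hh, e']
      | cons p pre => simpa using hh) (by
      cases post with
      | nil =>
        simp at hl ⊢
        have e := hms3
        have := h.d_self o
        rw [hl.1, hl.2, this] at e
        have e' := h.d_eq (x := m) (y := o) (by omega)
        simp [hs3', hl, e']
      | cons p post =>
        simp at hl ⊢; exact hl) (by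
      rw [List.pairwise_append] at hp ⊢
      obtain ⟨q1, q2, q3⟩ := hp
      simp only [List.pairwise_cons, List.mem_cons, forall_eq_or_imp] at q2 q3 ⊢
      obtain ⟨⟨_, q4, q5⟩, q6, q7, q8⟩ := q2
      refine ⟨q1, ⟨⟨?_, ?_⟩, ?_, q8⟩, ?_⟩
      · exact q4.shrink h on1 on3 rfl rfl
      · intro t ht
        exact (q5 t ht).shrink h on1 (TSide.on_self h t) rfl rfl
      · intro t ht
        exact (q7 t ht).shrink h on3 (TSide.on_self h t) rfl rfl
      · intro t ht
        obtain ⟨r1, r2, r3, r4⟩ := q3 t ht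
        exact ⟨r1.shrink h (TSide.on_self h t) on1 rfl rfl, r3.shrink h (TSide.on_self h t) on3 rfl rfl, r4⟩) (by
      simp only [List.mem_append, List.mem_cons] at hb ⊢
      rintro s (hs | rfl | rfl | hs)
      · exact hb s (by simp [hs])
      · exact hb s1 (by simp)
      · exact hb s3 (by simp)
      · exact hb s (by simp [hs]))
    rw [List.pairwise_append] at hp
    have hp := hp.2.1
    simp only [List.pairwise_cons, List.mem_cons, forall_eq_or_imp] at hp
    have g12 := hp.1.1 m s2.a (by
        unfold TSide.On; rw [h12, h.d_self]; rw [h12] at hms1; omega) (by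
        unfold TSide.On; rw [h.d_self]; omega)
    have g23 := hp.2.1.1 m s2.b (by
        unfold TSide.On; rw [h.d_self]; omega) (by
        unfold TSide.On; rw [h23, h.d_self]; omega)
    have b1 := hb s1 (by simp) _ _ _ hms1
    have b2 := hb s2 (by simp) _ _ _ hm2
    have b3 := hb s3 (by simp) _ _ _ hms3
    simp only [List.map_append, List.map_cons, List.sum_append, List.sum_cons, TSide.len, hs1', hs3'] at ih ⊢
    rw [h12] at b1 hms1 ⊢
    rw [← h23] at b3 hms3 ⊢
    have := h.d_comm s2.a m
    have := h.d_comm s2.b m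
    have : (4 * C + 6 * B) * (n + 1) = (4 * C + 6 * B) * n + 4 * C + 6 * B := by ring
    omega

/-- The region lemma: a closed polygon. -/
theorem region (h : TreeLen l) (o : K) (B C : ℕ) (L : List (TSide K))
    (hc : List.IsChain (fun s t : TSide K => s.b = t.a) L)
    (hh : ∀ z ∈ L.head?, z.a = o) (hl : ∀ z ∈ L.getLast?, z.b = o)
    (hp : L.Pairwise (TSide.Good l C)) (hb : ∀ s ∈ L, s.Bc l B) :
    3 * (L.map (TSide.len l)).sum ≤ 2 * (L.map (fun s => s.f s.a s.b)).sum + (4 * C + 6 * B) * L.length := by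
  set z : TSide K := ⟨fun _ _ => 0, o, o⟩ with hz
  have on : ∀ x y, z.On l x y → td l x y = 0 := by
    intro x y hxy
    simp only [TSide.On, hz, h.d_self] at hxy; omega
  have gz : ∀ t, z.Good l C t := by
    intro t x y hx _
    have := on x y hx
    omega
  have gz' : ∀ t : TSide K, t.Good l C z := by
    intro t x y _ hx
    have := on y x hx
    have := h.d_comm x y
    omega
  have := region_aux h o B C L.length (z :: L ++ [z]) (by simp) (by
    rw [List.isChain_append]
    refine ⟨?_, by simp, ?_⟩
    · rw [List.isChain_cons]
      exact ⟨fun y hy => by simp [hz, hh y hy], hc⟩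
    · intro x hx y hy
      simp at hy; subst hy
      rw [List.getLast?_cons] at hx
      simp at hx
      subst hx
      cases hq : L.getLast? with
      | none => simp [hz]
      | some q => simp [hl q (by simp [hq]), hz]) (by simp [hz]) (by
        intro y hy
        rw [List.getLast?_append] at hy
        have : y = z := by simpa using hy.symm
        simp [this, hz]) (by
      simp only [List.cons_append, List.pairwise_cons, List.pairwise_append]
      refine ⟨fun a _ => gz a, hp, by simp, ?_⟩
      intro a _ b hb
      simp at hb; subst hb; exact gz' a) (by
      intro s hs
      simp at hs
      rcases hs with rfl | hs | rfl
      · intro a m b _; simp [hz]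
      · exact hb s hs
      · intro a m b _; simp [hz])
  simpa [TSide.len, hz, h.d_self] using this

end RegionLemma

section Corridors

/-- corridor diagrams -/
inductive CD (K E : Type*) where
  | nil : CD K E
  | letter (x : K) (T : CD K E) : CD K E
  | cor (e : E × Bool) (T1 T : CD K E) : CD K E

variable {K : Type*} [Group K] {l : K → ℕ} {E : Type*}

/-- inverse label -/
def labInv (e : E × Bool) : E × Bool := (e.1, !e.2)

/-- automorphism of a label -/
def thb (th : E → MulAut K) (e : E × Bool) : MulAut K := if e.2 then th e.1 else (th e.1)⁻¹

theorem thb_labInv (th : E → MulAut K) (e : E × Bool) : thb th (labInv e) = (thb th e)⁻¹ := by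
  rcases e with ⟨e, _ | _⟩ <;> simp [thb, labInv]

theorem thb_labInv_apply (th : E → MulAut K) (e : E × Bool) (k : K) :
    thb th (labInv e) (thb th e k) = k := by
  rw [thb_labInv]; simp

theorem thb_labInv_apply' (th : E → MulAut K) (e : E × Bool) (k : K) :
    thb th e (thb th (labInv e) k) = k := by
  rw [thb_labInv]; simp

theorem labInv_labInv (e : E × Bool) : labInv (labInv e) = e := by simp [labInv]

namespace CD

/-- boundary word -/
def word : CD K E → List (K ⊕ (E × Bool))
  | nil => []
  | letter x T => Sum.inl x :: word T
  | cor e T1 T => Sum.inr e :: (word T1 ++ Sum.inr (labInv e) :: word T)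

/-- value -/
def val (th : E → MulAut K) : CD K E → K
  | nil => 1
  | letter x T => x * val th T
  | cor e T1 T => thb th e (val th T1) * val th T

/-- mass -/
def M (l : K → ℕ) (th : E → MulAut K) : CD K E → ℕ
  | nil => 0
  | letter _ T => M l th T
  | cor e T1 T => l (val th T1) + l (thb th e (val th T1)) + M l th T1 + M l th T

/-- concatenation -/
def app : CD K E → CD K E → CD K E
  | nil, S => S
  | letter x T, S => letter x (app T S)
  | cor e T1 T, S => cor e T1 (app T S)

theorem word_app (T S : CD K E) : (T.app S).word = T.word ++ S.word := by
  induction T with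
  | nil => simp [app, word]
  | letter x T ih => simp [app, word, ih]
  | cor e T1 T _ ih => simp [app, word, ih]

theorem val_app (th : E → MulAut K) (T S : CD K E) : (T.app S).val th = T.val th * S.val th := by
  induction T with
  | nil => simp [app, val]
  | letter x T ih => simp [app, val, ih, mul_assoc]
  | cor e T1 T _ ih => simp [app, val, ih, mul_assoc]

theorem M_app (th : E → MulAut K) (T S : CD K E) : (T.app S).M l th = T.M l th + S.M l th := by
  induction T with
  | nil => simp [app, M]
  | letter x T ih => simp [app, M, ih]
  | cor e T1 T _ ih => simp [app, M, ih]; omega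

theorem app_assoc (T S U : CD K E) : (T.app S).app U = T.app (S.app U) := by
  induction T with
  | nil => simp [app]
  | letter x T ih => simp [app, ih]
  | cor e T1 T _ ih => simp [app, ih]

theorem app_nil (T : CD K E) : T.app nil = T := by
  induction T with
  | nil => simp [app]
  | letter x T ih => simp [app, ih]
  | cor e T1 T _ ih => simp [app, ih]

/-- evaluation of letters -/
def ev (th : E → MulAut K) : K ⊕ (E × Bool) → K ⋊[MonoidHom.id (MulAut K)] MulAut K
  | Sum.inl x => SemidirectProduct.inl x
  | Sum.inr e => SemidirectProduct.inr (thb th e)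

theorem ev_word (th : E → MulAut K) (T : CD K E) :
    (T.word.map (ev th)).prod = SemidirectProduct.inl (T.val th) := by
  induction T with
  | nil => simp [word, val]
  | letter x T ih => simp [word, val, ih, ev]
  | cor e T1 T ih1 ih =>
    simp only [word, val, List.map_cons, List.map_append, List.prod_cons, List.prod_append, ih1, ih, ev,
      thb_labInv, map_mul]
    have := SemidirectProduct.inl_aut (φ := MonoidHom.id (MulAut K)) (thb th e) (val th T1)
    simp only [MonoidHom.id_apply] at this
    rw [this]; simp [mul_assoc]

theorem val_eq_of_word (th : E → MulAut K) (T S : CD K E) (h : T.word = S.word) : T.val th = S.val th := by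
  have h1 := ev_word th T
  rw [h, ev_word th S] at h1
  exact (SemidirectProduct.inl_injective h1).symm

/-- minimality -/
def Min (l : K → ℕ) (th : E → MulAut K) (T : CD K E) : Prop :=
  ∀ T' : CD K E, T'.word = T.word → T.M l th ≤ T'.M l th

theorem Min.left {th : E → MulAut K} {T S : CD K E} (h : (T.app S).Min l th) : T.Min l th := by
  intro T' hT'
  have := h (T'.app S) (by simp [word_app, hT'])
  rw [M_app, M_app] at this; omega

theorem Min.right {th : E → MulAut K} {T S : CD K E} (h : (T.app S).Min l th) : S.Min l th := by
  intro T' hT'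
  have := h (T.app T') (by simp [word_app, hT'])
  rw [M_app, M_app] at this; omega

theorem Min.inner {th : E → MulAut K} {e : E × Bool} {T S : CD K E} (h : (cor e T S).Min l th) : T.Min l th := by
  intro T' hT'
  have := h (cor e T' S) (by simp [word, hT'])
  have hv := val_eq_of_word th _ _ hT'
  simp only [M, hv] at this; omega

theorem Min.cor_left {th : E → MulAut K} {e : E × Bool} {T S : CD K E} (h : (cor e T S).Min l th) :
    (cor e T nil).Min l th := Min.left (T := cor e T nil) (S := S) (by simpa [app] using h)

theorem Min.cor_right {th : E → MulAut K} {e : E × Bool} {T S : CD K E} (h : (cor e T S).Min l th) :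
    S.Min l th := Min.right (T := cor e T nil) (S := S) (by simpa [app] using h)

theorem Min.letter_right {th : E → MulAut K} {x : K} {S : CD K E} (h : (letter x S).Min l th) :
    S.Min l th := Min.right (T := letter x nil) (S := S) (by simpa [app] using h)

/-- secondary distance of a label -/
def df (l : K → ℕ) (th : E → MulAut K) (e : E × Bool) (x y : K) : ℕ := l (thb th e (x⁻¹ * y))

/-- the sides of the top-level region -/
def sides (l : K → ℕ) (th : E → MulAut K) : K → CD K E → List (TSide K)
  | _, nil => []
  | g, letter x T => ⟨fun _ _ => 0, g, g * x⟩ :: sides l th (g * x) T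
  | g, cor e T1 T => ⟨df l th (labInv e), g, g * thb th e (val th T1)⟩ ::
      sides l th (g * thb th e (val th T1)) T

theorem mem_sides (th : E → MulAut K) (s : TSide K) : ∀ (T : CD K E) (g : K), s ∈ sides l th g T →
    (∃ Z x S, T = app Z (letter x S) ∧ s = ⟨fun _ _ => 0, g * Z.val th, g * Z.val th * x⟩) ∨
    (∃ Z e T1 S, T = app Z (cor e T1 S) ∧
      s = ⟨df l th (labInv e), g * Z.val th, g * Z.val th * thb th e (val th T1)⟩)
  | nil, g, h => by simp [sides] at h
  | letter x T, g, h => by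
    simp only [sides, List.mem_cons] at h
    rcases h with h | h
    · exact Or.inl ⟨nil, x, T, rfl, by simp [h, val]⟩
    · rcases mem_sides th s T _ h with ⟨Z, y, S, h1, h2⟩ | ⟨Z, e, T1, S, h1, h2⟩
      · exact Or.inl ⟨letter x Z, y, S, by simp [app, h1], by simp [h2, val, mul_assoc]⟩
      · exact Or.inr ⟨letter x Z, e, T1, S, by simp [app, h1], by simp [h2, val, mul_assoc]⟩
  | cor e' T0 T, g, h => by
    simp only [sides, List.mem_cons] at h
    rcases h with h | h
    · exact Or.inr ⟨nil, e', T0, T, rfl, by simp [h, val]⟩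
    · rcases mem_sides th s T _ h with ⟨Z, y, S, h1, h2⟩ | ⟨Z, e, T1, S, h1, h2⟩
      · exact Or.inl ⟨cor e' T0 Z, y, S, by simp [app, h1], by simp [h2, val, mul_assoc]⟩
      · exact Or.inr ⟨cor e' T0 Z, e, T1, S, by simp [app, h1], by simp [h2, val, mul_assoc]⟩

theorem sides_chain (th : E → MulAut K) : ∀ (T : CD K E) (g : K) (u : TSide K), u.a = g * T.val th →
    List.IsChain (fun s t : TSide K => s.b = t.a) (sides l th g T ++ [u]) ∧
    ∀ z ∈ (sides l th g T ++ [u]).head?, z.a = g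
  | nil, g, u, h => by simp [sides, h, val]
  | letter x T, g, u, h => by
    have := sides_chain th T (g * x) u (by simp [h, val, mul_assoc])
    simp only [sides, List.cons_append, List.isChain_cons]
    refine ⟨⟨?_, this.1⟩, by simp⟩
    intro y hy; exact (this.2 y hy).symm
  | cor e T1 T, g, u, h => by
    have := sides_chain th T (g * thb th e (val th T1)) u (by simp [h, val, mul_assoc])
    simp only [sides, List.cons_append, List.isChain_cons]
    refine ⟨⟨?_, this.1⟩, by simp⟩
    intro y hy; exact (this.2 y hy).symm

end CD

/-- swapping lemma: same label overlaps are short in minimal diagrams -/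
theorem swap_overlap (h : TreeLen l) (B : ℕ) (f : K → K → ℕ)
    (hB : ∀ a m b, td l a m + td l m b = td l a b → f a m + f m b ≤ f a b + B)
    (htri : ∀ a m b, f a b ≤ f a m + f m b) (hsym : ∀ a b, f a b = f b a)
    (a b c d x y : K) (h1 : td l a x + td l x y + td l y b = td l a b)
    (h2 : td l c y + td l y x + td l x d = td l c d)
    (hmin : td l a b + f a b + td l c d + f c d ≤ td l a d + f a d + td l b c + f b c) :
    td l x y ≤ 2 * B := by
  have b1 := hB a x b (by
    have := h.d_tri a x b; have := h.d_tri x y b; omega)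
  have b2 := hB x y b (by
    have := h.d_tri a x b; have := h.d_tri x y b; omega)
  have b3 := hB c y d (by
    have := h.d_tri c y d; have := h.d_tri y x d; omega)
  have b4 := hB y x d (by
    have := h.d_tri c y d; have := h.d_tri y x d; omega)
  have := h.d_tri a x d
  have := h.d_tri b y c
  have := htri a x d
  have := htri b y c
  have := h.d_comm x y
  have := h.d_comm b y
  have := h.d_comm y c
  have := hsym b y
  have := hsym y c
  omega

namespace CD

section
variable (th : E → MulAut K)

theorem df_tri (h : TreeLen l) (e : E × Bool) (a m b : K) :
    df l th e a b ≤ df l th e a m + df l th e m b := by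
  unfold df
  have := h.mul_le (thb th e (a⁻¹ * m)) (thb th e (m⁻¹ * b))
  rw [← map_mul] at this
  simpa [mul_assoc] using this

theorem df_symm (h : TreeLen l) (e : E × Bool) (a b : K) :
    df l th e a b = df l th e b a := by
  unfold df
  rw [← h.inv, ← map_inv]; simp

/-- uniform bounded cancellation constants -/
def BC (l : K → ℕ) (th : E → MulAut K) (B : ℕ) : Prop :=
  ∀ e a m b, td l a m + td l m b = td l a b → df l th e a m + df l th e m b ≤ df l th e a b + B

theorem exists_BC (h : TreeLen l) [Finite E] : ∃ B, BC l th B := by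
  have : ∀ e : E × Bool, ∃ B : ℕ, ∀ a m b, td l a m + td l m b = td l a b →
      df l th e a m + df l th e m b ≤ df l th e a b + B := by
    intro e
    obtain ⟨B, hB⟩ := h.bcl h (thb th e)
    refine ⟨B, fun a m b hm => ?_⟩
    have := hB a m b hm
    simp only [td, ← map_inv, ← map_mul] at this
    exact this
  choose B hB using this
  obtain ⟨B0, hB0⟩ := (Set.finite_range B).bddAbove
  refine ⟨B0, fun e a m b hm => (hB e a m b hm).trans ?_⟩
  have := hB0 ⟨e, rfl⟩
  omega

/-- distinct labels stretch -/
def Distinct (l : K → ℕ) (th : E → MulAut K) (C : ℕ) : Prop :=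
  ∀ s s' : E × Bool, s ≠ s' → ∀ p, 3 * l p ≤ l (thb th s p) + l (thb th s' p) + C

variable {th}

theorem good_letter_left (h : TreeLen l) {C : ℕ} (hC : 3 ≤ C) (g x : K) (hx : l x ≤ 1) (f) (t : TSide K) :
    (TSide.mk f g (g * x)).Good l C t := by
  intro u v huv _
  simp only [TSide.On, TreeLen.d_mul] at huv
  omega

theorem good_letter_right (h : TreeLen l) {C : ℕ} (hC : 3 ≤ C) (g x : K) (hx : l x ≤ 1) (f) (t : TSide K) :
    t.Good l C (TSide.mk f g (g * x)) := by
  intro u v _ huv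
  simp only [TSide.On, TreeLen.d_mul] at huv
  have := h.d_comm u v
  omega

theorem good_cor_cor (h : TreeLen l) {B C : ℕ} (hB : BC l th B) (hd : Distinct l th C) (hBC : 6 * B ≤ C)
    (P Z S T1 T2 : CD K E) (e e' : E × Bool) (g : K)
    (hmin : (P.app (cor e T1 (Z.app (cor e' T2 S)))).Min l th) :
    (TSide.mk (df l th (labInv e)) g (g * thb th e (val th T1))).Good l C
      ⟨df l th (labInv e'), g * thb th e (val th T1) * Z.val th,
        g * thb th e (val th T1) * Z.val th * thb th e' (val th T2)⟩ := by
  intro x y hx hy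
  by_cases hee : e = e'
  · subst hee
    have hm := hmin (P.app (cor e (T1.app (cor (labInv e) Z T2)) S)) (by
      simp [word_app, word, labInv_labInv])
    simp only [M_app, M, val_app, val, map_mul, thb_labInv_apply'] at hm
    have := swap_overlap h B (df l th (labInv e)) (hB _) (df_tri th h _) (df_symm th h _)
      g (g * thb th e (val th T1)) (g * thb th e (val th T1) * Z.val th)
      (g * thb th e (val th T1) * Z.val th * thb th e (val th T2)) x y hx hy (by
        have e1 : g⁻¹ * (g * thb th e (val th T1) * Z.val th * thb th e (val th T2)) =
          thb th e (val th T1) * Z.val th * thb th e (val th T2) := by group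
        simp only [df, td, e1, inv_mul_cancel_left]
        simp only [thb_labInv_apply, mul_assoc, map_mul]
        omega)
    have : 3 * td l x y ≤ C := by omega
    omega
  · have := hd (labInv e) (labInv e') (by
      intro hh; apply hee
      have := congrArg labInv hh
      simpa [labInv_labInv] using this) (x⁻¹ * y)
    simp only
    rw [df_symm th h (labInv e') y x]
    exact this

theorem good_cor_outer (h : TreeLen l) {B C : ℕ} (hB : BC l th B) (hd : Distinct l th C) (hBC : 6 * B ≤ C)
    (P S T1 : CD K E) (e e' : E × Bool)
    (hmin : (cor e' (P.app (cor e T1 S)) nil).Min l th) :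
    (TSide.mk (df l th (labInv e)) (P.val th) (P.val th * thb th e (val th T1))).Good l C
      ⟨df l th e', (P.app (cor e T1 S)).val th, 1⟩ := by
  intro x y hx hy
  by_cases hee : labInv e = e'
  · have hee' : e = labInv e' := by rw [← hee, labInv_labInv]
    subst hee'
    have hm := hmin (cor e' P (T1.app (cor e' S nil))) (by
      simp [word_app, word, labInv_labInv])
    simp only [labInv_labInv] at *
    simp only [M_app, M, val_app, val, map_mul, thb_labInv_apply'] at hm
    have := swap_overlap h B (df l th e') (hB _) (df_tri th h _) (df_symm th h _)
      (P.val th) (P.val th * thb th (labInv e') (val th T1)) ((P.app (cor (labInv e') T1 S)).val th)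
      1 x y hx hy (by
        rw [df_symm th h _ _ 1, h.d_comm _ 1, df_symm th h _ (P.val th) 1, h.d_comm (P.val th) 1]
        simp only [df, inv_mul_cancel_left, thb_labInv_apply', td, map_mul, val_app, val,
          inv_one, one_mul, mul_inv_rev, inv_mul_cancel_left]
        have e1 : (thb th (labInv e') (val th T1))⁻¹ * (val th P)⁻¹ *
          (val th P * (thb th (labInv e') (val th T1) * val th S)) = val th S := by group
        have e2 : (thb th e' ((thb th (labInv e')) (val th T1))⁻¹) * (thb th e' (val th P)⁻¹) *
          (thb th e' (val th P) * (val th T1 * thb th e' (val th S))) = thb th e' (val th S) := by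
          simp only [map_inv, thb_labInv_apply']; group
        rw [e1, e2]
        omega)
    have : 3 * td l x y ≤ C := by omega
    omega
  · have := hd (labInv e) e' hee (x⁻¹ * y)
    show 3 * td l x y ≤ df l th (labInv e) x y + df l th e' y x + C
    rw [df_symm th h e' y x]
    exact this

/-- all letters are short -/
def Short (l : K → ℕ) (w : List (K ⊕ (E × Bool))) : Prop := ∀ x, Sum.inl x ∈ w → l x ≤ 1

theorem pairwise_sides (h : TreeLen l) {B C : ℕ} (hB : BC l th B) (hd : Distinct l th C) (hBC : 6 * B ≤ C)
    (hC : 3 ≤ C) : ∀ (T P : CD K E) (g : K), (P.app T).Min l th → Short l T.word →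
    (sides l th g T).Pairwise (TSide.Good l C)
  | nil, P, g, _, _ => by simp [sides]
  | letter x T, P, g, hm, hs => by
    simp only [sides, List.pairwise_cons]
    refine ⟨fun t _ => good_letter_left h hC g x (hs x (by simp [word])) _ t, ?_⟩
    refine pairwise_sides h hB hd hBC hC T (P.app (letter x nil)) _ (by
      rw [app_assoc]; simpa [app] using hm) (fun y hy => hs y (by simp [word, hy]))
  | cor e T1 T, P, g, hm, hs => by
    simp only [sides, List.pairwise_cons]
    refine ⟨?_, ?_⟩
    · intro t ht
      rcases mem_sides th t T _ ht with ⟨Z, y, S, h1, h2⟩ | ⟨Z, e', T2, S, h1, h2⟩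
      · rw [h2]
        refine good_letter_right h hC _ _ (hs y (by simp [word, h1, word_app])) _ _
      · rw [h2]
        subst h1
        exact good_cor_cor h hB hd hBC P Z S T1 T2 e e' g hm
    · refine pairwise_sides h hB hd hBC hC T (P.app (cor e T1 nil)) _ (by
        rw [app_assoc]; simpa [app] using hm) (fun y hy => hs y (by simp [word, hy]))

theorem bc_sides (h : TreeLen l) {B : ℕ} (hB : BC l th B) : ∀ (T : CD K E) (g : K),
    ∀ s ∈ sides l th g T, s.Bc l B := by
  intro T g s hs
  rcases mem_sides th s T _ hs with ⟨Z, y, S, h1, h2⟩ | ⟨Z, e', T2, S, h1, h2⟩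
  · subst h2; intro a m b _; simp
  · subst h2; exact hB _

/-- sum of side lengths -/
def slen (l : K → ℕ) (th : E → MulAut K) : CD K E → ℕ
  | nil => 0
  | letter x T => l x + slen l th T
  | cor e T1 T => l (thb th e (val th T1)) + slen l th T

/-- sum of secondary lengths -/
def sf (l : K → ℕ) (th : E → MulAut K) : CD K E → ℕ
  | nil => 0
  | letter _ T => sf l th T
  | cor _ T1 T => l (val th T1) + sf l th T

/-- number of items -/
def items : CD K E → ℕ
  | nil => 0
  | letter _ T => 1 + items T
  | cor _ _ T => 1 + items T

theorem sum_slen : ∀ (T : CD K E) (g : K), ((sides l th g T).map (TSide.len l)).sum = slen l th T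
  | nil, g => by simp [sides, slen]
  | letter x T, g => by simp [sides, slen, sum_slen T, TSide.len, td]
  | cor e T1 T, g => by simp [sides, slen, sum_slen T, TSide.len, td]

theorem sum_sf : ∀ (T : CD K E) (g : K), ((sides l th g T).map (fun s => s.f s.a s.b)).sum = sf l th T
  | nil, g => by simp [sides, sf]
  | letter x T, g => by simp [sides, sf, sum_sf T]
  | cor e T1 T, g => by simp [sides, sf, sum_sf T, df, thb_labInv_apply]

theorem length_sides : ∀ (T : CD K E) (g : K), (sides l th g T).length = items T
  | nil, g => by simp [sides, items]
  | letter x T, g => by simp [sides, items, length_sides T]; omega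
  | cor e T1 T, g => by simp [sides, items, length_sides T]; omega

theorem region_T (h : TreeLen l) {B C : ℕ} (hB : BC l th B) (hd : Distinct l th C) (hBC : 6 * B ≤ C)
    (hC : 3 ≤ C) (T : CD K E) (hm : T.Min l th) (hs : Short l T.word) (f0 : K → K → ℕ)
    (hf0 : (TSide.mk f0 (T.val th) 1).Bc l B)
    (hgood : ∀ s ∈ sides l th 1 T, s.Good l C ⟨f0, T.val th, 1⟩) :
    3 * (slen l th T + l (T.val th)) ≤ 2 * (sf l th T + f0 (T.val th) 1) + (4 * C + 6 * B) * (items T + 1) := by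
  have hch := sides_chain (l := l) th T 1 ⟨f0, T.val th, 1⟩ (by simp)
  have := region h 1 B C (sides l th 1 T ++ [⟨f0, T.val th, 1⟩]) hch.1 hch.2 (by simp) (by
    rw [List.pairwise_append]
    refine ⟨pairwise_sides h hB hd hBC hC T nil 1 hm hs, by simp, ?_⟩
    intro a ha b hb
    simp at hb; subst hb; exact hgood a ha) (by
    intro s hs
    rw [List.mem_append, List.mem_singleton] at hs
    rcases hs with hs | rfl
    · exact bc_sides h hB T 1 s hs
    · exact hf0)
  simpa [sum_slen, sum_sf, length_sides, TSide.len, h.d_one'] using this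

theorem inner_bound (h : TreeLen l) {B C : ℕ} (hB : BC l th B) (hd : Distinct l th C) (hBC : 6 * B ≤ C)
    (hC : 3 ≤ C) : ∀ (T : CD K E), T.Min l th → Short l T.word →
    M l th T + 2 * sf l th T + (4 * C + 6 * B) * items T ≤ 3 * slen l th T + (4 * C + 6 * B) * T.word.length
  | nil, _, _ => by simp [M, sf, items, slen, word]
  | letter x T, hm, hs => by
    have := inner_bound h hB hd hBC hC T hm.letter_right (fun y hy => hs y (by simp [word, hy]))
    simp only [M, sf, items, slen, word, List.length_cons]
    nlinarith
  | cor e T1 T, hm, hs => by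
    have h1 := inner_bound h hB hd hBC hC T hm.cor_right (fun y hy => hs y (by simp [word, hy]))
    have hs1 : Short l T1.word := (fun y hy => hs y (by simp [word, hy]))
    have h2 := inner_bound h hB hd hBC hC T1 hm.inner hs1
    have h3 := region_T h hB hd hBC hC T1 hm.inner hs1 (df l th e) (hB e) (by
      intro s hss
      rcases mem_sides th s T1 _ hss with ⟨Z, y, S, h1, h2⟩ | ⟨Z, e', T2, S, h1, h2⟩
      · rw [h2]
        refine good_letter_left h hC _ _ (hs1 y (by simp [word, h1, word_app])) _ _
      · rw [h2]
        have := hm.cor_left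
        rw [h1] at this ⊢
        simpa using good_cor_outer h hB hd hBC Z S T2 e' e this)
    have : df l th e (val th T1) 1 = l (thb th e (val th T1)) := by
      rw [df_symm th h]; simp [df]
    rw [this] at h3
    simp only [M, sf, items, slen, word, List.length_cons, List.length_append]
    nlinarith

theorem root_bound (h : TreeLen l) {B C : ℕ} (hB : BC l th B) (hd : Distinct l th C) (hBC : 6 * B ≤ C)
    (hC : 3 ≤ C) (T : CD K E) (hm : T.Min l th) (hs : Short l T.word)
    (hout : ∀ a p b, T.val th = a * p * b → l a + l p + l b = l (T.val th) →
      ∀ s, 3 * l p ≤ l (thb th s p) + C) :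
    M l th T + 3 * l (T.val th) ≤ (4 * C + 6 * B) * (T.word.length + 1) := by
  have h1 := inner_bound h hB hd hBC hC T hm hs
  have h2 := region_T h hB hd hBC hC T hm hs (fun _ _ => 0) (by intro a m b _; simp) (by
      intro s hss
      rcases mem_sides th s T _ hss with ⟨Z, y, S, h1, h2⟩ | ⟨Z, e', T2, S, h1, h2⟩
      · rw [h2]
        refine good_letter_left h hC _ _ (hs y (by simp [word, h1, word_app])) _ _
      · rw [h2]
        intro x y hx hy
        simp only [TSide.On] at hy
        rw [h.d_one', h.d_one'] at hy
        have := hout x (x⁻¹ * y) (y⁻¹ * T.val th) (by group) (by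
          have := h.d_comm (val th T) y
          have := h.d_comm y x
          simp only [td] at *
          omega) (labInv e')
        simpa [df, td] using this)
  nlinarith

end

/-- projection of words to labels -/
def proj (w : List (K ⊕ (E × Bool))) : List (E × Bool) := w.filterMap Sum.getRight?

theorem proj_append (w v : List (K ⊕ (E × Bool))) : proj (w ++ v) = proj w ++ proj v := by
  simp [proj]

theorem drop_letters : ∀ (Z V : List (K ⊕ (E × Bool))) (T : CD K E), T.word = Z ++ V → proj Z = [] →
    ∃ T1 T' : CD K E, T1.word = Z ∧ T'.word = V
  | [], V, T, h, _ => ⟨nil, T, rfl, by simpa using h⟩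
  | Sum.inr e :: Z, V, T, h, hz => by simp [proj] at hz
  | Sum.inl x :: Z, V, T, h, hz => by
    cases T with
    | nil => simp [word] at h
    | cor e T1 T => simp [word] at h
    | letter y T =>
      simp [word] at h
      obtain ⟨T1, T', h1, h2⟩ := drop_letters Z V T h.2 (by simpa [proj] using hz)
      exact ⟨letter x T1, T', by simp [word, h1], h2⟩

theorem insert (e : E × Bool) (Z : List (K ⊕ (E × Bool))) (hZ : proj Z = []) :
    ∀ (T : CD K E) (U V : List (K ⊕ (E × Bool))), T.word = U ++ Z ++ V →
    ∃ T' : CD K E, T'.word = U ++ Sum.inr e :: Z ++ Sum.inr (labInv e) :: V := by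
  have base : ∀ (T : CD K E) (V : List (K ⊕ (E × Bool))), T.word = Z ++ V →
    ∃ T' : CD K E, T'.word = Sum.inr e :: Z ++ Sum.inr (labInv e) :: V := by
    intro T V h
    obtain ⟨T1, T', h1, h2⟩ := drop_letters Z V T h hZ
    exact ⟨cor e T1 T', by simp [word, h1, h2]⟩
  intro T
  induction T with
  | nil =>
    intro U V h
    simp [word] at h
    obtain ⟨rfl, h2, rfl⟩ := h
    simpa using base nil [] (by simp [word, h2])
  | letter x T ih =>
    intro U V h
    cases U with
    | nil => simpa using base _ V (by simpa using h)
    | cons u U =>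
      simp [word] at h
      obtain ⟨T', hT'⟩ := ih U V (by simp [h.2])
      exact ⟨letter x T', by simp [word, hT', h.1]⟩
  | cor e0 T1 T ih1 ih =>
    intro U V h
    cases U with
    | nil => simpa using base _ V (by simpa using h)
    | cons u U =>
      simp only [word, List.cons_append, List.cons.injEq] at h
      obtain ⟨rfl, h⟩ := h
      rcases List.append_eq_append_iff.1 h with ⟨as, h1, h2⟩ | ⟨bs, h1, h2⟩
      · -- U ++ Z = word T1 ++ as
        rcases List.append_eq_append_iff.1 h1 with ⟨cs, h3, h4⟩ | ⟨cs, h3, h4⟩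
        · -- word T1 = U ++ cs, Z = cs ++ as
          cases as with
          | nil =>
            obtain ⟨T', hT'⟩ := ih1 U [] (by simpa using h1.symm)
            refine ⟨cor e0 T' T, ?_⟩
            simp at h2
            simp [word, hT', ← h2]
          | cons q as =>
            simp at h2
            obtain ⟨rfl, h2⟩ := h2
            rw [h4] at hZ
            simp [proj] at hZ
        · -- U = word T1 ++ cs
          cases cs with
          | nil =>
            simp at h4 h3
            subst h4
            obtain ⟨T', hT'⟩ : ∃ T' : CD K E, T'.word = as := by
              obtain ⟨T', _, h', _⟩ := drop_letters as [] (CD.nil : CD K E) (by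
                cases as with
                | nil => simp [word]
                | cons q as =>
                  simp at h2
                  rw [← h2.1] at hZ
                  simp [proj] at hZ) hZ
              exact ⟨T', h'⟩
            cases as with
            | nil =>
              simp at h2
              refine ⟨cor e0 (T1.app (cor e nil nil)) T, ?_⟩
              simp [word, word_app, h3, ← h2]
            | cons q as =>
              simp at h2
              rw [← h2.1] at hZ
              simp [proj] at hZ
          | cons c cs =>
            subst h4
            simp at h2
            obtain ⟨rfl, h2⟩ := h2
            obtain ⟨T', hT'⟩ := ih cs V (by simp [h2])
            refine ⟨cor e0 T1 T', ?_⟩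
            simp [word, hT', h3]
      · -- word T1 = U ++ Z ++ bs
        obtain ⟨T', hT'⟩ := ih1 U bs (by simp [h1])
        refine ⟨cor e0 T' T, ?_⟩
        simp [word, hT', h2]

theorem proj_cons_decomp : ∀ (w : List (K ⊕ (E × Bool))) (p : List (E × Bool)) (e : E × Bool) (q : List (E × Bool)),
    proj w = p ++ e :: q → ∃ u v, w = u ++ Sum.inr e :: v ∧ proj u = p ∧ proj v = q
  | [], p, e, q, h => by simp [proj] at h
  | Sum.inl x :: w, p, e, q, h => by
    obtain ⟨u, v, h1, h2, h3⟩ := proj_cons_decomp w p e q h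
    exact ⟨Sum.inl x :: u, v, by simp [h1], h2, h3⟩
  | Sum.inr e' :: w, [], e, q, h => by
    simp [proj] at h
    exact ⟨[], w, by simp [h.1], rfl, h.2⟩
  | Sum.inr e' :: w, e'' :: p, e, q, h => by
    simp [proj] at h
    obtain ⟨u, v, h1, h2, h3⟩ := proj_cons_decomp w p e q h.2
    exact ⟨Sum.inr e' :: u, v, by simp [h1], by simp [proj, h.1]; exact h2, h3⟩

theorem exists_CD : ∀ (n : ℕ) (w : List (K ⊕ (E × Bool))), (proj w).length = n →
    FreeGroup.mk (proj w) = 1 → ∃ T : CD K E, T.word = w := by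
  intro n
  induction n using Nat.strong_induction_on with
  | _ n ih =>
  intro w hn hw
  rw [FreeGroup.one_eq_mk] at hw
  have hred : FreeGroup.Red (proj w) [] := by
    obtain ⟨c, h1, h2⟩ := FreeGroup.Red.exact.1 hw
    rw [FreeGroup.Red.nil_iff] at h2
    rwa [h2] at h1
  rcases Relation.ReflTransGen.cases_head hred with h0 | ⟨c, h1, h2⟩
  · clear hred hw ih hn
    induction w with
    | nil => exact ⟨nil, rfl⟩
    | cons x w ih =>
      cases x with
      | inr e => simp [proj] at h0
      | inl x =>
        obtain ⟨T, hT⟩ := ih (by simpa [proj] using h0)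
        exact ⟨letter x T, by simp [word, hT]⟩
  · generalize hpw : proj w = pw at h1
    cases h1 with
    | @not L1 L2 x b =>
      obtain ⟨u, v, rfl, hu, hv⟩ := proj_cons_decomp w L1 (x, b) _ hpw
      obtain ⟨Z, v', rfl, hZ, hv'⟩ := proj_cons_decomp v [] (x, !b) L2 (by simpa using hv)
      obtain ⟨T, hT⟩ := ih (L1.length + L2.length) (by rw [← hn, hpw]; simp) (u ++ Z ++ v')
        (by simp [proj_append, hu, hZ, hv']) (by
          simp only [proj_append, hu, hZ, hv', List.append_nil]
          rw [FreeGroup.one_eq_mk]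
          exact FreeGroup.Red.exact.2 ⟨[], h2, Relation.ReflTransGen.refl⟩)
      obtain ⟨T', hT'⟩ := insert (x, b) Z hZ T u v' hT
      exact ⟨T', by simp [hT', labInv]⟩

theorem exists_min (th : E → MulAut K) (w : List (K ⊕ (E × Bool))) (h : ∃ T : CD K E, T.word = w) :
    ∃ T : CD K E, T.word = w ∧ T.Min l th := by
  classical
  have : ∃ n, ∃ T : CD K E, T.word = w ∧ T.M l th = n := by
    obtain ⟨T, hT⟩ := h
    exact ⟨_, T, hT, rfl⟩
  obtain ⟨T, h1, h2⟩ := Nat.find_spec this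
  refine ⟨T, h1, fun T' hT' => ?_⟩
  rw [h2]
  exact Nat.find_min' this ⟨T', by rw [hT', h1], rfl⟩

end CD

/-- Main corridor theorem. -/
theorem corridor (h : TreeLen l) [Finite E] (th : E → MulAut K) (C : ℕ) (hd : CD.Distinct l th C) :
    ∃ C' : ℕ, ∀ w : List (K ⊕ (E × Bool)), CD.Short l w → FreeGroup.mk (CD.proj w) = 1 →
      ∃ T : CD K E, T.word = w ∧ ((∀ a p b, T.val th = a * p * b → l a + l p + l b = l (T.val th) →
      ∀ s, 3 * l p ≤ l (thb th s p) + C) → T.M l th + 3 * l (T.val th) ≤ C' * (w.length + 1)) := by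
  obtain ⟨B, hB⟩ := CD.exists_BC th h
  set C1 := C + 6 * B + 3 with hC1
  have hd' : CD.Distinct l th C1 := fun s s' hs p => (hd s s' hs p).trans (by omega)
  refine ⟨4 * C1 + 6 * B, fun w hs hw => ?_⟩
  obtain ⟨T, hT, hm⟩ := CD.exists_min (l := l) th w (CD.exists_CD _ w rfl hw)
  refine ⟨T, hT, fun hout => ?_⟩
  subst hT
  exact CD.root_bound h hB hd' (by omega) (by omega) T hm hs
    (fun a p b h1 h2 s => (hout a p b h1 h2 s).trans (by omega))

end Corridors

section IsoCriterion

/-- graph metrics -/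
structure GMet {X : Type*} (d : X → X → ℕ) : Prop where
  self : ∀ x, d x x = 0
  comm : ∀ x y, d x y = d y x
  tri : ∀ x y z, d x z ≤ d x y + d y z
  geod : ∀ x y, ∃ g : ℕ → X, g 0 = x ∧ g (d x y) = y ∧
    ∀ i j, i ≤ j → j ≤ d x y → d (g i) (g j) = j - i

/-- the quadratic form -/
def om {X : Type*} (u v : X → ℤ) (x y : X) : ℤ := (u x + u y) * (v y - v x)

/-- paths with integral -/
inductive PI {X : Type*} (d : X → X → ℕ) (u v : X → ℤ) : X → X → ℕ → ℤ → Prop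
  | nil (x) : PI d u v x x 0 0
  | cons (x y z n I) : d x y ≤ 1 → PI d u v y z n I → PI d u v x z (n + 1) (om u v x y + I)

/-- paths in a set -/
inductive PS {X : Type*} (d : X → X → ℕ) (A : X → Prop) : X → X → ℕ → Prop
  | nil (x) : A x → PS d A x x 0
  | cons (x y z n) : A x → d x y ≤ 1 → PS d A y z n → PS d A x z (n + 1)

/-- 1-Lipschitz -/
def Lip1 {X : Type*} (d : X → X → ℕ) (u : X → ℤ) : Prop := ∀ x y, u x - u y ≤ d x y

variable {X : Type*} {d : X → X → ℕ}

theorem PI.trans {u v : X → ℤ} {x y z : X} {n m : ℕ} {I J : ℤ} (h1 : PI d u v x y n I)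
    (h2 : PI d u v y z m J) : PI d u v x z (n + m) (I + J) := by
  induction h1 with
  | nil x => simpa using h2
  | cons x y w n I h _ ih =>
    have := PI.cons x y z _ _ h (ih h2)
    convert this using 1
    · omega
    · ring

theorem PS.trans {A : X → Prop} {x y z : X} {n m : ℕ} (h1 : PS d A x y n)
    (h2 : PS d A y z m) : PS d A x z (n + m) := by
  induction h1 with
  | nil x => simpa using h2
  | cons x y w n hx h _ ih =>
    have := PS.cons x y z _ hx h (ih h2)
    convert this using 1
    omega

theorem PS.mono {A A' : X → Prop} (hA : ∀ x, A x → A' x) {x y : X} {n : ℕ} (h1 : PS d A x y n) :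
    PS d A' x y n := by
  induction h1 with
  | nil x hx => exact PS.nil x (hA x hx)
  | cons x y w n hx h _ ih => exact PS.cons _ _ _ _ (hA x hx) h ih

theorem PS.last {A : X → Prop} {x y : X} {n : ℕ} (h1 : PS d A x y n) : A y := by
  induction h1 with
  | nil x hx => exact hx
  | cons x y w n hx h _ ih => exact ih

theorem PS.symm (hd : GMet d) {A : X → Prop} {x y : X} {n : ℕ} (h1 : PS d A x y n) : PS d A y x n := by
  induction h1 with
  | nil x hx => exact PS.nil x hx
  | cons x y w n hx h h2 ih =>
    have hy : A y := by cases h2 <;> assumption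
    exact ih.trans (PS.cons y x x 0 hy (by rw [hd.comm]; exact h) (PS.nil x hx))

theorem PS.toPI {u v : X → ℤ} {A : X → Prop} {c : ℤ} (hc : ∀ x, A x → u x = c) {x y : X} {n : ℕ}
    (h1 : PS d A x y n) : PI d u v x y n (2 * c * (v y - v x)) := by
  induction h1 with
  | nil x hx => simpa using PI.nil x
  | cons x y w n hx h h2 ih =>
    have hy : A y := by cases h2 <;> assumption
    have := PI.cons x y w _ _ h ih
    convert this using 1
    rw [om, hc x hx, hc y hy]; ring

/-- a sequence with small steps gives a path -/
theorem PS.ofSeq (A : X → Prop) (g : ℕ → X) : ∀ (n i : ℕ), (∀ k, i ≤ k → k ≤ i + n → A (g k)) →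
    (∀ k, i ≤ k → k < i + n → d (g k) (g (k + 1)) ≤ 1) → PS d A (g i) (g (i + n)) n
  | 0, i, hA, _ => PS.nil _ (hA i le_rfl (by omega))
  | n + 1, i, hA, hs => by
    have := PS.ofSeq A g n (i + 1) (fun k h1 h2 => hA k (by omega) (by omega))
      (fun k h1 h2 => hs k (by omega) (by omega))
    have := PS.cons (g i) _ _ _ (hA i le_rfl (by omega)) (hs i le_rfl (by omega)) this
    rwa [show i + 1 + n = i + (n + 1) by omega] at this

theorem PI.ofSeq {u v : X → ℤ} (g : ℕ → X) : ∀ (n i : ℕ),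
    (∀ k, i ≤ k → k < i + n → d (g k) (g (k + 1)) ≤ 1 ∧ om u v (g k) (g (k + 1)) = 0) →
    PI d u v (g i) (g (i + n)) n 0
  | 0, i, _ => PI.nil _
  | n + 1, i, hs => by
    have := PI.ofSeq g n (i + 1) (fun k h1 h2 => hs k (by omega) (by omega))
    have := PI.cons (g i) _ _ _ _ (hs i le_rfl (by omega)).1 this
    rw [(hs i le_rfl (by omega)).2] at this
    rwa [show i + 1 + n = i + (n + 1) by omega] at this

/-- isoperimetric condition -/
def Iso (d : X → X → ℕ) (C : ℕ) : Prop :=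
  ∀ u v : X → ℤ, Lip1 d u → Lip1 d v → ∀ x n I, PI d u v x x n I → |I| ≤ C * n

theorem PS.ofGeod (hd : GMet d) (x y : X) (A : X → Prop)
    (hA : ∀ z, d x z ≤ d x y → A z) : PS d A x y (d x y) := by
  obtain ⟨g, g0, g1, hg⟩ := hd.geod x y
  have := PS.ofSeq (d := d) A g (d x y) 0 (fun k _ h => hA _ (by
    have := hg 0 k (by omega) (by omega)
    rw [g0] at this; omega)) (fun k h1 h2 => by
      have := hg k (k + 1) (by omega) (by omega); omega)
  rwa [g0, Nat.zero_add, g1] at this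

theorem morse (hd : GMet d) {C : ℕ} (hI : Iso d C) (A : X → Prop)
    (hA : ∀ p q, A p → A q → ∃ n, n ≤ 3 * d p q ∧ PS d A p q n)
    (g : ℕ → X) (N : ℕ) (hg : ∀ i j, i ≤ j → j ≤ N → d (g i) (g j) = j - i) (h0 : A (g 0)) (hN : A (g N))
    (k : ℕ) (hk : k ≤ N) : ∃ a, A a ∧ d (g k) a ≤ 48 * C + 1 := by
  classical
  -- distance to A
  have hex : ∀ x : X, ∃ n, ∃ a, A a ∧ d x a = n := fun x => ⟨_, _, h0, rfl⟩
  let D : X → ℕ := fun x => Nat.find (hex x)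
  have D1 : ∀ x, ∃ a, A a ∧ d x a = D x := fun x => Nat.find_spec (hex x)
  have D2 : ∀ x a, A a → D x ≤ d x a := fun x a ha => Nat.find_min' (hex x) ⟨a, ha, rfl⟩
  obtain ⟨k0, hk0, hmax⟩ := Finset.exists_max_image (Finset.range (N + 1)) (fun i => D (g i)) ⟨0, by simp⟩
  simp only [Finset.mem_range] at hk0 hmax
  set t := D (g k0) with ht
  suffices hts : t ≤ 48 * C + 1 by
    obtain ⟨a, ha, ha'⟩ := D1 (g k)
    exact ⟨a, ha, by have := hmax k (by omega); omega⟩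
  by_contra hcon
  push Not at hcon
  obtain ⟨s, hs⟩ : ∃ s, s = t / 2 := ⟨_, rfl⟩
  have hk0t : t ≤ k0 := by
    have := D2 (g k0) (g 0) h0
    rw [hd.comm, hg 0 k0 (by omega) (by omega)] at this; omega
  have hNt : t ≤ N - k0 := by
    have := D2 (g k0) (g N) hN
    rw [hg k0 N (by omega) (by omega)] at this; omega
  obtain ⟨a, ha⟩ : ∃ a, a = k0 - 3 * t := ⟨_, rfl⟩
  obtain ⟨b, hb⟩ : ∃ b, b = min (k0 + 3 * t) N := ⟨_, rfl⟩
  set p := g k0 with hp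
  let u : X → ℤ := fun x => max 0 (min (d x p : ℤ) t - s)
  let v : X → ℤ := fun x => max ((k0 - a : ℕ) - s : ℤ) (min (d x (g a) : ℤ) ((k0 - a : ℕ) + s : ℤ))
  have hu : Lip1 d u := by
    intro x y
    have := hd.tri x y p
    simp only [u]; omega
  have hv : Lip1 d v := by
    intro x y
    have := hd.tri x y (g a)
    simp only [v]; omega
  -- points near the ends
  have ha' : ∃ a', A a' ∧ d (g a) a' ≤ t ∧ (∀ z, d (g a) z ≤ d (g a) a' → t ≤ d z p) := by
    by_cases haz : a = 0
    · refine ⟨g 0, h0, by rw [haz, hd.self]; omega, ?_⟩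
      intro z hz
      rw [haz, hd.self] at hz
      have := hg 0 k0 (by omega) (by omega)
      have := hd.tri (g 0) z p
      rw [← hp] at *
      omega
    · obtain ⟨a', h1, h2⟩ := D1 (g a)
      have h3 := hmax a (by omega)
      refine ⟨a', h1, by omega, ?_⟩
      intro z hz
      have := hg a k0 (by omega) (by omega)
      have := hd.tri (g a) z p
      rw [← hp] at *
      omega
  have hb' : ∃ b', A b' ∧ d (g b) b' ≤ t ∧ (∀ z, d (g b) z ≤ d (g b) b' → t ≤ d z p) := by
    by_cases hbz : b = N
    · refine ⟨g N, hN, by rw [hbz, hd.self]; omega, ?_⟩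
      intro z hz
      rw [hbz, hd.self] at hz
      have := hg k0 N (by omega) (by omega)
      have := hd.tri (g N) z p
      have := hd.comm p (g N)
      rw [← hp] at *
      omega
    · obtain ⟨b', h1, h2⟩ := D1 (g b)
      have h3 := hmax b (by omega)
      refine ⟨b', h1, by omega, ?_⟩
      intro z hz
      have := hg k0 b (by omega) (by omega)
      have := hd.tri (g b) z p
      have := hd.comm p (g b)
      rw [← hp] at *
      omega
  obtain ⟨a', A1, A2, A3⟩ := ha'
  obtain ⟨b', B1, B2, B3⟩ := hb'
  obtain ⟨n, hn1, hn2⟩ := hA b' a' B1 A1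
  let F : X → Prop := fun z => t ≤ d z p
  have huF : ∀ z, F z → u z = (t - s : ℤ) := by
    intro z hz
    have : t ≤ d z p := hz
    simp only [u]; omega
  have P1 : PS d F (g b) b' (d (g b) b') := PS.ofGeod hd _ _ _ B3
  have P3 : PS d F (g a) a' (d (g a) a') := PS.ofGeod hd _ _ _ A3
  have P2 : PS d F b' a' n := hn2.mono (fun x hx => by
    have := D2 p x hx
    have := hd.comm p x
    show t ≤ d x p
    omega)
  have P4 := ((P1.trans P2).trans (P3.symm hd)).toPI (u := u) (v := v) huF
  have P5 : PI d u v (g a) (g (a + (b - a))) (b - a) 0 := by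
    apply PI.ofSeq
    intro k h1 h2
    have e1 := hg a k (by omega) (by omega)
    have e2 := hg a (k + 1) (by omega) (by omega)
    have c1 := hd.comm (g a) (g k)
    have c2 := hd.comm (g a) (g (k + 1))
    refine ⟨by have := hg k (k + 1) (by omega) (by omega); omega, ?_⟩
    unfold om
    by_cases hcase : k0 ≤ k + s ∧ k + 1 ≤ k0 + s
    · have f1 : d (g k) p ≤ s := by
        rcases le_total k k0 with h | h
        · have := hg k k0 h (by omega)
          rw [← hp] at this; omega
        · have := hg k0 k h (by omega)
          rw [← hp, hd.comm] at this; omega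
      have f2 : d (g (k + 1)) p ≤ s := by
        rcases le_total (k + 1) k0 with h | h
        · have := hg (k + 1) k0 h (by omega)
          rw [← hp] at this; omega
        · have := hg k0 (k + 1) h (by omega)
          rw [← hp, hd.comm] at this; omega
      have : u (g k) = 0 := by simp only [u]; omega
      have : u (g (k + 1)) = 0 := by simp only [u]; omega
      simp [*]
    · have : v (g (k + 1)) = v (g k) := by
        simp only [v]; omega
      simp [this]
  rw [show a + (b - a) = b by omega] at P5
  have P6 := P5.trans P4
  have hfin := hI u v hu hv _ _ _ P6
  have hva : v (g a) = (k0 - a : ℕ) - s := by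
    have := hd.self (g a)
    simp only [v]; omega
  have hvb : v (g b) = (k0 - a : ℕ) + s := by
    have e1 := hg a b (by omega) (by omega)
    have c1 := hd.comm (g a) (g b)
    simp only [v]; omega
  rw [hva, hvb] at hfin
  have hlen : b - a + (d (g b) b' + n + d (g a) a') ≤ 32 * t := by
    have q1 := hd.tri b' (g b) a'
    have q2 := hd.tri (g b) (g a) a'
    have q3 := hg a b (by omega) (by omega)
    have := hd.comm (g a) (g b)
    have := hd.comm b' (g b)
    omega
  have hst : (s : ℤ) ≤ t - s := by omega
  have hlen' : ((b - a + (d (g b) b' + n + d (g a) a') : ℕ) : ℤ) ≤ 32 * t := by exact_mod_cast hlen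
  have h9 : 4 * (s : ℤ) * (t - s) ≤ C * (32 * t) := by
    have e : (0 + 2 * ((t : ℤ) - s) * ((((k0 - a : ℕ) : ℤ) - s) - (((k0 - a : ℕ) : ℤ) + s))) = - (4 * s * (t - s)) := by ring
    rw [e, abs_neg] at hfin
    refine (le_abs_self _).trans (hfin.trans ?_)
    exact mul_le_mul_of_nonneg_left hlen' (by positivity)
  have ht2 : (t : ℤ) ≤ 2 * s + 1 := by omega
  have hs24 : (24 * C : ℤ) < s := by omega
  have hs1 : (1 : ℤ) ≤ s := by omega
  have hC0 : (0 : ℤ) ≤ C := by positivity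
  nlinarith

/-- coarse projections -/
theorem coarse_proj (hd : GMet d) {C : ℕ} (hI : Iso d C) (g : ℕ → X) (N : ℕ)
    (hg : ∀ i j, i ≤ j → j ≤ N → d (g i) (g j) = j - i) (z : X) (k : ℕ) (hk : k ≤ N)
    (hmin : ∀ j ≤ N, d z (g k) ≤ d z (g j)) :
    d (g 0) (g k) + d (g k) z ≤ d (g 0) z + 2 * (5 * (48 * C + 1) + 3) := by
  obtain ⟨f, f0, f1, hf⟩ := hd.geod (g k) z
  obtain ⟨e, e0, e1, he⟩ := hd.geod (g 0) z
  set T := 48 * C + 1 with hT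
  set R := d (g k) z with hR
  let A1 : X → Prop := fun x => ∃ i ≤ k, x = g i
  let A2 : X → Prop := fun x => ∃ i ≤ R, x = f i
  let A : X → Prop := fun x => A1 x ∨ A2 x
  have pA1 : ∀ i j, i ≤ j → j ≤ k → PS d A (g i) (g j) (j - i) := by
    intro i j hij hj
    have := PS.ofSeq (d := d) A g (j - i) i (fun q _ h2 => Or.inl ⟨q, by omega, rfl⟩)
      (fun q h1 h2 => by have := hg q (q + 1) (by omega) (by omega); omega)
    rwa [show i + (j - i) = j by omega] at this
  have pA2 : ∀ i j, i ≤ j → j ≤ R → PS d A (f i) (f j) (j - i) := by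
    intro i j hij hj
    have := PS.ofSeq (d := d) A f (j - i) i (fun q _ h2 => Or.inr ⟨q, by omega, rfl⟩)
      (fun q h1 h2 => by have := hf q (q + 1) (by omega) (by omega); omega)
    rwa [show i + (j - i) = j by omega] at this
  have key : ∀ i j, i ≤ k → j ≤ R → j ≤ d (g i) (f j) ∧ k - i ≤ 2 * d (g i) (f j) := by
    intro i j hi hj
    have a1 := hmin i (by omega)
    have a2 := hf j R hj (by omega)
    have a3 := hf 0 j (by omega) (by omega)
    have a4 := hg i k hi (by omega)
    rw [f1] at a2
    rw [f0] at a3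
    have a5 := hd.tri z (f j) (g i)
    have a6 := hd.comm (f j) (g i)
    have a7 := hd.comm z (f j)
    have a8 := hd.comm z (g k)
    have a9 := hd.tri (g i) (f j) (g k)
    have a10 := hd.comm (f j) (g k)
    omega
  have hAA : ∀ p q, A p → A q → ∃ n, n ≤ 3 * d p q ∧ PS d A p q n := by
    have mixed : ∀ i j, i ≤ k → j ≤ R → ∃ n, n ≤ 3 * d (g i) (f j) ∧ PS d A (g i) (f j) n := by
      intro i j hi hj
      refine ⟨(k - i) + (j - 0), by have := key i j hi hj; omega, ?_⟩
      have q1 := pA1 i k hi le_rfl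
      have q2 := pA2 0 j (by omega) hj
      rw [f0] at q2
      exact q1.trans q2
    rintro p q (⟨i, hi, rfl⟩ | ⟨i, hi, rfl⟩) (⟨j, hj, rfl⟩ | ⟨j, hj, rfl⟩)
    · rcases le_total i j with h | h
      · exact ⟨j - i, by have := hg i j h (by omega); omega, pA1 i j h hj⟩
      · exact ⟨i - j, by have := hg j i h (by omega); rw [hd.comm]; omega, (pA1 j i h hi).symm hd⟩
    · exact mixed i j hi hj
    · obtain ⟨n, h1, h2⟩ := mixed j i hj hi
      exact ⟨n, by rw [hd.comm]; exact h1, h2.symm hd⟩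
    · rcases le_total i j with h | h
      · exact ⟨j - i, by have := hf i j h (by omega); omega, pA2 i j h hj⟩
      · exact ⟨i - j, by have := hf j i h (by omega); rw [hd.comm]; omega, (pA2 j i h hi).symm hd⟩
  have hmo := morse hd hI A hAA e (d (g 0) z) he (by rw [e0]; exact Or.inl ⟨0, by omega, rfl⟩)
    (by rw [e1]; exact Or.inr ⟨R, le_rfl, f1.symm⟩)
  -- switching point
  have hsw : ∃ w, w ≤ d (g 0) z ∧ (∃ p, A1 p ∧ d (e w) p ≤ T + 1) ∧ (∃ q, A2 q ∧ d (e w) q ≤ T) := by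
    classical
    have hex : ∃ w, w ≤ d (g 0) z ∧ ∃ q, A2 q ∧ d (e w) q ≤ T :=
      ⟨_, le_rfl, z, ⟨R, le_rfl, f1.symm⟩, by rw [e1, hd.self]; omega⟩
    obtain ⟨w1, w2⟩ := Nat.find_spec hex
    refine ⟨Nat.find hex, w1, ?_, w2⟩
    by_cases h0 : Nat.find hex = 0
    · rw [h0, e0]
      exact ⟨g 0, ⟨0, by omega, rfl⟩, by rw [hd.self]; omega⟩
    · obtain ⟨m, hm⟩ := Nat.exists_eq_succ_of_ne_zero h0
      have hm1 : ¬ (m ≤ d (g 0) z ∧ ∃ q, A2 q ∧ d (e m) q ≤ T) := Nat.find_min hex (by omega)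
      obtain ⟨a, ha, ha'⟩ := hmo m (by omega)
      rcases ha with ha | ha
      · refine ⟨a, ha, ?_⟩
        have := he m (m + 1) (by omega) (by omega)
        rw [hm]
        have := hd.tri (e (m + 1)) (e m) a
        have := hd.comm (e (m + 1)) (e m)
        simp only [Nat.succ_eq_add_one]
        omega
      · exact absurd ⟨by omega, a, ha, ha'⟩ hm1
  obtain ⟨w, hw, ⟨p, ⟨i, hi, rfl⟩, hp⟩, q, ⟨j, hj, rfl⟩, hq⟩ := hsw
  have k1 := key i j hi hj
  have t1 := hd.tri (g i) (e w) (f j)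
  have t2 := hd.comm (g i) (e w)
  have t3 := hg i k hi (by omega)
  have t4 := he 0 w (by omega) hw
  have t5 := he w (d (g 0) z) hw le_rfl
  rw [e0] at t4
  rw [e1] at t5
  have t6 := hd.tri (g 0) (e w) (g k)
  have t7 := hd.tri (e w) (g i) (g k)
  have t8 := hd.tri (g k) (e w) z
  have t9 := hd.comm (g k) (e w)
  omega

theorem iso_hyp (hd : GMet d) {C : ℕ} (hI : Iso d C) : IsHypD (fun x y => (d x y : ℝ)) := by
  set T := 2 * (5 * (48 * C + 1) + 3) with hT
  refine ⟨2 * T, by positivity, fun o x y z => ?_⟩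
  obtain ⟨g, g0, g1, hg⟩ := hd.geod x z
  set N := d x z with hN
  have hmin : ∀ w, ∃ k ≤ N, ∀ j ≤ N, d w (g k) ≤ d w (g j) := by
    intro w
    obtain ⟨k, hk, h⟩ := Finset.exists_min_image (Finset.range (N + 1)) (fun i => d w (g i)) ⟨0, by simp⟩
    exact ⟨k, by simpa [Nat.lt_succ_iff] using hk, fun j hj => h j (by simpa [Nat.lt_succ_iff] using hj)⟩
  have both : ∀ w k, k ≤ N → (∀ j ≤ N, d w (g k) ≤ d w (g j)) →
      d x (g k) + d (g k) w ≤ d x w + T ∧ d z (g k) + d (g k) w ≤ d z w + T := by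
    intro w k hk h
    refine ⟨?_, ?_⟩
    · have := coarse_proj hd hI g N hg w k hk h
      rwa [g0] at this
    · have := coarse_proj hd hI (fun i => g (N - i)) N (fun i j hij hj => by
        have := hg (N - j) (N - i) (by omega) (by omega)
        rw [hd.comm, this]; omega) w (N - k) (by omega) (fun j hj => by
          have := h (N - j) (by omega)
          rwa [show N - (N - k) = k by omega])
      simp only [Nat.sub_zero, show N - (N - k) = k by omega, g1] at this
      exact this
  obtain ⟨k, hk, hp⟩ := hmin o
  obtain ⟨r, hr, hq⟩ := hmin y
  obtain ⟨p1, p2⟩ := both o k hk hp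
  obtain ⟨q1, q2⟩ := both y r hr hq
  have a1 := hg 0 k (by omega) hk
  have a2 := hg k N hk le_rfl
  have a3 := hg 0 r (by omega) hr
  have a4 := hg r N hr le_rfl
  rw [g0] at a1 a3
  rw [g1] at a2 a4
  have c1 := hd.comm z (g k)
  have c2 := hd.comm z (g r)
  have c3 := hd.comm (g k) o
  have c4 := hd.comm (g r) y
  have c5 := hd.comm x o
  have c6 := hd.comm z o
  have c7 := hd.comm y o
  have t1 := hd.tri y (g r) o
  have t2 := hd.tri (g r) (g k) o
  have t3 := hd.tri x (g k) o
  have t4 := hd.tri z (g k) o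
  have c8 := hd.comm z y
  have main : (d x o + d y o + d x z ≤ d x y + d x o + d z o + 4 * T) ∨
      (d y o + d z o + d x z ≤ d y z + d x o + d z o + 4 * T) := by
    rcases le_total k r with h | h
    · left
      have := hg k r h hr
      have := hd.comm (g r) (g k)
      omega
    · right
      have := hg r k h hk
      omega
  simp only [gprod]
  rcases main with h | h
  · have h' : (d x o + d y o + d x z : ℝ) ≤ d x y + d x o + d z o + 4 * T := by exact_mod_cast h
    exact (min_le_left _ _).trans (by linarith)
  · have h' : (d y o + d z o + d x z : ℝ) ≤ d y z + d x o + d z o + 4 * T := by exact_mod_cast h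
    exact (min_le_right _ _).trans (by linarith)

end IsoCriterion

section WordLen

variable {G : Type*} [Group G] {S : Set G}

theorem wl_le (l : List G) (h : ∀ x ∈ l, x ∈ S ∨ x⁻¹ ∈ S) : wordLength S l.prod ≤ l.length :=
  Nat.sInf_le ⟨l, h, rfl, rfl⟩

theorem wl_exists (hS : Subgroup.closure S = ⊤) (g : G) :
    ∃ l : List G, (∀ x ∈ l, x ∈ S ∨ x⁻¹ ∈ S) ∧ l.length = wordLength S g ∧ l.prod = g := by
  have hg : g ∈ Subgroup.closure S := by rw [hS]; trivial
  rw [← Subgroup.mem_toSubmonoid, Subgroup.closure_toSubmonoid] at hg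
  obtain ⟨l, hl, hp⟩ := Submonoid.exists_list_of_mem_closure hg
  exact Nat.sInf_mem (s := { n : ℕ | ∃ l : List G, (∀ x ∈ l, x ∈ S ∨ x⁻¹ ∈ S) ∧ l.length = n ∧ l.prod = g })
    ⟨_, l, hl, rfl, hp⟩

theorem wl_one : wordLength S (1 : G) = 0 := by
  have := wl_le (S := S) [] (by simp)
  simpa using this

theorem wl_mul (hS : Subgroup.closure S = ⊤) (g h : G) :
    wordLength S (g * h) ≤ wordLength S g + wordLength S h := by
  obtain ⟨l, hl, h1, h2⟩ := wl_exists hS g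
  obtain ⟨m, hm, m1, m2⟩ := wl_exists hS h
  have := wl_le (S := S) (l ++ m) (by
    intro x hx; rcases List.mem_append.1 hx with hx | hx
    · exact hl x hx
    · exact hm x hx)
  simpa [h1, h2, m1, m2] using this

theorem wl_inv_le (hS : Subgroup.closure S = ⊤) (g : G) : wordLength S g⁻¹ ≤ wordLength S g := by
  obtain ⟨l, hl, h1, h2⟩ := wl_exists hS g
  have := wl_le (S := S) (l.map (·⁻¹)).reverse (by
    intro x hx
    simp only [List.mem_reverse, List.mem_map] at hx
    obtain ⟨y, hy, rfl⟩ := hx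
    rw [inv_inv]; exact (hl y hy).symm)
  rw [← List.prod_inv_reverse, h2] at this
  simpa [h1] using this

theorem wl_inv (hS : Subgroup.closure S = ⊤) (g : G) : wordLength S g⁻¹ = wordLength S g :=
  le_antisymm (wl_inv_le hS g) (by simpa using wl_inv_le hS g⁻¹)

theorem wl_mem {s : G} (h : s ∈ S ∨ s⁻¹ ∈ S) : wordLength S s ≤ 1 := by
  simpa using wl_le (S := S) [s] (by simpa using h)

/-- natural-valued word metric -/
noncomputable def wdn (S : Set G) (g h : G) : ℕ := wordLength S (g⁻¹ * h)

theorem wdn_tri (hS : Subgroup.closure S = ⊤) (x y z : G) : wdn S x z ≤ wdn S x y + wdn S y z := by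
  have := wl_mul hS (x⁻¹ * y) (y⁻¹ * z)
  simpa [wdn, mul_assoc] using this

theorem wdn_self (x : G) : wdn S x x = 0 := by simp [wdn, wl_one]

theorem wdn_comm (hS : Subgroup.closure S = ⊤) (x y : G) : wdn S x y = wdn S y x := by
  unfold wdn; rw [← wl_inv hS]; simp

theorem wdn_left (g x y : G) : wdn S (g * x) (g * y) = wdn S x y := by
  unfold wdn; simp [mul_assoc]

theorem gmet_wdn (hS : Subgroup.closure S = ⊤) : GMet (wdn S) where
  self := wdn_self
  comm := wdn_comm hS
  tri := wdn_tri hS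
  geod x y := by
    obtain ⟨l, hl, h1, h2⟩ := wl_exists hS (x⁻¹ * y)
    have key : ∀ i j, i ≤ j → j ≤ l.length → wdn S (x * (l.take i).prod) (x * (l.take j).prod) ≤ j - i := by
      intro i j hij hj
      have e : l.take j = l.take i ++ (l.drop i).take (j - i) := by
        rw [← List.take_add]; congr 1; omega
      have := wl_le (S := S) ((l.drop i).take (j - i)) (fun x hx =>
        hl x (List.mem_of_mem_drop (List.mem_of_mem_take hx)))
      rw [wdn_left, e]
      simp only [wdn, List.prod_append, inv_mul_cancel_left]
      refine this.trans ?_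
      simp
    refine ⟨fun i => x * (l.take i).prod, by simp, ?_, ?_⟩
    · show x * (l.take (wordLength S (x⁻¹ * y))).prod = y
      rw [← h1]; simp [h2]
    · intro i j hij hj
      have hj' : j ≤ l.length := by rw [h1]; exact hj
      apply le_antisymm (key i j hij hj')
      have a1 := key 0 i (by omega) (by omega)
      have a2 := key j l.length (by omega) (by omega)
      have b1 := wdn_tri hS x (x * (l.take i).prod) y
      have b2 := wdn_tri hS (x * (l.take i).prod) (x * (l.take j).prod) y
      have e1 : x * (l.take l.length).prod = y := by simp [h2]
      have e0 : x * (l.take 0).prod = x := by simp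
      rw [e1] at a2; rw [e0] at a1
      have : wdn S x y = l.length := h1.symm
      show j - i ≤ wdn S (x * (l.take i).prod) (x * (l.take j).prod)
      omega

theorem wl_bound (hS : Subgroup.closure S = ⊤) {T : Set G} (hT : T.Finite) :
    ∃ C, ∀ t ∈ T, wordLength S t ≤ C := by
  obtain ⟨C, hC⟩ := (hT.image (wordLength S)).bddAbove
  exact ⟨C, fun t ht => hC ⟨t, ht, rfl⟩⟩

theorem wl_list_bound (hS : Subgroup.closure S = ⊤) (C : ℕ) (l : List G)
    (h : ∀ x ∈ l, wordLength S x ≤ C) : wordLength S l.prod ≤ C * l.length := by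
  induction l with
  | nil => simp [wl_one]
  | cons a l ih =>
    have := wl_mul hS a l.prod
    have h1 := h a (by simp)
    have h2 := ih (fun x hx => h x (by simp [hx]))
    simp only [List.prod_cons, List.length_cons]
    nlinarith

theorem wl_change {T : Set G} (hS : GenSet S) (hT : GenSet T) :
    ∃ C, ∀ g, wordLength S g ≤ C * wordLength T g := by
  obtain ⟨C, hC⟩ := wl_bound hS.2 hT.1
  refine ⟨C, fun g => ?_⟩
  obtain ⟨l, hl, h1, h2⟩ := wl_exists hT.2 g
  rw [← h1, ← h2]
  apply wl_list_bound hS.2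
  intro x hx
  rcases hl x hx with h | h
  · exact hC _ h
  · rw [← wl_inv hS.2]; exact hC _ h

end WordLen

section Combination

variable {K : Type*} [Group K] {l : K → ℕ} {E : Type*} {G : Type*} [Group G]

/-- evaluation of letters in a group -/
def evG (i : K →* G) (t : E → G) : K ⊕ (E × Bool) → G
  | Sum.inl x => i x
  | Sum.inr e => if e.2 then t e.1 else (t e.1)⁻¹

theorem evG_inl (i : K →* G) (t : E → G) (x : K) : evG i t (Sum.inl x) = i x := rfl

theorem evG_labInv (i : K →* G) (t : E → G) (e : E × Bool) :
    evG i t (Sum.inr (labInv e)) = (evG i t (Sum.inr e))⁻¹ := by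
  rcases e with ⟨e, _ | _⟩ <;> simp [evG, labInv]

theorem evG_rel {i : K →* G} {t : E → G} {th : E → MulAut K}
    (hr : ∀ e k, t e * i k = i (th e k) * t e) (e : E × Bool) (k : K) :
    evG i t (Sum.inr e) * i k = i (thb th e k) * evG i t (Sum.inr e) := by
  rcases e with ⟨e, _ | _⟩
  · simp only [evG, thb]
    have := hr e ((th e)⁻¹ k)
    simp only [MulAut.apply_inv_self] at this
    simp only [Bool.false_eq_true, if_false]
    rw [inv_mul_eq_iff_eq_mul, ← mul_assoc, this]; simp
  · simpa [evG, thb] using hr e k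

/-- word evaluates as expected -/
theorem evG_word {i : K →* G} {t : E → G} {th : E → MulAut K}
    (hr : ∀ e k, t e * i k = i (th e k) * t e) (T : CD K E) :
    (T.word.map (evG i t)).prod = i (T.val th) := by
  induction T with
  | nil => simp [CD.word, CD.val]
  | letter x T ih => simp [CD.word, CD.val, ih, evG]
  | cor e T1 T ih1 ih =>
    simp only [CD.word, List.map_cons, List.map_append, List.prod_cons, List.prod_append, ih1, ih, CD.val,
      map_mul, evG_labInv]
    rw [← mul_assoc, evG_rel hr]; simp [mul_assoc]

/-- standard generating set -/
def stdGen (l : K → ℕ) (i : K →* G) (t : E → G) : Set G := (i '' {x | l x ≤ 1}) ∪ Set.range t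

theorem mem_stdGen_iff (h : TreeLen l) (i : K →* G) (t : E → G) {g : G}
    (hg : g ∈ stdGen l i t ∨ g⁻¹ ∈ stdGen l i t) :
    ∃ a : K ⊕ (E × Bool), evG i t a = g ∧ ∀ x, a = Sum.inl x → l x ≤ 1 := by
  rcases hg with (⟨x, hx, rfl⟩ | ⟨e, rfl⟩) | (⟨x, hx, hx'⟩ | ⟨e, he⟩)
  · exact ⟨Sum.inl x, rfl, by rintro _ ⟨⟩; exact hx⟩
  · exact ⟨Sum.inr (e, true), by simp [evG], by simp⟩
  · exact ⟨Sum.inl x⁻¹, by simp [evG, hx'], by rintro _ ⟨⟩; rw [h.inv]; exact hx⟩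
  · exact ⟨Sum.inr (e, false), by simp [evG, he], by simp⟩

theorem evG_wl (i : K →* G) (t : E → G) (a : K ⊕ (E × Bool)) (ha : ∀ x, a = Sum.inl x → l x ≤ 1) :
    wordLength (stdGen l i t) (evG i t a) ≤ 1 := by
  apply wl_mem
  rcases a with x | ⟨e, _ | _⟩
  · left; left; exact ⟨x, ha x rfl, rfl⟩
  · right; right; simp [evG]
  · left; right; simp [evG]

theorem stdGen_finite (h : TreeLen l) [Finite E] (i : K →* G) (t : E → G) : (stdGen l i t).Finite :=
  ((h.fin 1).image _).union (Set.finite_range t)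

/-- geodesic words in `K` -/
theorem TreeLen.letters (h : TreeLen l) : ∀ (n : ℕ) (k : K), l k = n →
    ∃ w : List K, w.prod = k ∧ w.length = n ∧ ∀ x ∈ w, l x ≤ 1
  | 0, k, hk => ⟨[], by simp [h.eq_one k hk], rfl, by simp⟩
  | n + 1, k, hk => by
    obtain ⟨a, b, hab, ha, hb⟩ := h.split k n (by omega)
    obtain ⟨w, h1, h2, h3⟩ := TreeLen.letters h n a ha
    refine ⟨w ++ [b], by simp [h1, hab], by simp [h2], ?_⟩
    intro x hx
    rcases List.mem_append.1 hx with hx | hx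
    · exact h3 x hx
    · simp only [List.mem_singleton] at hx; subst hx; omega

theorem stdGen_closure (h : TreeLen l) (i : K →* G) (t : E → G) (k : K) :
    i k ∈ Subgroup.closure (stdGen l i t) := by
  obtain ⟨w, h1, h2, h3⟩ := h.letters _ k rfl
  rw [← h1, map_list_prod]
  apply Subgroup.list_prod_mem
  intro x hx
  obtain ⟨y, hy, rfl⟩ := List.mem_map.1 hx
  exact Subgroup.subset_closure (Or.inl ⟨y, h3 y hy, rfl⟩)

/-- tree potential -/
theorem TreeLen.potential (h : TreeLen l) (f : K → K → ℤ) (hf : ∀ x y, f y x = - f x y) :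
    ∃ P : K → ℤ, P 1 = 0 ∧ ∀ k x, l x ≤ 1 → P (k * x) = P k + f k (k * x) := by
  have h1 : ∀ (k : K) (j : ℕ), ∃ m, j ≤ l k → td l 1 m = j ∧ td l 1 m + td l m k = td l 1 k := by
    intro k j
    by_cases hj : j ≤ l k
    · obtain ⟨m, hm⟩ := h.d_split 1 k j (by rwa [TreeLen.d_one])
      exact ⟨m, fun _ => hm⟩
    · exact ⟨1, fun h => absurd h hj⟩
  choose pre hpre using h1
  have huniq : ∀ (k m m' : K), td l 1 m = td l 1 m' → td l 1 m + td l m k = td l 1 k →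
      td l 1 m' + td l m' k = td l 1 k → m = m' := by
    intro k m m' e1 e2 e3
    apply h.d_eq
    have := h.four 1 m k m'
    have := h.d_comm m' k
    rcases le_max_iff.1 (h.four 1 m k m') with h' | h' <;> omega
  have hend : ∀ k, pre k (l k) = k := by
    intro k
    have := hpre k (l k) le_rfl
    rw [TreeLen.d_one k] at this
    apply h.d_eq; omega
  have main : ∀ k x, l (k * x) = l k + 1 → l x = 1 →
      ∑ i ∈ Finset.range (l (k * x)), f (pre (k * x) i) (pre (k * x) (i + 1)) =
      ∑ i ∈ Finset.range (l k), f (pre k i) (pre k (i + 1)) + f k (k * x) := by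
    intro k x hkx hx
    have hp : ∀ j, j ≤ l k → pre (k * x) j = pre k j := by
      intro j hj
      obtain ⟨a1, a2⟩ := hpre k j hj
      obtain ⟨b1, b2⟩ := hpre (k * x) j (by omega)
      apply huniq (k * x) _ _ (by omega) b2
      have c1 := h.d_tri (pre k j) k (k * x)
      have c2 := h.d_tri 1 (pre k j) (k * x)
      rw [TreeLen.d_mul] at c1
      have e1 := TreeLen.d_one (l := l) k
      have e2 := TreeLen.d_one (l := l) (k * x)
      omega
    rw [hkx, Finset.sum_range_succ, ← hkx, hend, hp _ le_rfl, hend]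
    congr 1
    apply Finset.sum_congr rfl
    intro j hj
    rw [Finset.mem_range] at hj
    rw [hp _ (by omega), hp _ (by omega)]
  refine ⟨fun k => ∑ i ∈ Finset.range (l k), f (pre k i) (pre k (i + 1)), by simp [h.one], ?_⟩
  intro k x hx
  rcases Nat.eq_zero_or_pos (l x) with h0 | h0
  · have := h.eq_one x h0
    subst this
    have := hf k k
    simp only [mul_one]; omega
  · have hx1 : l x = 1 := by omega
    have p := h.par k x
    rw [Nat.even_iff] at p
    have m1 := h.mul_le k x
    have m2 := h.mul_le (k * x) x⁻¹
    rw [h.inv] at m2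
    simp only [mul_inv_cancel_right] at m2
    rcases (show l (k * x) = l k + 1 ∨ l k = l (k * x) + 1 by omega) with hh | hh
    · exact main k x hh hx1
    · have := main (k * x) x⁻¹ (by simpa using hh) (by rw [h.inv]; exact hx1)
      simp only [mul_inv_cancel_right] at this
      have := hf k (k * x)
      simp only []
      omega

/-- integral along a word -/
def Iw (u v : G → ℤ) (f : K ⊕ (E × Bool) → G) : G → List (K ⊕ (E × Bool)) → ℤ
  | _, [] => 0
  | g, a :: w => om u v g (g * f a) + Iw u v f (g * f a) w

theorem Iw_append (u v : G → ℤ) (f : K ⊕ (E × Bool) → G) (w w' : List (K ⊕ (E × Bool))) (g : G) :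
    Iw u v f g (w ++ w') = Iw u v f g w + Iw u v f (g * (w.map f).prod) w' := by
  induction w generalizing g with
  | nil => simp [Iw]
  | cons a w ih => simp [Iw, ih, mul_assoc, add_assoc]

theorem om_anti (u v : G → ℤ) (x y : G) : om u v y x = - om u v x y := by simp only [om]; ring

/-- quadratic bound -/
theorem Iw_quad {S : Set G} (hS : Subgroup.closure S = ⊤) (u v : G → ℤ) (hu : Lip1 (wdn S) u) (hv : Lip1 (wdn S) v)
    (f : K ⊕ (E × Bool) → G) (w : List (K ⊕ (E × Bool))) (hw : ∀ a ∈ w, wordLength S (f a) ≤ 1) (g : G) :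
    |v (g * (w.map f).prod) - v g| ≤ w.length ∧
    |Iw u v f g w - 2 * u g * (v (g * (w.map f).prod) - v g)| ≤ 2 * (w.length : ℤ) ^ 2 := by
  induction w generalizing g with
  | nil => simp [Iw]
  | cons a w ih =>
    obtain ⟨i1, i2⟩ := ih (fun b hb => hw b (by simp [hb])) (g * f a)
    have ha := hw a (by simp)
    have d1 : (wdn S g (g * f a) : ℤ) ≤ 1 := by
      have : wdn S g (g * f a) = wordLength S (f a) := by simp [wdn]
      rw [this]; exact_mod_cast ha
    have d2 : (wdn S (g * f a) g : ℤ) ≤ 1 := by rw [wdn_comm hS]; exact d1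
    have u1 := hu g (g * f a)
    have u2 := hu (g * f a) g
    have v1 := hv g (g * f a)
    have v2 := hv (g * f a) g
    simp only [List.map_cons, List.prod_cons, List.length_cons, Iw, ← mul_assoc, om]
    push_cast
    clear ih hw ha
    generalize v (g * f a * (w.map f).prod) = V at *
    generalize v (g * f a) = V' at *
    generalize u (g * f a) = U' at *
    generalize Iw u v f (g * f a) w = II at *
    generalize u g = U at *
    generalize v g = W at *
    generalize (w.length : ℤ) = n at *
    have hU : |U' - U| ≤ 1 := abs_le.2 ⟨by omega, by omega⟩
    have hV : |V' - W| ≤ 1 := abs_le.2 ⟨by omega, by omega⟩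
    have p1 : |(U' - U) * (V' - W)| ≤ 1 := by
      rw [abs_mul]; nlinarith [abs_nonneg (U' - U), abs_nonneg (V' - W)]
    have p2 : |(U' - U) * (V - V')| ≤ n := by
      rw [abs_mul]; nlinarith [abs_nonneg (U' - U), abs_nonneg (V - V')]
    have hn : 0 ≤ n := le_trans (abs_nonneg _) i1
    rw [abs_le] at i1 i2 p1 p2 hU hV
    rw [abs_le, abs_le]
    constructor
    · constructor <;> omega
    · constructor <;> nlinarith

/-- extension data -/
structure GExt (l : K → ℕ) (i : K →* G) (t : E → G) (th : E → MulAut K) : Prop where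
  inj : Function.Injective i
  rel : ∀ e k, t e * i k = i (th e k) * t e
  gen : Subgroup.closure (stdGen l i t) = ⊤
  proj : ∀ (w : List (K ⊕ (E × Bool))) (k : K), (w.map (evG i t)).prod = i k → FreeGroup.mk (CD.proj w) = 1

theorem GExt.exists_word (h : TreeLen l) {i : K →* G} {t : E → G} {th : E → MulAut K} (hx : GExt l i t th) (g : G) :
    ∃ w : List (K ⊕ (E × Bool)), (w.map (evG i t)).prod = g ∧ CD.Short l w ∧
      w.length = wordLength (stdGen l i t) g := by
  obtain ⟨L, hL, h1, h2⟩ := wl_exists hx.gen g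
  rw [← h1, ← h2]
  clear h1 h2
  induction L with
  | nil => exact ⟨[], by simp, by intro x hx; simp at hx, rfl⟩
  | cons a L ih =>
    obtain ⟨w, h1, h2, h3⟩ := ih (fun x hx => hL x (by simp [hx]))
    obtain ⟨b, hb, hb'⟩ := mem_stdGen_iff h i t (hL a (by simp))
    refine ⟨b :: w, by simp [hb, h1], ?_, by simp [h3]⟩
    intro x hx
    rcases List.mem_cons.1 hx with hx | hx
    · exact hb' x hx.symm
    · exact h2 x hx

theorem GExt.qi (h : TreeLen l) [Finite E] {i : K →* G} {t : E → G} {th : E → MulAut K} (hx : GExt l i t th)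
    {C : ℕ} (hd : CD.Distinct l th C) : ∃ C', ∀ k : K,
      (∀ a p b, k = a * p * b → l a + l p + l b = l k → ∀ s, 3 * l p ≤ l (thb th s p) + C) →
      l k ≤ C' * (wordLength (stdGen l i t) (i k) + 1) := by
  obtain ⟨C', hC⟩ := corridor h th C hd
  refine ⟨C', fun k hk => ?_⟩
  obtain ⟨w, h1, h2, h3⟩ := hx.exists_word h (i k)
  obtain ⟨T, hT, hT'⟩ := hC w h2 (hx.proj w k h1)
  have hv : T.val th = k := by
    apply hx.inj
    rw [← evG_word hx.rel, hT, h1]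
  rw [hv, h3] at hT'
  have := hT' hk
  omega

theorem GExt.of_PI (h : TreeLen l) {i : K →* G} {t : E → G} {th : E → MulAut K} (hx : GExt l i t th)
    {u v : G → ℤ} {x y : G} {n : ℕ} {I : ℤ} (hp : PI (wdn (stdGen l i t)) u v x y n I) :
    ∃ w : List (K ⊕ (E × Bool)), x * (w.map (evG i t)).prod = y ∧ CD.Short l w ∧ w.length = n ∧
      Iw u v (evG i t) x w = I := by
  induction hp with
  | nil x => exact ⟨[], by simp, by intro x hx; simp at hx, rfl, rfl⟩
  | cons x y z n I hxy _ ih =>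
    obtain ⟨w, h1, h2, h3, h4⟩ := ih
    obtain ⟨L, hL, e1, e2⟩ := wl_exists hx.gen (x⁻¹ * y)
    have : ∃ b : K ⊕ (E × Bool), evG i t b = x⁻¹ * y ∧ ∀ x, b = Sum.inl x → l x ≤ 1 := by
      have hlen : L.length ≤ 1 := by rw [e1]; exact hxy
      match L, hL, e2, hlen with
      | [], _, e2, _ =>
        refine ⟨Sum.inl 1, ?_, ?_⟩
        · rw [← e2]; simp [evG]
        · rintro _ ⟨⟩; rw [h.one]; omega
      | [a], hL, e2, _ =>
        rw [← e2]
        simpa using mem_stdGen_iff h i t (hL a (by simp))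
    obtain ⟨b, hb, hb'⟩ := this
    have hxb : x * evG i t b = y := by rw [hb]; simp
    refine ⟨b :: w, ?_, ?_, by simp [h3], ?_⟩
    · simp only [List.map_cons, List.prod_cons]
      rw [← mul_assoc, hxb, h1]
    · intro x hx
      rcases List.mem_cons.1 hx with hx | hx
      · exact hb' x hx.symm
      · exact h2 x hx
    · simp only [Iw, hxb, h4]

theorem GExt.hyp (h : TreeLen l) [Finite E] {i : K →* G} {t : E → G} {th : E → MulAut K} (hx : GExt l i t th)
    {C : ℕ} (hd : CD.Distinct l th C) : IsHypGroup G := by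
  obtain ⟨C', hC⟩ := corridor h th C hd
  -- Lipschitz constants
  have hlip : ∃ L, ∀ (s : E × Bool) (x : K), l x ≤ 1 → l (thb th s x) ≤ L := by
    have : ({y | ∃ (s : E × Bool) (x : K), l x ≤ 1 ∧ y = l (thb th s x)} : Set ℕ).Finite := by
      have : ({y | ∃ (s : E × Bool) (x : K), l x ≤ 1 ∧ y = l (thb th s x)} : Set ℕ) =
        ⋃ s : E × Bool, (fun x => l (thb th s x)) '' {x | l x ≤ 1} := by
        ext y; simp [eq_comm]
      rw [this]
      exact Set.finite_iUnion (fun s => (h.fin 1).image _)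
    obtain ⟨L, hL⟩ := this.bddAbove
    exact ⟨L, fun s x hx => hL ⟨s, x, hx, rfl⟩⟩
  obtain ⟨L, hL⟩ := hlip
  set S := stdGen l i t with hS
  refine ⟨S, ⟨stdGen_finite h i t, hx.gen⟩, ?_⟩
  set ρ : ℤ := 2 * ((L : ℤ) + 3) ^ 2 + 2 * (L : ℤ)^2 with hρ
  have hρ0 : 0 ≤ ρ := by positivity
  have := iso_hyp (gmet_wdn hx.gen) (C := (2 * ρ.toNat * C')) ?_
  · exact this
  intro u v hu hv x n I hp
  obtain ⟨w, h1, h2, h3, h4⟩ := hx.of_PI h hp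
  have hev : (w.map (evG i t)).prod = i 1 := by simpa using h1
  obtain ⟨T, hT, hT'⟩ := hC w h2 (hx.proj w 1 hev)
  have hval : T.val th = 1 := by
    apply hx.inj; rw [← evG_word hx.rel, hT, hev]
  have hM : T.M l th ≤ C' * (n + 1) := by
    have := hT' (by
      intro a p b hab hl s
      rw [hval, h.one] at hl
      omega)
    rw [h3] at this; omega
  -- potential
  have hP : ∀ g : G, ∃ P : K → ℤ, P 1 = 0 ∧ ∀ k x, l x ≤ 1 → P (k * x) = P k + om u v (g * i k) (g * i (k * x)) := by
    intro g
    exact h.potential (fun a b => om u v (g * i a) (g * i b)) (fun a b => om_anti u v _ _)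
  choose P P1 Pm using hP
  have PI' : ∀ (g : G) (w : List K), (∀ x ∈ w, l x ≤ 1) → ∀ k,
      P g (k * w.prod) = P g k + Iw (E := E) u v (evG i t) (g * i k) (w.map Sum.inl) := by
    intro g w
    induction w with
    | nil => intro _ k; simp [Iw]
    | cons a w ih =>
      intro hw k
      simp only [List.prod_cons, List.map_cons, Iw, evG]
      rw [← mul_assoc, ih (fun x hx => hw x (by simp [hx])), Pm _ _ _ (hw a (by simp))]
      simp only [map_mul, mul_assoc]
      ring
  have Padd : ∀ g k k', P g (k * k') = P g k + P (g * i k) k' := by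
    intro g k k'
    obtain ⟨w, e1, e2, e3⟩ := h.letters _ k' rfl
    have a1 := PI' g w e3 k
    have a2 := PI' (g * i k) w e3 1
    rw [one_mul, P1, map_one, mul_one, zero_add] at a2
    rw [← e1, a1, a2]
  -- strip
  set D : G → E × Bool → K → ℤ := fun g e k =>
    om u v g (g * evG i t (Sum.inr e)) + P (g * evG i t (Sum.inr e)) k
      + om u v (g * evG i t (Sum.inr e) * i k) (g * i (thb th e k)) - P g (thb th e k) with hD
  have hrel : ∀ g e k, g * i (thb th e k) * evG i t (Sum.inr e) = g * evG i t (Sum.inr e) * i k := by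
    intro g e k
    rw [mul_assoc, mul_assoc, evG_rel hx.rel]
  have Dadd : ∀ g e k k', D g e (k * k') = D g e k + D (g * i (thb th e k)) e k' := by
    intro g e k k'
    simp only [hD, Padd, map_mul]
    rw [hrel, om_anti u v (g * i (thb th e k))]
    simp only [mul_assoc]
    ring
  have D1 : ∀ g e, D g e 1 = 0 := by
    intro g e
    simp only [hD, map_one, mul_one, P1]
    rw [om_anti u v g]; ring
  have Dx : ∀ g e x, l x ≤ 1 → |D g e x| ≤ ρ := by
    intro g e x hxl
    obtain ⟨w', e1, e2, e3⟩ := h.letters _ (thb th e x) rfl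
    have b1 := PI' g w' e3 1
    rw [one_mul, P1, map_one, mul_one, zero_add, e1] at b1
    have b2 := Pm (g * evG i t (Sum.inr e)) 1 x hxl
    rw [one_mul, P1, map_one, mul_one, zero_add] at b2
    have q1 := (Iw_quad (E := E) hx.gen u v hu hv (evG i t) (w'.map Sum.inl) (by
      intro a ha
      obtain ⟨y, hy, rfl⟩ := List.mem_map.1 ha
      exact evG_wl i t _ (by rintro _ ⟨⟩; exact e3 y hy)) g).2
    have q2 := (Iw_quad (E := E) hx.gen u v hu hv (evG i t) [Sum.inr e, Sum.inl x, Sum.inr (labInv e)] (by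
      intro a ha
      apply evG_wl
      rintro y rfl
      simp at ha; rw [ha]; exact hxl) g).2
    have r1 : ((w'.map (Sum.inl : K → K ⊕ (E × Bool))).map (evG i t)).prod = i (thb th e x) := by
      rw [List.map_map, ← e1, map_list_prod]; rfl
    have r2 : (([Sum.inr e, Sum.inl x, Sum.inr (labInv e)] : List (K ⊕ (E × Bool))).map (evG i t)).prod
        = i (thb th e x) := by
      simp only [List.map_cons, List.prod_cons, List.map_nil, List.prod_nil, evG_labInv]
      have := evG_rel hx.rel e x
      rw [evG_inl, mul_one, ← mul_assoc, this, mul_inv_cancel_right]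
    rw [r1] at q1
    rw [r2] at q2
    simp only [Iw, List.length_map, e2, List.length_cons, List.length_nil, evG_labInv] at q1 q2
    have r3 : g * evG i t (Sum.inr e) * evG i t (Sum.inl x) * (evG i t (Sum.inr e))⁻¹ = g * i (thb th e x) := by
      rw [evG_inl, ← hrel g e x, mul_inv_cancel_right]
    rw [r3] at q2
    have hDe : D g e x = (om u v g (g * evG i t (Sum.inr e)) + (om u v (g * evG i t (Sum.inr e))
      (g * evG i t (Sum.inr e) * evG i t (Sum.inl x)) + (om u v
      (g * evG i t (Sum.inr e) * evG i t (Sum.inl x)) (g * i (thb th e x)) + 0))) -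
      Iw (E := E) u v (evG i t) g (w'.map Sum.inl) := by
      simp only [hD, b1, b2, evG_inl]
      ring
    have hLx : (l (thb th e x) : ℤ) ≤ L := by exact_mod_cast hL e x hxl
    have hLx0 : (0 : ℤ) ≤ l (thb th e x) := by positivity
    have hsq : (l (thb th e x) : ℤ) ^ 2 ≤ L ^ 2 := by nlinarith
    rw [hDe]
    rw [abs_le] at *
    push_cast at q2
    constructor <;> nlinarith [q1.1, q1.2, q2.1, q2.2]
  have Dk : ∀ g e k, |D g e k| ≤ ρ * l k := by
    intro g e k
    obtain ⟨w', e1, e2, e3⟩ := h.letters _ k rfl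
    rw [← e2, ← e1]
    clear e1 e2
    induction w' generalizing g with
    | nil => simp [D1]
    | cons a w' ih =>
      rw [List.prod_cons, Dadd]
      have := ih (g * i (thb th e a)) (fun x hx => e3 x (by simp [hx]))
      have := Dx g e a (e3 a (by simp))
      refine (abs_add_le _ _).trans ?_
      simp only [List.length_cons]; push_cast; linarith
  have main : ∀ (T : CD K E) (g : G), CD.Short l T.word →
      |Iw u v (evG i t) g T.word - P g (T.val th)| ≤ ρ * T.M l th := by
    intro T
    induction T with
    | nil => intro g _; simp [CD.word, CD.val, CD.M, Iw, P1]
    | letter y T ih =>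
      intro g hs
      have hy : l y ≤ 1 := hs y (by simp [CD.word])
      have := ih (g * i y) (fun z hz => hs z (by simp [CD.word, hz]))
      simp only [CD.word, CD.val, CD.M, Iw, Padd]
      have b2 := Pm g 1 y hy
      rw [one_mul, P1, map_one, mul_one, zero_add] at b2
      rw [b2]
      simp only [evG_inl] at *
      convert this using 2
      ring
    | cor e T1 T ih1 ih =>
      intro g hs
      have a1 := ih1 (g * evG i t (Sum.inr e)) (fun z hz => hs z (by simp [CD.word, hz]))
      have a2 := ih (g * i (thb th e (T1.val th))) (fun z hz => hs z (by simp [CD.word, hz]))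
      have a3 := Dk g e (T1.val th)
      simp only [CD.word, CD.val, CD.M, Iw, Padd, Iw_append, evG_word hx.rel, evG_labInv]
      have r3 : g * evG i t (Sum.inr e) * i (T1.val th) * (evG i t (Sum.inr e))⁻¹ = g * i (thb th e (T1.val th)) := by
        rw [← hrel]; simp
      rw [r3]
      have hpos : (0:ℤ) ≤ l (thb th e (T1.val th)) := by positivity
      simp only [hD] at a3
      push_cast
      rw [abs_le] at *
      constructor <;> nlinarith [a1.1, a1.2, a2.1, a2.2, a3.1, a3.2, mul_nonneg hρ0 hpos]
  have hfin := main T x (by rw [hT]; exact h2)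
  rw [hval, P1, hT, h4, sub_zero] at hfin
  rcases Nat.eq_zero_or_pos n with h0 | h0
  · subst h0
    have : w = [] := List.length_eq_zero_iff.1 h3
    subst this
    simp [Iw] at h4
    simp [← h4]
  · refine hfin.trans ?_
    have hM' : (T.M l th : ℤ) ≤ C' * (n + 1) := by exact_mod_cast hM
    have hn : (1:ℤ) ≤ n := by exact_mod_cast h0
    push_cast
    rw [Int.toNat_of_nonneg hρ0]
    have hC0 : (0:ℤ) ≤ C' := by positivity
    have : (T.M l th : ℤ) ≤ C' * (2 * n) := by nlinarith
    nlinarith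

end Combination

section LinIso

variable {G : Type*} [Group G] {S : Set G}

/-- sum along a list -/
def SO (Om : G → G → ℤ) : G → List G → ℤ
  | _, [] => 0
  | g, s :: w => Om g (g * s) + SO Om (g * s) w

theorem SO_append (Om : G → G → ℤ) (w w' : List G) (g : G) :
    SO Om g (w ++ w') = SO Om g w + SO Om (g * w.prod) w' := by
  induction w generalizing g with
  | nil => simp [SO]
  | cons a w ih => simp [SO, ih, mul_assoc, add_assoc]

/-- coarse cocycles -/
def Coarse (Om : G → G → ℤ) : Prop := ∀ F : Set G, F.Finite → ∃ κ : ℤ, ∀ g, ∀ s ∈ F, ∀ s' ∈ F,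
  |Om g (g * s) + Om (g * s) (g * s * s') - Om g (g * s * s')| ≤ κ

theorem finite_prods {F : Set G} (hF : F.Finite) : ∀ r : ℕ,
    {g | ∃ w : List G, (∀ x ∈ w, x ∈ F) ∧ w.length ≤ r ∧ w.prod = g}.Finite
  | 0 => (Set.finite_singleton (1 : G)).subset (by
      rintro g ⟨w, _, h, rfl⟩
      have : w = [] := List.length_eq_zero_iff.1 (by omega)
      simp [this])
  | r + 1 => ((Set.finite_singleton (1 : G)).union (Set.Finite.image2 (fun a b : G => a * b) hF (finite_prods hF r))).subset (by
      rintro g ⟨w, hw, h, rfl⟩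
      rcases w with _ | ⟨a, w⟩
      · left; simp
      · right
        refine ⟨a, hw a (by simp), w.prod, ⟨w, fun x hx => hw x (by simp [hx]), ?_, rfl⟩, by simp⟩
        simpa using h)

theorem Coarse.short {Om : G → G → ℤ} (hO : Coarse Om) {F : Set G} (hF : F.Finite) : ∀ r : ℕ, ∃ κ : ℤ, 0 ≤ κ ∧
    ∀ w : List G, (∀ x ∈ w, x ∈ F) → w.length ≤ r → ∀ g, |SO Om g w - Om g (g * w.prod)| ≤ κ := by
  intro r
  induction r with
  | zero =>
    obtain ⟨κ, hκ⟩ := hO {1} (Set.finite_singleton 1)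
    refine ⟨max κ 0, le_max_right _ _, fun w _ h g => ?_⟩
    have : w = [] := List.length_eq_zero_iff.1 (by omega)
    subst this
    have := hκ g 1 rfl 1 rfl
    simp only [mul_one] at this
    simp only [SO, List.prod_nil, mul_one, zero_sub, abs_neg]
    refine le_trans ?_ (le_max_left _ _)
    rwa [add_sub_cancel_right] at this
  | succ r ih =>
    obtain ⟨κ, h0, hκ⟩ := ih
    obtain ⟨κ', hκ'⟩ := hO (F ∪ {g | ∃ w : List G, (∀ x ∈ w, x ∈ F) ∧ w.length ≤ r + 1 ∧ w.prod = g})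
      (hF.union (finite_prods hF _))
    refine ⟨κ + max κ' 0, by positivity, fun w hw h g => ?_⟩
    rcases w with _ | ⟨a, w⟩
    · have := hκ [] (by simp) (by simp) g
      exact this.trans (by have := le_max_right κ' 0; omega)
    · have hw' : ∀ x ∈ w, x ∈ F := fun x hx => hw x (by simp [hx])
      simp only [List.length_cons] at h
      have h1 := hκ w hw' (by omega) (g * a)
      have h2 := hκ' g a (Or.inl (hw a (by simp))) w.prod (Or.inr ⟨w, hw', by omega, rfl⟩)
      have := le_max_left κ' 0
      simp only [SO, List.prod_cons, ← mul_assoc]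
      rw [abs_le] at *
      constructor <;> linarith [h1.1, h1.2, h2.1, h2.2]

theorem lin_iso_gen (hS : GenSet S) (hyp : IsHypD (wordDist S)) {Om : G → G → ℤ} (hO : Coarse Om) :
    ∃ C : ℤ, 0 ≤ C ∧ ∀ n : ℕ, ∀ w : List G, (∀ x ∈ w, x ∈ S ∨ x⁻¹ ∈ S) → w.length = n → w.prod = 1 → ∀ g,
      |SO Om g w| ≤ C * (n + 1) := by
  obtain ⟨δ, hδ, h4⟩ := hyp
  obtain ⟨m, hm⟩ := exists_nat_gt (2 * δ)
  have hm0 : 0 < m := by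
    have : (0:ℝ) < m := by linarith
    exact_mod_cast this
  have hF : ({x | x ∈ S ∨ x⁻¹ ∈ S} : Set G).Finite := by
    have := hS.1.union (hS.1.image (·⁻¹))
    apply this.subset
    rintro x (h | h)
    · exact Or.inl h
    · exact Or.inr ⟨x⁻¹, h, by simp⟩
  obtain ⟨κ, hκ0, hκ⟩ := hO.short hF (2 * m)
  refine ⟨3 * κ, by positivity, ?_⟩
  intro n
  induction n using Nat.strong_induction_on with
  | _ n ih =>
  intro w hw hn hp g
  rcases Nat.lt_or_ge n (2 * m) with hlt | hge
  · have h1 := hκ w hw (by omega) g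
    rw [hp, mul_one] at h1
    have h2 := hκ [] (by simp) (by simp) g
    simp only [SO, List.prod_nil, mul_one] at h2
    have : (0:ℤ) ≤ n := by positivity
    rw [abs_le] at *
    constructor <;> nlinarith [h1.1, h1.2, h2.1, h2.2, mul_nonneg hκ0 this]
  · -- find a shortening
    set p : ℕ → G := fun i => (w.take i).prod with hpdef
    have hp0 : p 0 = 1 := by simp [hpdef]
    have hpn : p n = 1 := by simp [hpdef, ← hn, hp]
    have hstep : ∀ i j, i ≤ j → j ≤ n → wdn S (p i) (p j) ≤ j - i := by
      intro i j hij hj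
      have e : w.take j = w.take i ++ (w.drop i).take (j - i) := by
        rw [← List.take_add]; congr 1; omega
      have := wl_le (S := S) ((w.drop i).take (j - i)) (fun x hx =>
        hw x (List.mem_of_mem_drop (List.mem_of_mem_take hx)))
      simp only [hpdef]
      rw [e]
      simp only [wdn, List.prod_append, inv_mul_cancel_left]
      refine this.trans ?_
      simp
    have claim : ∃ i, i + 2 * m ≤ n ∧ wdn S (p i) (p (i + 2 * m)) < 2 * m := by
      by_contra hcon
      push Not at hcon
      obtain ⟨j, hj, hmax⟩ := Finset.exists_max_image (Finset.range (n + 1)) (fun i => wdn S 1 (p i)) ⟨0, by simp⟩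
      simp only [Finset.mem_range] at hj hmax
      have c0 := hcon 0 (by omega)
      rw [hp0, Nat.zero_add] at c0
      have hD : 2 * m ≤ wdn S 1 (p j) := c0.trans (hmax _ (by omega))
      have hj1 := hstep 0 j (by omega) (by omega)
      have hj2 := hstep j n (by omega) (by omega)
      rw [hp0] at hj1
      rw [hpn, wdn_comm hS.2] at hj2
      obtain ⟨i, rfl⟩ : ∃ i, j = i + m := ⟨j - m, by omega⟩
      have c1 := hcon i (by omega)
      have a1 := hstep i (i + m) (by omega) (by omega)
      have a2 := hstep (i + m) (i + 2 * m) (by omega) (by omega)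
      have m1 := hmax i (by omega)
      have m2 := hmax (i + 2 * m) (by omega)
      have q := h4 1 (p i) (p (i + m)) (p (i + 2 * m))
      have conv : ∀ x y, wordDist S x y = wdn S x y := fun _ _ => rfl
      simp only [gprod, conv] at q
      rw [wdn_comm hS.2 (p i) 1, wdn_comm hS.2 (p (i + m)) 1, wdn_comm hS.2 (p (i + 2 * m)) 1] at q
      have c1' : (2 * m : ℝ) ≤ wdn S (p i) (p (i + 2 * m)) := by exact_mod_cast c1
      have a1' : (wdn S (p i) (p (i + m)) : ℝ) ≤ m := by
        have : wdn S (p i) (p (i + m)) ≤ m := by omega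
        exact_mod_cast this
      have a2' : (wdn S (p (i + m)) (p (i + 2 * m)) : ℝ) ≤ m := by
        have : wdn S (p (i + m)) (p (i + 2 * m)) ≤ m := by omega
        exact_mod_cast this
      have m1' : (wdn S 1 (p i) : ℝ) ≤ wdn S 1 (p (i + m)) := by exact_mod_cast m1
      have m2' : (wdn S 1 (p (i + 2 * m)) : ℝ) ≤ wdn S 1 (p (i + m)) := by exact_mod_cast m2
      rcases min_le_iff.1 q with q | q <;> linarith
    obtain ⟨i, hi, hlt⟩ := claim
    obtain ⟨v, hv, hv1, hv2⟩ := wl_exists hS.2 ((p i)⁻¹ * p (i + 2 * m))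
    set w1 := w.take i with hw1
    set w2 := (w.drop i).take (2 * m) with hw2
    set w3 := (w.drop i).drop (2 * m) with hw3
    have hwe : w = w1 ++ (w2 ++ w3) := by simp [hw1, hw2, hw3]
    have hl2 : w2.length = 2 * m := by simp [hw2]; omega
    have hl : w.length = w1.length + (w2.length + w3.length) := by
      conv_lhs => rw [hwe]
      simp only [List.length_append]
    have hpr : v.prod = w2.prod := by
      rw [hv2]
      have : p (i + 2 * m) = w1.prod * w2.prod := by
        simp only [hpdef, hw1, hw2]
        rw [List.take_add, List.prod_append]
      rw [this]; simp [hpdef, hw1]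
    have hvl : v.length < 2 * m := by rw [hv1]; exact hlt
    have hw2' : ∀ x ∈ w2, x ∈ S ∨ x⁻¹ ∈ S := fun x hx => hw x (by rw [hwe]; simp [hx])
    have key := ih (w1 ++ (v ++ w3)).length (by simp only [List.length_append]; omega) (w1 ++ (v ++ w3)) (by
      intro x hx
      simp only [List.mem_append] at hx
      rcases hx with hx | hx | hx
      · exact hw x (by rw [hwe]; simp [hx])
      · exact hv x hx
      · exact hw x (by rw [hwe]; simp [hx])) rfl (by
      rw [hwe] at hp
      simpa [hpr] using hp) g
    have k1 := hκ w2 hw2' (by omega) (g * w1.prod)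
    have k2 := hκ v hv (by omega) (g * w1.prod)
    rw [hpr] at k2
    have hlen : ((w1 ++ (v ++ w3)).length : ℤ) + 1 ≤ n := by
      have : (w1 ++ (v ++ w3)).length + 1 ≤ n := by simp only [List.length_append]; omega
      exact_mod_cast this
    have e1 : SO Om g w = SO Om g w1 + (SO Om (g * w1.prod) w2 + SO Om (g * w1.prod * w2.prod) w3) := by
      conv_lhs => rw [hwe]
      rw [SO_append, SO_append]
    have e2 : SO Om g (w1 ++ (v ++ w3)) = SO Om g w1 + (SO Om (g * w1.prod) v + SO Om (g * w1.prod * w2.prod) w3) := by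
      rw [SO_append, SO_append, hpr]
    rw [e2] at key
    rw [e1]
    have : 3 * κ * ((w1 ++ (v ++ w3)).length + 1) ≤ 3 * κ * n := by
      apply mul_le_mul_of_nonneg_left hlen; positivity
    rw [abs_le] at *
    constructor <;> nlinarith [k1.1, k1.2, k2.1, k2.2, key.1, key.2]

theorem lin_iso (hG : IsHypGroup G) {Om : G → G → ℤ} (hO : Coarse Om) (F : Set G) (hF : F.Finite) :
    ∃ C : ℤ, 0 ≤ C ∧ ∀ w : List G, (∀ x ∈ w, x ∈ F) → w.prod = 1 → ∀ g,
      |SO Om g w| ≤ C * (w.length + 1) := by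
  obtain ⟨S, hS, hyp⟩ := hG
  obtain ⟨C, hC0, hC⟩ := lin_iso_gen hS hyp hO
  obtain ⟨R, hR⟩ := wl_bound hS.2 hF
  have hF' : ({x | x ∈ S ∨ x⁻¹ ∈ S} : Set G).Finite := by
    have := hS.1.union (hS.1.image (·⁻¹))
    apply this.subset
    rintro x (h | h)
    · exact Or.inl h
    · exact Or.inr ⟨x⁻¹, h, by simp⟩
  obtain ⟨κ, hκ0, hκ⟩ := hO.short hF' R
  have main : ∀ w : List G, (∀ x ∈ w, x ∈ F) → ∃ W : List G, (∀ x ∈ W, x ∈ S ∨ x⁻¹ ∈ S) ∧ W.length ≤ R * w.length ∧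
      W.prod = w.prod ∧ ∀ g, |SO Om g w - SO Om g W| ≤ κ * w.length := by
    intro w
    induction w with
    | nil => intro _; exact ⟨[], by simp, by simp, rfl, by simp⟩
    | cons a w ih =>
      intro hw
      obtain ⟨W, h1, h2, h3, h4⟩ := ih (fun x hx => hw x (by simp [hx]))
      obtain ⟨v, v1, v2, v3⟩ := wl_exists hS.2 a
      have hv := hR a (hw a (by simp))
      refine ⟨v ++ W, ?_, ?_, by simp [v3, h3], ?_⟩
      · intro x hx
        rcases List.mem_append.1 hx with hx | hx
        · exact v1 x hx
        · exact h1 x hx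
      · simp only [List.length_append, List.length_cons]; nlinarith
      · intro g
        have a1 := hκ v v1 (by omega) g
        have a2 := h4 (g * a)
        rw [v3] at a1
        rw [SO_append, v3]
        simp only [SO, List.length_cons]
        push_cast
        rw [abs_le] at *
        constructor <;> nlinarith [a1.1, a1.2, a2.1, a2.2]
  refine ⟨κ + C * (R + 1), by positivity, fun w hw hp g => ?_⟩
  obtain ⟨W, h1, h2, h3, h4⟩ := main w hw
  have a1 := hC _ W h1 rfl (by rw [h3, hp]) g
  have a2 := h4 g
  have h2' : (W.length : ℤ) ≤ R * w.length := by exact_mod_cast h2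
  have hw0 : (0:ℤ) ≤ w.length := by positivity
  have hR0 : (0:ℤ) ≤ R := by positivity
  have b1 : C * (W.length + 1) ≤ C * (R + 1) * (w.length + 1) := by
    rw [mul_assoc]; apply mul_le_mul_of_nonneg_left _ hC0; nlinarith
  rw [abs_le] at *
  constructor <;> nlinarith [a1.1, a1.2, a2.1, a2.2]

end LinIso

section Flare

/-- discrete primitive -/
def TT (f : ℤ → ℤ) : ℤ → ℤ
  | Int.ofNat n => ∑ i ∈ Finset.range n, f i
  | Int.negSucc n => - ∑ i ∈ Finset.range (n + 1), f (-(i : ℤ) - 1)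

theorem TT_succ (f : ℤ → ℤ) (j : ℤ) : TT f (j + 1) = TT f j + f j := by
  match j with
  | Int.ofNat n => exact Finset.sum_range_succ _ n
  | Int.negSucc 0 =>
    show TT f (Int.ofNat 0) = _
    simp [TT]
  | Int.negSucc (n + 1) =>
    show TT f (Int.negSucc n) = _
    simp only [TT]
    rw [Finset.sum_range_succ _ (n + 1)]
    have : Int.negSucc (n + 1) = -((n + 1 : ℕ) : ℤ) - 1 := by rw [Int.negSucc_eq]; push_cast; ring
    rw [this]; ring

theorem TT_zero (f : ℤ → ℤ) (hf : ∀ j, f j = 0) (j : ℤ) : TT f j = 0 := by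
  match j with
  | Int.ofNat n => simp [TT, hf]
  | Int.negSucc n => simp [TT, hf]

theorem step_bound (f : ℤ → ℤ) (c : ℤ) (n : ℕ) (p : ℤ)
    (h : ∀ j, p ≤ j → j < p + n → |f (j + 1) - f j| ≤ c) : |f (p + n) - f p| ≤ c * n := by
  induction n with
  | zero => simp
  | succ n ih =>
    have h1 := ih (fun j a b => h j a (by push_cast; omega))
    have h2 := h (p + n) (by omega) (by push_cast; omega)
    push_cast
    rw [← add_assoc]
    rw [abs_le] at *
    constructor <;> linarith [h1.1, h1.2, h2.1, h2.2]

variable {K : Type*} [Group K] {l : K → ℕ}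

/-- heights -/
def hh (l : K → ℕ) (φ : MulAut K) (k : K) : ℤ → ℤ := fun r => (l ((φ ^ (-r)) k) : ℤ)

/-- the coarse cocycle on the mapping torus -/
def OmT (l : K → ℕ) (φ : MulAut K) (g g' : K ⋊[zpowersHom (MulAut K) φ] Multiplicative ℤ) : ℤ :=
  TT (hh l φ g.left) g'.right.toAdd - TT (hh l φ g.left) g.right.toAdd

theorem lip_hh (h : TreeLen l) (φ : MulAut K) (k s : K) (i r : ℤ) :
    |hh l φ (k * (φ ^ i) s) r - hh l φ k r| ≤ l ((φ ^ (i - r)) s) := by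
  simp only [hh, map_mul]
  rw [← MulAut.mul_apply, ← zpow_add, neg_add_eq_sub]
  have h1 := h.mul_le ((φ ^ (-r)) k) ((φ ^ (i - r)) s)
  have h2 := h.mul_le ((φ ^ (-r)) k * (φ ^ (i - r)) s) ((φ ^ (i - r)) s)⁻¹
  rw [mul_inv_cancel_right, h.inv] at h2
  rw [abs_le]; constructor <;> omega

theorem coarse_OmT (h : TreeLen l) (φ : MulAut K) : Coarse (OmT l φ) := by
  intro F hF
  set c : K → ℤ → ℤ := fun s N => ∑ r ∈ Finset.Icc (-N) N, (l ((φ ^ r) s) : ℤ) with hc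
  have hc' : ∀ s N r, -N ≤ r → r ≤ N → (l ((φ ^ r) s) : ℤ) ≤ c s N := by
    intro s N r h1 h2
    exact Finset.single_le_sum (f := fun r => (l ((φ ^ r) s) : ℤ)) (fun _ _ => by positivity) (Finset.mem_Icc.2 ⟨h1, h2⟩)
  set B : (K ⋊[zpowersHom (MulAut K) φ] Multiplicative ℤ) × (K ⋊[zpowersHom (MulAut K) φ] Multiplicative ℤ) → ℤ :=
    fun p => c p.1.left (|p.1.right.toAdd| + |p.2.right.toAdd|) * |p.2.right.toAdd| with hB
  obtain ⟨κ, hκ⟩ := ((hF.prod hF).image B).bddAbove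
  refine ⟨κ, fun g s hs s' hs' => ?_⟩
  refine le_trans ?_ (hκ ⟨(s, s'), ⟨hs, hs'⟩, rfl⟩)
  obtain ⟨k, i⟩ := g
  obtain ⟨x, a⟩ := s
  obtain ⟨y, b⟩ := s'
  have e1 : ((⟨k, i⟩ : K ⋊[zpowersHom (MulAut K) φ] Multiplicative ℤ) * ⟨x, a⟩) =
     ⟨k * (φ ^ i.toAdd) x, i * a⟩ := by
    rfl
  rw [e1]
  simp only [OmT, SemidirectProduct.mul_right, toAdd_mul, hB]
  generalize i.toAdd = i
  generalize a.toAdd = a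
  generalize b.toAdd = b
  set f : ℤ → ℤ := fun j => TT (hh l φ (k * (φ ^ i) x)) j - TT (hh l φ k) j with hf
  have hfs : ∀ j, |j - i| ≤ |a| + |b| → |f (j + 1) - f j| ≤ c x (|a| + |b|) := by
    intro j hj
    have : f (j + 1) - f j = hh l φ (k * (φ ^ i) x) j - hh l φ k j := by
      simp only [hf, TT_succ]; ring
    rw [this]
    refine (lip_hh h φ k x i j).trans (hc' _ _ _ ?_ ?_)
    · rw [abs_le] at hj; omega
    · rw [abs_le] at hj; omega
  have goal : |f (i + a + b) - f (i + a)| ≤ c x (|a| + |b|) * |b| := by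
    rcases le_total 0 b with hb | hb
    · have := step_bound f (c x (|a| + |b|)) b.toNat (i + a) (fun j h1 h2 => hfs j (by
        rw [Int.toNat_of_nonneg hb] at h2
        rw [abs_le, abs_of_nonneg hb]
        have := neg_abs_le a; have := le_abs_self a
        constructor <;> omega))
      rw [Int.toNat_of_nonneg hb] at this
      rwa [abs_of_nonneg hb] at this ⊢
    · have hb' : 0 ≤ -b := by omega
      have := step_bound f (c x (|a| + |b|)) (-b).toNat (i + a + b) (fun j h1 h2 => hfs j (by
        rw [Int.toNat_of_nonneg hb'] at h2
        rw [abs_le, abs_of_nonpos hb]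
        have := neg_abs_le a; have := le_abs_self a
        constructor <;> omega))
      rw [Int.toNat_of_nonneg hb', abs_of_nonpos hb, abs_sub_comm] at this
      rw [abs_of_nonpos hb]
      convert this using 3
      · rw [show i + a + b + -b = i + a by ring]
  have e9 : TT (hh l φ k) (i + a) - TT (hh l φ k) i + (TT (hh l φ (k * (φ ^ i) x)) (i + a + b) -
      TT (hh l φ (k * (φ ^ i) x)) (i + a)) - (TT (hh l φ k) (i + a + b) - TT (hh l φ k) i)
      = f (i + a + b) - f (i + a) := by
    simp only [hf]; ring
  rw [← e9] at goal
  exact goal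

theorem SO_horiz (φ : MulAut K) (w : List K) (g : K ⋊[zpowersHom (MulAut K) φ] Multiplicative ℤ) :
    SO (OmT l φ) g (w.map SemidirectProduct.inl) = 0 := by
  induction w generalizing g with
  | nil => simp [SO]
  | cons a w ih => simp [SO, ih, OmT]

theorem SO_vert (φ : MulAut K) (t : Multiplicative ℤ) (n : ℕ) (g : K ⋊[zpowersHom (MulAut K) φ] Multiplicative ℤ) :
    SO (OmT l φ) g (List.replicate n (SemidirectProduct.inr t)) =
      TT (hh l φ g.left) (g.right.toAdd + n * t.toAdd) - TT (hh l φ g.left) g.right.toAdd := by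
  induction n generalizing g with
  | zero => simp [SO]
  | succ n ih =>
    simp only [List.replicate_succ, SO, ih, OmT, SemidirectProduct.mul_right, SemidirectProduct.mul_left,
      SemidirectProduct.right_inr, SemidirectProduct.left_inr, map_one, mul_one, toAdd_mul]
    push_cast
    rw [show g.right.toAdd + t.toAdd + n * t.toAdd = g.right.toAdd + (n + 1) * t.toAdd by ring]
    ring

theorem ladder (h : TreeLen l) (φ : MulAut K) (ha : AtoroidalAut φ) : ∃ C : ℕ, ∀ (n : ℕ) (w : K),
    TT (hh l φ w) n - TT (hh l φ w) (-n) ≤ C * (4 * n + l ((φ ^ n) w) + l ((φ ^ n)⁻¹ w) + 1) := by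
  obtain ⟨C, hC0, hC⟩ := lin_iso ha (coarse_OmT h φ)
    ((SemidirectProduct.inl '' {x | l x ≤ 1}) ∪ {SemidirectProduct.inr (Multiplicative.ofAdd 1),
      SemidirectProduct.inr (Multiplicative.ofAdd (-1))}) (((h.fin 1).image _).union (Set.toFinite _))
  refine ⟨C.toNat, fun n w => ?_⟩
  rw [Int.toNat_of_nonneg hC0]
  obtain ⟨u, u1, u2, u3⟩ := h.letters _ ((φ ^ n) w) rfl
  obtain ⟨v, v1, v2, v3⟩ := h.letters _ ((φ ^ n)⁻¹ w)⁻¹ rfl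
  rw [h.inv] at v2
  set W : List (K ⋊[zpowersHom (MulAut K) φ] Multiplicative ℤ) := u.map SemidirectProduct.inl ++
    (List.replicate (2 * n) (SemidirectProduct.inr (Multiplicative.ofAdd 1)) ++ (v.map SemidirectProduct.inl ++
      List.replicate (2 * n) (SemidirectProduct.inr (Multiplicative.ofAdd (-1))))) with hW
  have pu : (u.map (SemidirectProduct.inl : K →* K ⋊[zpowersHom (MulAut K) φ] Multiplicative ℤ)).prod
    = SemidirectProduct.inl ((φ ^ n) w) := by rw [← map_list_prod, u1]
  have pv : (v.map (SemidirectProduct.inl : K →* K ⋊[zpowersHom (MulAut K) φ] Multiplicative ℤ)).prod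
    = SemidirectProduct.inl ((φ ^ n)⁻¹ w)⁻¹ := by rw [← map_list_prod, v1]
  have hphi : ∀ z : ℤ, zpowersHom (MulAut K) φ (Multiplicative.ofAdd z) = φ ^ z := fun z => rfl
  have hpow : ∀ z : ℤ, (SemidirectProduct.inr (Multiplicative.ofAdd z) : K ⋊[zpowersHom (MulAut K) φ] Multiplicative ℤ) ^ (2 * n) =
      SemidirectProduct.inr (Multiplicative.ofAdd (2 * n * z)) := by
    intro z
    rw [← map_pow, ← ofAdd_nsmul]; simp
  have hl0 : (φ ^ n) w * (φ ^ (2 * (n : ℤ))) ((φ ^ n)⁻¹ w)⁻¹ = 1 := by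
    rw [map_inv, ← zpow_natCast, ← zpow_neg, ← MulAut.mul_apply, ← zpow_add]
    rw [show 2 * (n : ℤ) + -n = n by ring, mul_inv_cancel]
  have hprod : W.prod = 1 := by
    rw [hW]
    simp only [List.prod_append, pu, pv, List.prod_replicate, hpow]
    ext
    · simp only [SemidirectProduct.mul_left, SemidirectProduct.left_inl, SemidirectProduct.right_inl, map_one,
        SemidirectProduct.left_inr, SemidirectProduct.right_inr, MulAut.one_apply, mul_one, one_mul, hphi,
        SemidirectProduct.one_left]
      exact hl0
    · simp only [SemidirectProduct.mul_right, SemidirectProduct.right_inl, SemidirectProduct.right_inr, one_mul,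
        SemidirectProduct.one_right, ← ofAdd_add]
      simp
  have hmem : ∀ x ∈ W, x ∈ ((SemidirectProduct.inl '' {x | l x ≤ 1}) ∪ {SemidirectProduct.inr (Multiplicative.ofAdd 1),
      SemidirectProduct.inr (Multiplicative.ofAdd (-1))} : Set (K ⋊[zpowersHom (MulAut K) φ] Multiplicative ℤ)) := by
    intro x hx
    simp only [hW, List.mem_append, List.mem_map, List.mem_replicate] at hx
    rcases hx with ⟨y, hy, rfl⟩ | ⟨_, rfl⟩ | ⟨y, hy, rfl⟩ | ⟨_, rfl⟩
    · left; exact ⟨y, u3 y hy, rfl⟩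
    · right; left; rfl
    · left; exact ⟨y, v3 y hy, rfl⟩
    · right; right; rfl
  have key := hC W hmem hprod (SemidirectProduct.inr (Multiplicative.ofAdd (-(n : ℤ))))
  have hlen : (W.length : ℤ) = 4 * n + l ((φ ^ n) w) + l ((φ ^ n)⁻¹ w) := by
    simp only [hW, List.length_append, List.length_map, List.length_replicate, u2, v2]
    push_cast; ring
  rw [hlen] at key
  have hw0 : (φ ^ (-(n : ℤ))) ((φ ^ n) w) = w := by
    rw [zpow_neg, zpow_natCast]; simp
  have hval : SO (OmT l φ) (SemidirectProduct.inr (Multiplicative.ofAdd (-(n : ℤ)))) W =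
      TT (hh l φ w) n - TT (hh l φ w) (-n) := by
    simp only [hW, SO_append, SO_horiz, SO_vert, pu, pv, List.prod_replicate, hpow]
    simp only [SemidirectProduct.mul_left, SemidirectProduct.left_inl, SemidirectProduct.right_inl, map_one,
        SemidirectProduct.left_inr, SemidirectProduct.right_inr, MulAut.one_apply, mul_one, one_mul, hphi,
        SemidirectProduct.mul_right, hw0, toAdd_mul, toAdd_ofAdd, ← zpow_add, ← MulAut.mul_apply, ← ofAdd_add]
    have z1 : w * (φ ^ (-(n : ℤ) + 2 * n)) (((φ ^ n)⁻¹) w)⁻¹ = 1 := by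
      rw [show -(n : ℤ) + 2 * n = n by ring, zpow_natCast]; simp
    have z2 : ∀ j, TT (hh l φ (1 : K)) j = 0 := TT_zero _ (fun j => by simp [hh, h.one])
    rw [z1, z2, z2]
    rw [show -(n : ℤ) + ↑(2 * n) = n by push_cast; ring]
    simp
  rw [hval] at key
  exact (le_abs_self _).trans key

theorem flare (h : TreeLen l) (φ : MulAut K) (ha : AtoroidalAut φ) (Λ : ℕ) :
    ∃ n : ℕ, 1 ≤ n ∧ ∃ C : ℕ, ∀ w, Λ * l w ≤ l ((φ ^ n) w) + l ((φ ^ n)⁻¹ w) + C := by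
  obtain ⟨C0, hC0⟩ := ladder h φ ha
  set C : ℝ := C0 + 1 with hC
  have hCpos : 0 < C := by positivity
  set s : K → ℕ → ℝ := fun w n => ((TT (hh l φ w) n - TT (hh l φ w) (-n) : ℤ) : ℝ) with hs
  set A : K → ℕ → ℝ := fun w n => l ((φ ^ n) w) + l ((φ ^ n)⁻¹ w) with hA
  have hA0 : ∀ w n, 0 ≤ A w n := fun w n => by positivity
  have hbd : ∀ w n, s w n ≤ C * (4 * n + A w n + 1) := by
    intro w n
    have := hC0 n w
    have : s w n ≤ C0 * (4 * n + A w n + 1) := by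
      simp only [hs, hA]
      have t : ((TT (hh l φ w) n - TT (hh l φ w) (-n) : ℤ) : ℝ) ≤ ((C0 * (4 * n + l ((φ ^ n) w) + l ((φ ^ n)⁻¹ w) + 1) : ℤ) : ℝ) := by
        exact_mod_cast this
      push_cast at t ⊢
      linarith
    have h2 := hA0 w n
    have : (0:ℝ) ≤ 4 * n + A w n + 1 := by positivity
    nlinarith
  have hst : ∀ w n, s w (n + 1) = s w n + l ((φ ^ n)⁻¹ w) + l ((φ ^ (n + 1)) w) := by
    intro w n
    simp only [hs]
    have e1 := TT_succ (hh l φ w) n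
    have e2 := TT_succ (hh l φ w) (-((n + 1 : ℕ) : ℤ))
    rw [show -((n + 1 : ℕ) : ℤ) + 1 = -(n : ℤ) by push_cast; ring] at e2
    push_cast at e1 e2 ⊢
    rw [e1, e2]
    have e3 : hh l φ w n = l ((φ ^ n)⁻¹ w) := by simp [hh]
    have e4 : hh l φ w (-1 + -n) = l ((φ ^ (n + 1)) w) := by
      simp only [hh]
      rw [show -(-1 + -(n:ℤ)) = ((n + 1 : ℕ) : ℤ) by push_cast; ring, zpow_natCast]
    have e5 : (-((n : ℤ) + 1)) = -1 + -n := by ring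
    rw [e5, e3, e4]
    push_cast; ring
  have grow : ∀ k : ℕ, ∃ D : ℝ, ∀ w, (1 + 1 / C) ^ k * l w ≤ s w (2 * k + 1) + D := by
    intro k
    induction k with
    | zero =>
      refine ⟨0, fun w => ?_⟩
      have := hst w 0
      simp [hs] at this ⊢
      linarith [this, (show (0:ℝ) ≤ l (φ w) by positivity)]
    | succ k ih =>
      obtain ⟨D, hD⟩ := ih
      refine ⟨(1 + 1 / C) * D + (4 * (2 * k + 2) + 1), fun w => ?_⟩
      have a1 := hst w (2 * k + 1)
      have a2 := hst w (2 * k + 2)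
      have a3 := hbd w (2 * k + 2)
      have a4 := hD w
      have p1 : (0:ℝ) ≤ l ((φ ^ (2 * k + 1))⁻¹ w) := by positivity
      have p2 : (0:ℝ) ≤ l ((φ ^ (2 * k + 2 + 1)) w) := by positivity
      have p3 : (0:ℝ) ≤ l ((φ ^ (2 * k + 1 + 1)) w) := by positivity
      have a5 : s w (2 * k + 2) / C ≤ 4 * (2 * k + 2) + A w (2 * k + 2) + 1 := by
        rw [div_le_iff₀ hCpos]; push_cast at a3; linarith
      have a6 : s w (2 * k + 1) / C ≤ s w (2 * k + 2) / C := by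
        apply div_le_div_of_nonneg_right _ hCpos.le
        rw [show 2 * k + 2 = 2 * k + 1 + 1 by ring, a1]; linarith
      have a7 : s w (2 * (k + 1) + 1) ≥ s w (2 * k + 1) + A w (2 * k + 2) := by
        rw [show 2 * (k + 1) + 1 = 2 * k + 2 + 1 by ring, a2, show 2 * k + 2 = 2 * k + 1 + 1 by ring, a1]
        simp only [hA]; linarith
      have a8 : (1 + 1 / C) * ((1 + 1 / C) ^ k * l w) ≤ (1 + 1 / C) * (s w (2 * k + 1) + D) := by
        apply mul_le_mul_of_nonneg_left a4; positivity
      have a9 : (1 + 1 / C) * (s w (2 * k + 1) + D) = s w (2 * k + 1) + s w (2 * k + 1) / C + (1 + 1 / C) * D := by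
        field_simp
      rw [pow_succ]
      linarith
  obtain ⟨k, hk⟩ := pow_unbounded_of_one_lt (Λ * C) (show 1 < 1 + 1 / C by
    have : 0 < 1 / C := by positivity
    linarith)
  obtain ⟨D, hD⟩ := grow k
  obtain ⟨E, hE⟩ := exists_nat_gt (D / C + 4 * (2 * k + 1) + 1)
  refine ⟨2 * k + 1, by omega, E, fun w => ?_⟩
  have b1 := hbd w (2 * k + 1)
  have b2 := hD w
  have hlw : (0:ℝ) ≤ l w := by positivity
  have b3 : Λ * C * l w ≤ C * (4 * (2 * k + 1) + A w (2 * k + 1) + 1) + D := by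
    push_cast at b1
    nlinarith
  have b4 : Λ * l w ≤ A w (2 * k + 1) + E := by
    have : Λ * l w ≤ 4 * (2 * k + 1) + A w (2 * k + 1) + 1 + D / C := by
      have e : Λ * (l w : ℝ) = (Λ * C * l w) / C := by field_simp
      rw [e, div_le_iff₀ hCpos, add_mul, div_mul_cancel₀ _ hCpos.ne']
      linarith
    linarith
  simp only [hA] at b4
  exact_mod_cast b4

end Flare

section Growth

variable {K : Type*} [Group K] {l : K → ℕ}

/-- flaring -/
def Fl (l : K → ℕ) (Φ : MulAut K) (C0 : ℕ) : Prop := ∀ w, 16 * l w ≤ l (Φ w) + l (Φ⁻¹ w) + C0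

theorem Fl.inv {Φ : MulAut K} {C0 : ℕ} (h : Fl l Φ C0) : Fl l Φ⁻¹ C0 := by
  intro w
  have := h w
  rw [inv_inv]; omega

theorem Fl.grow {Φ : MulAut K} {C0 : ℕ} (h : Fl l Φ C0) {p : K} (h1 : C0 ≤ l p) (h2 : l p ≤ l (Φ p)) :
    ∀ j, 8 ^ j * l (Φ p) ≤ l ((Φ ^ (j + 1)) p) ∧ l p ≤ l ((Φ ^ (j + 1)) p) ∧ l ((Φ ^ j) p) ≤ l ((Φ ^ (j + 1)) p) := by
  intro j
  induction j with
  | zero => simpa using h2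
  | succ j ih =>
    obtain ⟨a1, a2, a3⟩ := ih
    have := h ((Φ ^ (j + 1)) p)
    have e1 : Φ ((Φ ^ (j + 1)) p) = (Φ ^ (j + 1 + 1)) p := by
      rw [pow_succ' Φ (j + 1), MulAut.mul_apply]
    have e2 : Φ⁻¹ ((Φ ^ (j + 1)) p) = (Φ ^ j) p := by
      rw [pow_succ' Φ j, MulAut.mul_apply]; simp
    rw [e1, e2] at this
    refine ⟨?_, by omega, by omega⟩
    rw [pow_succ]
    have : 8 ^ j * 8 * l (Φ p) = 8 * (8 ^ j * l (Φ p)) := by ring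
    omega

theorem lip_pow (h : TreeLen l) (φ : MulAut K) (n : ℕ) : ∃ L, 1 ≤ L ∧ ∀ i, i ≤ n → ∀ x, l x ≤ L * l ((φ ^ i) x) := by
  obtain ⟨L1, hL1, hL⟩ := h.lip h (φ⁻¹ : MulAut K).toMonoidHom
  have hL' : ∀ x, l x ≤ L1 * l (φ x) := by
    intro x
    have := hL (φ x)
    simpa using this
  have key : ∀ i x, l x ≤ L1 ^ i * l ((φ ^ i) x) := by
    intro i
    induction i with
    | zero => intro x; simp
    | succ i ih =>
      intro x
      have a1 := ih x
      have a2 := hL' ((φ ^ i) x)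
      rw [← MulAut.mul_apply, ← pow_succ'] at a2
      calc l x ≤ L1 ^ i * l ((φ ^ i) x) := a1
        _ ≤ L1 ^ i * (L1 * l ((φ ^ (i + 1)) x)) := Nat.mul_le_mul_left _ a2
        _ = _ := by ring
  refine ⟨L1 ^ n, Nat.one_le_pow _ _ (by omega), fun i hi x => (key i x).trans ?_⟩
  exact Nat.mul_le_mul_right _ (Nat.pow_le_pow_right (by omega) hi)

theorem grow1 (h : TreeLen l) (φ : MulAut K) {n0 C0 : ℕ} (hn : 1 ≤ n0) (hF : Fl l (φ ^ n0) C0) (M q : ℕ) :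
    ∃ N C, ∀ m, N ≤ m → ∀ p, C ≤ l p → ∀ j, j ≤ q → l (((φ ^ n0) ^ j) p) ≤ l (((φ ^ n0) ^ (j + 1)) p) →
      M * l p ≤ l ((φ ^ m) p) := by
  obtain ⟨L, hL1, hL⟩ := lip_pow h φ (n0 * (q + 2))
  obtain ⟨i0, hi0⟩ : ∃ i0 : ℕ, M * (L * L) ≤ 8 ^ i0 := ⟨M * (L * L), (Nat.lt_pow_self (by norm_num)).le⟩
  refine ⟨n0 * (q + 1 + i0), L * C0, ?_⟩
  intro m hm p hp j hj hjj
  set Φ := φ ^ n0 with hΦ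
  have hLj : l p ≤ L * l ((Φ ^ j) p) := by
    rw [hΦ, ← pow_mul]
    exact hL _ (Nat.mul_le_mul_left _ (by omega)) p
  have h1 : C0 ≤ l ((Φ ^ j) p) := by
    have : L * C0 ≤ L * l ((Φ ^ j) p) := hp.trans hLj
    exact Nat.le_of_mul_le_mul_left this (by omega)
  have h2 : l ((Φ ^ j) p) ≤ l (Φ ((Φ ^ j) p)) := by
    rw [← MulAut.mul_apply, ← pow_succ']; exact hjj
  set Q := m / n0 with hQ
  have hQm : n0 * Q + m % n0 = m := Nat.div_add_mod m n0
  have hr : m % n0 < n0 := Nat.mod_lt _ (by omega)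
  have hQge : q + 1 + i0 ≤ Q := by
    rw [hQ, Nat.le_div_iff_mul_le (by omega)]; rw [mul_comm]; exact hm
  obtain ⟨i, hi⟩ : ∃ i, Q = i + 1 + j := ⟨Q - 1 - j, by omega⟩
  have hg := (hF.grow h1 h2 i).1
  have e1 : (Φ ^ (i + 1)) ((Φ ^ j) p) = (Φ ^ Q) p := by
    rw [← MulAut.mul_apply, ← pow_add, hi]
  rw [e1] at hg
  have e2 : (φ ^ m) p = (φ ^ (m % n0)) ((Φ ^ Q) p) := by
    rw [← MulAut.mul_apply, hΦ, ← pow_mul, ← pow_add, add_comm, hQm]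
  have hL2 := hL (m % n0) (by nlinarith) ((Φ ^ Q) p)
  rw [← e2] at hL2
  have a1 : 8 ^ i * l p ≤ L * (L * l ((φ ^ m) p)) := by
    calc 8 ^ i * l p ≤ 8 ^ i * (L * l (Φ ((Φ ^ j) p))) := Nat.mul_le_mul_left _ (hLj.trans (Nat.mul_le_mul_left _ h2))
      _ = L * (8 ^ i * l (Φ ((Φ ^ j) p))) := by ring
      _ ≤ L * l ((Φ ^ Q) p) := Nat.mul_le_mul_left _ hg
      _ ≤ _ := Nat.mul_le_mul_left _ hL2
  have a2 : M * (L * L) * l p ≤ 8 ^ i * l p := by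
    apply Nat.mul_le_mul_right
    exact hi0.trans (Nat.pow_le_pow_right (by norm_num) (by omega))
  have a3 : (L * L) * (M * l p) ≤ (L * L) * l ((φ ^ m) p) := by
    calc (L * L) * (M * l p) = M * (L * L) * l p := by ring
      _ ≤ _ := a2.trans a1
      _ = _ := by ring
  exact Nat.le_of_mul_le_mul_left a3 (by positivity)

theorem exists_Fl (h : TreeLen l) (φ : MulAut K) (ha : AtoroidalAut φ) : ∃ n0, 1 ≤ n0 ∧ ∃ C0, Fl l (φ ^ n0) C0 := by
  obtain ⟨n, hn, C, hC⟩ := flare h φ ha 16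
  exact ⟨n, hn, C, hC⟩

/-- one of the two directions is nondecreasing -/
theorem Fl.either {Φ : MulAut K} {C0 : ℕ} (h : Fl l Φ C0) {p : K} (h1 : C0 ≤ l p) :
    l p ≤ l (Φ p) ∨ l p ≤ l (Φ⁻¹ p) := by
  have := h p; omega

/-- no periodic elements -/
theorem not_periodic (h : TreeLen l) [IsMulTorsionFree K] {φ : MulAut K} {n0 C0 : ℕ} (hF : Fl l (φ ^ n0) C0)
    (x : K) (hx : x ≠ 1) (j : ℕ) (hj : 0 < j) (hp : (φ ^ j) x = x) : False := by
  have hper : ∀ k : ℕ, (φ ^ j) (x ^ k) = x ^ k := fun k => by rw [map_pow, hp]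
  have bound : ∀ k : ℕ, l (x ^ k) ≤ C0 := by
    intro k
    set y := x ^ k
    have hy : (φ ^ j) y = y := hper k
    have hy' : ∀ i : ℕ, ((φ ^ j) ^ i) y = y := by
      intro i
      induction i with
      | zero => simp
      | succ i ih => rw [pow_succ, MulAut.mul_apply, hy, ih]
    obtain ⟨i, hi, hmax⟩ := Finset.exists_max_image (Finset.range j) (fun i => l ((φ ^ i) y)) ⟨0, by simpa using hj⟩
    have hred : ∀ i : ℕ, l ((φ ^ i) y) ≤ l ((φ ^ (i % j)) y) := by
      intro i
      conv_lhs => rw [← Nat.div_add_mod i j, add_comm, pow_add, pow_mul, MulAut.mul_apply, hy']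
    have hall : ∀ i' : ℕ, l ((φ ^ i') y) ≤ l ((φ ^ i) y) := fun i' =>
      (hred i').trans (hmax _ (by simpa using Nat.mod_lt _ hj))
    have := hF ((φ ^ i) y)
    have b1 := hall (n0 + i)
    have e2 : (φ ^ n0)⁻¹ ((φ ^ i) y) = (φ ^ (n0 * (j - 1) + i)) y := by
      apply (φ ^ n0).injective
      rw [MulAut.apply_inv_self, ← MulAut.mul_apply, ← pow_add]
      have e3 : n0 + (n0 * (j - 1) + i) = i + j * n0 := by
        obtain ⟨j', rfl⟩ : ∃ j', j = j' + 1 := ⟨j - 1, by omega⟩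
        simp; ring
      rw [e3, pow_add, pow_mul, MulAut.mul_apply, hy']
    rw [e2] at this
    rw [pow_add, MulAut.mul_apply] at b1
    have b2 := hall (n0 * (j - 1) + i)
    have b3 := hall 0
    simp only [pow_zero, MulAut.one_apply] at b3
    omega
  have hinj : Function.Injective (fun k : ℕ => x ^ k) := by
    rw [injective_pow_iff_not_isOfFinOrder]
    exact not_isOfFinOrder_of_isMulTorsionFree hx
  exact Set.infinite_range_of_injective hinj ((h.fin C0).subset (by rintro _ ⟨k, rfl⟩; exact bound k))
end Growth

section Growth2

variable {K : Type*} [Group K] {l : K → ℕ}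

theorem short_grow1 (h : TreeLen l) [IsMulTorsionFree K] {φ : MulAut K} {n0 C0 : ℕ} (hF : Fl l (φ ^ n0) C0)
    (R M : ℕ) : ∃ N, ∀ n, N ≤ n → ∀ a, a ≠ 1 → l a ≤ R → M * l a ≤ l ((φ ^ n) a) := by
  have key : ∀ a ∈ {x | l x ≤ R}, ∀ᶠ n in Filter.atTop, a ≠ 1 → M * R ≤ l ((φ ^ n) a) := by
    intro a _
    by_cases ha1 : a = 1
    · exact Filter.Eventually.of_forall fun n hn => absurd ha1 hn
    have hinj : Function.Injective (fun n : ℕ => (φ ^ n) a) := by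
      have aux : ∀ n k : ℕ, (φ ^ n) a = (φ ^ (n + (k + 1))) a → False := by
        intro n k hnk
        rw [pow_add, MulAut.mul_apply] at hnk
        exact not_periodic h hF a ha1 (k + 1) (by omega) ((φ ^ n).injective hnk.symm)
      intro n m hnm
      rcases lt_trichotomy n m with h1 | h1 | h1
      · obtain ⟨k, rfl⟩ := Nat.exists_eq_add_of_lt h1
        exact (aux n k hnm).elim
      · exact h1
      · obtain ⟨k, rfl⟩ := Nat.exists_eq_add_of_lt h1
        exact (aux m k hnm.symm).elim
    have hfin : {n : ℕ | (φ ^ n) a ∈ {x | l x ≤ M * R}}.Finite :=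
      Set.Finite.preimage hinj.injOn (h.fin (M * R))
    have := hfin.eventually_cofinite_notMem
    rw [Nat.cofinite_eq_atTop] at this
    filter_upwards [this] with n hn _
    simp only [Set.mem_setOf_eq, not_le] at hn
    exact hn.le
  have := (Filter.eventually_all_finite (h.fin R)).2 key
  obtain ⟨N, hN⟩ := Filter.eventually_atTop.1 this
  refine ⟨N, fun n hn a ha hR => ?_⟩
  exact (Nat.mul_le_mul_left _ hR).trans (hN n hn a hR ha)

theorem short_grow (h : TreeLen l) [IsMulTorsionFree K] {φ : MulAut K} {n0 C0 : ℕ} (hF : Fl l (φ ^ n0) C0)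
    (R M : ℕ) : ∃ N, ∀ n, N ≤ n → ∀ a, l a ≤ R → M * l a ≤ l ((φ ^ n) a) ∧ M * l a ≤ l ((φ ^ n)⁻¹ a) := by
  obtain ⟨N, hN⟩ := short_grow1 h hF R M
  have hF' : Fl l (φ⁻¹ ^ n0) C0 := by rw [inv_pow]; exact hF.inv
  obtain ⟨N', hN'⟩ := short_grow1 h hF' R M
  refine ⟨max N N', fun n hn a hR => ?_⟩
  by_cases ha : a = 1
  · subst ha; simp [h.one]
  refine ⟨hN n (by omega) a ha hR, ?_⟩
  rw [← inv_pow]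
  exact hN' n (by omega) a ha hR

theorem long_either (h : TreeLen l) {φ : MulAut K} {n0 C0 : ℕ} (hn : 1 ≤ n0) (hF : Fl l (φ ^ n0) C0)
    (M : ℕ) : ∃ N C, ∀ n, N ≤ n → ∀ a, C ≤ l a → M * l a ≤ l ((φ ^ n) a) ∨ M * l a ≤ l ((φ ^ n)⁻¹ a) := by
  have hF' : Fl l (φ⁻¹ ^ n0) C0 := by rw [inv_pow]; exact hF.inv
  obtain ⟨N, C, hN⟩ := grow1 h φ hn hF M 0
  obtain ⟨N', C', hN'⟩ := grow1 h φ⁻¹ hn hF' M 0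
  refine ⟨max N N', max C0 (max C C'), fun n hn a hR => ?_⟩
  rcases hF.either (p := a) (by omega) with h1 | h1
  · left
    exact hN n (by omega) a (by omega) 0 le_rfl (by simpa using h1)
  · right
    rw [← inv_pow]
    exact hN' n (by omega) a (by omega) 0 le_rfl (by simpa using h1)

theorem all_either (h : TreeLen l) [IsMulTorsionFree K] {φ : MulAut K} {n0 C0 : ℕ} (hn : 1 ≤ n0) (hF : Fl l (φ ^ n0) C0)
    (M : ℕ) : ∃ N, ∀ n, N ≤ n → ∀ a, M * l a ≤ l ((φ ^ n) a) ∨ M * l a ≤ l ((φ ^ n)⁻¹ a) := by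
  obtain ⟨N, C, hN⟩ := long_either h hn hF M
  obtain ⟨N', hN'⟩ := short_grow h hF C M
  refine ⟨max N N', fun n hn a => ?_⟩
  by_cases hC : C ≤ l a
  · exact hN n (by omega) a hC
  · exact Or.inl (hN' n (by omega) a (by omega)).1

theorem gen_lip (h : TreeLen l) {H : Type*} [Group H] (e : H ≃* K) {T : Set H} (hT : GenSet T) :
    ∃ C, ∀ x, l (e x) ≤ C * wordLength T x := by
  obtain ⟨C, hC⟩ := (hT.1.image (fun x => l (e x))).bddAbove
  refine ⟨C, fun x => ?_⟩
  obtain ⟨w, h1, h2, h3⟩ := wl_exists hT.2 x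
  rw [← h2, ← h3]
  clear h2 h3
  induction w with
  | nil => simp [h.one]
  | cons a w ih =>
    have := ih (fun x hx => h1 x (List.mem_cons_of_mem _ hx))
    have ha : l (e a) ≤ C := by
      rcases h1 a (by simp) with h4 | h4
      · exact hC ⟨a, h4, rfl⟩
      · have := hC ⟨a⁻¹, h4, rfl⟩
        simpa [h.inv] using this
    rw [List.prod_cons, map_mul, List.length_cons]
    have := h.mul_le (e a) (e w.prod)
    nlinarith

theorem exp_lin (P : ℕ) (hP : ∀ j : ℕ, 8 ^ j ≤ P * (j + 1)) : False := by
  have h1 := hP P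
  have h2 : P < 2 ^ P := Nat.lt_pow_self (by norm_num)
  have h3 : P < 4 ^ P := Nat.lt_pow_self (by norm_num)
  have h4 : (8:ℕ) ^ P = 2 ^ P * 4 ^ P := by rw [← mul_pow]; norm_num
  nlinarith

/-- distortion -/
theorem distorted {A G : Type*} [Group A] [Group G] {l : A → ℕ} (h : TreeLen l) [Infinite A]
    (ι : A →* G) (hι : Function.Injective ι) (s : G) (α : MulAut A) (hs : ∀ w, s * ι w * s⁻¹ = ι (α w))
    {C0 : ℕ} (hF : Fl l α C0) (H : Subgroup G) (hH : H = ι.range) : ¬ QIEmbSubgroup H := by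
  subst hH
  rintro ⟨S, T, hS, hT, k, hk, hq⟩
  obtain ⟨w, hw⟩ : ∃ w, C0 + 1 ≤ l w := by
    by_contra hcon
    push Not at hcon
    exact Set.infinite_univ (α := A) ((h.fin (C0 + 1)).subset (fun x _ => (hcon x).le))
  -- choose direction
  obtain ⟨β, t, ht, hβ, hβ2⟩ : ∃ (β : MulAut A) (t : G), (∀ w, t * ι w * t⁻¹ = ι (β w)) ∧ Fl l β C0 ∧ l w ≤ l (β w) := by
    rcases hF.either (p := w) (by omega) with h1 | h1
    · exact ⟨α, s, hs, hF, h1⟩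
    · refine ⟨α⁻¹, s⁻¹, fun w => ?_, hF.inv, h1⟩
      have := hs (α⁻¹ w)
      rw [MulAut.apply_inv_self] at this
      rw [← this]; group
  let e := (MonoidHom.ofInjective hι).symm
  obtain ⟨C, hC⟩ := gen_lip h e hT
  have hup : ∀ j : ℕ, wordLength S (ι ((β ^ j) w)) ≤ 2 * j * wordLength S t + wordLength S (ι w) := by
    intro j
    induction j with
    | zero => simp
    | succ j ih =>
      rw [pow_succ', MulAut.mul_apply, ← ht]
      have h1 := wl_mul hS.2 (t * ι ((β ^ j) w)) t⁻¹
      have h2 := wl_mul hS.2 t (ι ((β ^ j) w))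
      rw [wl_inv hS.2] at h1
      have : 2 * (j + 1) * wordLength S t = 2 * j * wordLength S t + 2 * wordLength S t := by ring
      omega
  obtain ⟨k', hk'⟩ := exists_nat_ge k
  set Q := 2 * wordLength S t + wordLength S (ι w)
  apply exp_lin (C * (k' * (2 * Q + k')))
  intro j
  have g := (hβ.grow (p := w) (by omega) hβ2 j).1
  have g1 : 8 ^ j ≤ l ((β ^ (j + 1)) w) := by
    have : 1 ≤ l (β w) := by omega
    nlinarith [Nat.pow_pos (n := j) (show 0 < 8 by norm_num)]
  let x : ι.range := ⟨ι ((β ^ (j + 1)) w), ⟨_, rfl⟩⟩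
  have ex : e x = (β ^ (j + 1)) w := by
    show (MonoidHom.ofInjective hι).symm x = _
    rw [MulEquiv.symm_apply_eq]
    rfl
  have g2 := hC x
  rw [ex] at g2
  have g3 := (hq 1 x).1
  have g4 := hup (j + 1)
  simp only [wordDist, inv_one, one_mul, Subgroup.coe_one] at g3
  have g5 : (wordLength T x : ℝ) ≤ k * (wordLength S (x : G) + k) := by
    have : (wordLength T x : ℝ) / k ≤ wordLength S (x : G) + k := by linarith
    rw [div_le_iff₀ (by linarith)] at this
    linarith
  have g6 : (wordLength T x : ℝ) ≤ k' * (wordLength S (x : G) + k') := by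
    refine g5.trans ?_
    have : (0:ℝ) ≤ wordLength S (x : G) := by positivity
    gcongr
  have g7 : wordLength T x ≤ k' * (wordLength S (x : G) + k') := by exact_mod_cast g6
  have g8 : wordLength S (x : G) ≤ 2 * Q * (j + 1) := by
    refine g4.trans ?_
    simp only [Q]
    nlinarith [Nat.zero_le (wordLength S t), Nat.zero_le (wordLength S (ι w)), Nat.zero_le (j * wordLength S t), Nat.zero_le (j * wordLength S (ι w))]
  calc 8 ^ j ≤ C * wordLength T x := g1.trans g2
    _ ≤ C * (k' * (wordLength S (x : G) + k')) := by gcongr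
    _ ≤ C * (k' * (2 * Q * (j + 1) + k' * (j + 1))) := by
        gcongr
        nlinarith
    _ = _ := by ring
end Growth2

section FF
universe u
variable {K : Type u} [Group K]

/-- relative free factors, via the universal property -/
def RFF (A H : Subgroup K) : Prop :=
  A ≤ H ∧ ∃ C : Subgroup K, C ≤ H ∧ A ⊔ C = H ∧ ∀ (P : Type u) [Group P] (f : A →* P) (g : C →* P),
    ∃ F : H →* P, (∀ a (ha : a ∈ A) (ha' : a ∈ H), F ⟨a, ha'⟩ = f ⟨a, ha⟩) ∧
      (∀ a (ha : a ∈ C) (ha' : a ∈ H), F ⟨a, ha'⟩ = g ⟨a, ha⟩)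

theorem RFF.trans {A H L : Subgroup K} (h1 : RFF A H) (h2 : RFF H L) : RFF A L := by
  obtain ⟨hAH, C, hC, hgen, hex⟩ := h1
  obtain ⟨hHL, D, hD, hgen', hex'⟩ := h2
  refine ⟨hAH.trans hHL, C ⊔ D, sup_le (hC.trans hHL) hD, ?_, ?_⟩
  · rw [← sup_assoc, hgen, hgen']
  · intro P _ f g
    obtain ⟨F1, a1, a2⟩ := hex P f (g.comp (Subgroup.inclusion le_sup_left))
    obtain ⟨F2, b1, b2⟩ := hex' P F1 (g.comp (Subgroup.inclusion le_sup_right))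
    refine ⟨F2, fun a ha ha' => ?_, ?_⟩
    · rw [b1 a (hAH ha), a1 a ha]
    · have hle : C ⊔ D ≤ L := sup_le (hC.trans hHL) hD
      have key : C ⊔ D ≤ ((F2.comp (Subgroup.inclusion hle)).eqLocus g).map (C ⊔ D).subtype := by
        apply sup_le
        · intro x hx
          refine ⟨⟨x, (le_sup_left : C ≤ C ⊔ D) hx⟩, ?_, rfl⟩
          show F2 ⟨x, _⟩ = g ⟨x, _⟩
          rw [b1 x (hC hx), a2 x hx]; rfl
        · intro x hx
          refine ⟨⟨x, (le_sup_right : D ≤ C ⊔ D) hx⟩, ?_, rfl⟩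
          show F2 ⟨x, _⟩ = g ⟨x, _⟩
          rw [b2 x hx]; rfl
      intro a ha ha'
      obtain ⟨y, hy, hy'⟩ := key ha
      obtain ⟨y, hy2⟩ := y
      simp only [Subgroup.subtype_apply] at hy'
      subst hy'
      exact hy

theorem RFF.toFF {A : Subgroup K} (h : RFF A ⊤) : IsFreeFactor A := by
  obtain ⟨hAH, C, hC, hgen, hex⟩ := h
  refine ⟨C, ?_, ?_⟩
  · obtain ⟨F, h1, h2⟩ := hex (Monoid.Coprod A C) Monoid.Coprod.inl Monoid.Coprod.inr
    have : (F.comp (Subgroup.topEquiv.symm.toMonoidHom)).comp (Monoid.Coprod.lift A.subtype C.subtype) = MonoidHom.id _ := by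
      apply Monoid.Coprod.hom_ext
      · ext x
        simp only [MonoidHom.comp_apply, Monoid.Coprod.lift_apply_inl]
        exact h1 x.1 x.2 trivial
      · ext x
        simp only [MonoidHom.comp_apply, Monoid.Coprod.lift_apply_inr]
        exact h2 x.1 x.2 trivial
    intro x y hxy
    have e1 := DFunLike.congr_fun this x
    have e2 := DFunLike.congr_fun this y
    simp only [MonoidHom.comp_apply, MonoidHom.id_apply] at e1 e2
    rw [← e1, ← e2, hxy]
  · rw [← MonoidHom.range_eq_top, eq_top_iff, ← hgen]
    apply sup_le
    · intro x hx
      exact ⟨Monoid.Coprod.inl ⟨x, hx⟩, by simp⟩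
    · intro x hx
      exact ⟨Monoid.Coprod.inr ⟨x, hx⟩, by simp⟩

theorem IsFreeFactor.toRFF {A : Subgroup K} (h : IsFreeFactor A) : RFF A ⊤ := by
  obtain ⟨C, hb⟩ := h
  refine ⟨le_top, C, le_top, ?_, ?_⟩
  · rw [eq_top_iff]
    intro x _
    obtain ⟨y, rfl⟩ := hb.2 x
    induction y using Monoid.Coprod.induction_on with
    | inl a => simpa using Subgroup.mem_sup_left a.2
    | inr a => simpa using Subgroup.mem_sup_right a.2
    | mul a b h1 h2 => rw [map_mul]; exact mul_mem (h1 trivial) (h2 trivial)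
  · intro P _ f g
    let e := MulEquiv.ofBijective _ hb
    refine ⟨((Monoid.Coprod.lift f g).comp e.symm.toMonoidHom).comp (Subgroup.subtype ⊤), ?_, ?_⟩
    · intro a ha ha'
      have : e.symm a = Monoid.Coprod.inl ⟨a, ha⟩ := by
        rw [MulEquiv.symm_apply_eq]; simp [e]
      simp [this]
    · intro a ha ha'
      have : e.symm a = Monoid.Coprod.inr ⟨a, ha⟩ := by
        rw [MulEquiv.symm_apply_eq]; simp [e]
      simp [this]

theorem RFF.map {A : Subgroup K} (h : RFF A ⊤) (e : MulAut K) : RFF (A.map e.toMonoidHom) ⊤ := by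
  obtain ⟨hAH, C, hC, hgen, hex⟩ := h
  refine ⟨le_top, C.map e.toMonoidHom, le_top, ?_, ?_⟩
  · rw [← Subgroup.map_sup, hgen, ← MonoidHom.range_eq_map, MonoidHom.range_eq_top]
    exact e.surjective
  · intro P _ f g
    obtain ⟨F, h1, h2⟩ := hex P (f.comp (e.toMonoidHom.subgroupMap A)) (g.comp (e.toMonoidHom.subgroupMap C))
    refine ⟨(F.comp (Subgroup.topEquiv.symm.toMonoidHom)).comp (e.symm.toMonoidHom.comp (Subgroup.subtype ⊤)), ?_, ?_⟩
    · rintro _ ⟨a, ha, rfl⟩ ha'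
      have := h1 a ha trivial
      simp only [MonoidHom.comp_apply] at this ⊢
      rw [show f ⟨e.toMonoidHom a, _⟩ = f ((e.toMonoidHom.subgroupMap A) ⟨a, ha⟩) from rfl, ← this]
      congr 1
      apply Subtype.ext
      show e.symm (e a) = a
      simp
    · rintro _ ⟨a, ha, rfl⟩ ha'
      have := h2 a ha trivial
      simp only [MonoidHom.comp_apply] at this ⊢
      rw [show g ⟨e.toMonoidHom a, _⟩ = g ((e.toMonoidHom.subgroupMap C) ⟨a, ha⟩) from rfl, ← this]
      congr 1
      apply Subtype.ext
      show e.symm (e a) = a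
      simp

end FF

section Kurosh
universe u
variable {K : Type u} [Group K]

theorem exists_transversal (A B H : Subgroup K) (hgen : A ⊔ B = ⊤) :
    ∃ (σ : K ⧸ H → K) (d : K ⧸ H → ℕ), (∀ ω, (σ ω : K ⧸ H) = ω) ∧ σ ((1 : K) : K ⧸ H) = 1 ∧
      (∀ a ∈ A, σ (a : K ⧸ H) ∈ A) ∧
      (∀ ω, (¬ ∃ a ∈ A, (a : K ⧸ H) = ω) → ∃ s ω', (s ∈ A ∨ s ∈ B) ∧ ω = s • ω' ∧ σ ω = s * σ ω' ∧ d ω' < d ω) := by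
  classical
  have hex : ∀ ω : K ⧸ H, ∃ n, ∃ L : List K, L.length = n ∧ (∀ s ∈ L, s ∈ A ∨ s ∈ B) ∧ (L.prod : K ⧸ H) = ω := by
    intro ω
    obtain ⟨g, rfl⟩ := QuotientGroup.mk_surjective ω
    have hg : g ∈ A ⊔ B := by rw [hgen]; trivial
    rw [Subgroup.sup_eq_closure] at hg
    rw [← Subgroup.mem_toSubmonoid, Subgroup.closure_toSubmonoid] at hg
    obtain ⟨L, h1, h2⟩ := Submonoid.exists_list_of_mem_closure hg
    refine ⟨L.length, L, rfl, fun s hs => ?_, by rw [h2]⟩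
    rcases h1 s hs with (h3 | h3) | (h3 | h3)
    · exact Or.inl h3
    · exact Or.inr h3
    · exact Or.inl (by simpa using h3)
    · exact Or.inr (by simpa using h3)
  let d : K ⧸ H → ℕ := fun ω => Nat.find (hex ω)
  have hnext : ∀ ω : K ⧸ H, ∃ q : K × (K ⧸ H), (¬ ∃ a ∈ A, (a : K ⧸ H) = ω) →
      (q.1 ∈ A ∨ q.1 ∈ B) ∧ ω = q.1 • q.2 ∧ d q.2 < d ω := by
    intro ω
    by_cases ho : ∃ a ∈ A, (a : K ⧸ H) = ω
    · exact ⟨(1, ω), fun h => absurd ho h⟩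
    obtain ⟨L, h1, h2, h3⟩ := Nat.find_spec (hex ω)
    cases L with
    | nil => exact absurd ⟨1, A.one_mem, by simpa using h3⟩ ho
    | cons s L =>
      refine ⟨(s, (L.prod : K ⧸ H)), fun _ => ⟨h2 s (by simp), ?_, ?_⟩⟩
      · rw [← h3, List.prod_cons]; rfl
      · have : d (L.prod : K ⧸ H) ≤ L.length :=
          Nat.find_min' (hex _) ⟨L, rfl, fun s hs => h2 s (by simp [hs]), rfl⟩
        simp only [List.length_cons] at h1
        show _ < Nat.find (hex ω)
        rw [← h1]
        simp only
        omega
  choose nx hnx using hnext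
  have horb : ∀ ω : K ⧸ H, ∃ a : K, (∃ a ∈ A, (a : K ⧸ H) = ω) → (a ∈ A ∧ (a : K ⧸ H) = ω ∧ (ω = ((1 : K) : K ⧸ H) → a = 1)) := by
    intro ω
    by_cases h1 : ω = ((1 : K) : K ⧸ H)
    · exact ⟨1, fun _ => ⟨A.one_mem, h1.symm, fun _ => rfl⟩⟩
    · by_cases ho : ∃ a ∈ A, (a : K ⧸ H) = ω
      · obtain ⟨a, ha, hh⟩ := ho
        exact ⟨a, fun _ => ⟨ha, hh, fun h => absurd h h1⟩⟩
      · exact ⟨1, fun h => absurd h ho⟩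
  choose ar har using horb
  let σ : K ⧸ H → K := (measure d).wf.fix (fun ω rec => if h : ∃ a ∈ A, (a : K ⧸ H) = ω then ar ω else
    (nx ω).1 * rec (nx ω).2 (hnx ω h).2.2)
  have hσ1 : ∀ ω, (∃ a ∈ A, (a : K ⧸ H) = ω) → σ ω = ar ω := by
    intro ω h
    simp only [σ]
    rw [WellFounded.fix_eq, dif_pos h]
  have hσ2 : ∀ ω, (¬ ∃ a ∈ A, (a : K ⧸ H) = ω) → σ ω = (nx ω).1 * σ (nx ω).2 := by
    intro ω h
    simp only [σ]
    rw [WellFounded.fix_eq, dif_neg h]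
  refine ⟨σ, d, ?_, ?_, ?_, ?_⟩
  · intro ω
    induction hn : d ω using Nat.strong_induction_on generalizing ω with
    | _ n ih =>
      by_cases h : ∃ a ∈ A, (a : K ⧸ H) = ω
      · rw [hσ1 ω h]; exact (har ω h).2.1
      · rw [hσ2 ω h]
        obtain ⟨h1, h2, h3⟩ := hnx ω h
        have := ih (d (nx ω).2) (by omega) (nx ω).2 rfl
        conv_rhs => rw [h2, ← this]
        rfl
  · have h : ∃ a ∈ A, (a : K ⧸ H) = ((1 : K) : K ⧸ H) := ⟨1, A.one_mem, rfl⟩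
    rw [hσ1 _ h]; exact (har _ h).2.2 rfl
  · intro a ha
    have h : ∃ b ∈ A, (b : K ⧸ H) = (a : K ⧸ H) := ⟨a, ha, rfl⟩
    rw [hσ1 _ h]; exact (har _ h).1
  · intro ω h
    obtain ⟨h1, h2, h3⟩ := hnx ω h
    exact ⟨_, _, h1, h2, hσ2 ω h, h3⟩

open Classical in
/-- extension by one -/
noncomputable def ext1 {P : Type*} [Group P] {S : Subgroup K} (f : S →* P) (x : K) : P :=
  if h : x ∈ S then f ⟨x, h⟩ else 1

theorem ext1_mem {P : Type*} [Group P] {S : Subgroup K} (f : S →* P) {x : K} (h : x ∈ S) : ext1 f x = f ⟨x, h⟩ := dif_pos h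

theorem ext1_mul {P : Type*} [Group P] {S : Subgroup K} (f : S →* P) {x y : K} (h : x ∈ S) (h' : y ∈ S) :
    ext1 f (x * y) = ext1 f x * ext1 f y := by
  rw [ext1_mem f h, ext1_mem f h', ext1_mem f (mul_mem h h'), ← map_mul]; rfl

theorem ext1_one {P : Type*} [Group P] {S : Subgroup K} (f : S →* P) : ext1 f 1 = 1 := by
  rw [ext1_mem f S.one_mem]; exact map_one f

/-- skew permutation representation -/
theorem skew_rep {Ω : Type u} {P : Type u} [Group P] [MulAction K Ω] (A : Subgroup K) (d : K → Ω → P)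
    (h1 : ∀ ω, d 1 ω = 1)
    (hd : ∀ a ∈ A, ∀ b ∈ A, ∀ ω, d (a * b) ω = d a (b • ω) * d b ω) :
    ∃ f : A →* Equiv.Perm (Ω × P), ∀ a ω p, f a (ω, p) = ((a : K) • ω, d a ω * p) := by
  let f0 : A →* Function.End (Ω × P) :=
    { toFun := fun a q => ((a : K) • q.1, d a q.1 * q.2)
      map_one' := by
        funext q
        simp [h1]
        rfl
      map_mul' := by
        intro a b
        funext q
        show _ = ((a : K) • (b : K) • q.1, d a ((b : K) • q.1) * (d b q.1 * q.2))
        simp [mul_smul, hd a a.2 b b.2, mul_assoc] }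
  exact ⟨f0.toHomPerm, fun a ω p => rfl⟩

theorem RFF.inter {A : Subgroup K} (h : RFF A ⊤) (H : Subgroup K) : RFF (A ⊓ H) H := by
  classical
  obtain ⟨-, B, -, hgen, hex⟩ := h
  obtain ⟨σ, dd, s1, s2, s3, s4⟩ := exists_transversal A B H hgen
  set ω0 : K ⧸ H := ((1 : K) : K ⧸ H) with hω0
  let c : K → K ⧸ H → K := fun g ω => (σ (g • ω))⁻¹ * g * σ ω
  let Orb : K ⧸ H → Prop := fun ω => ∃ a ∈ A, (a : K ⧸ H) = ω
  have hsm : ∀ g : K, (g : K ⧸ H) = g • ω0 := by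
    intro g; show _ = ((g * 1 : K) : K ⧸ H); simp
  have hcH : ∀ g ω, c g ω ∈ H := by
    intro g ω
    simp only [c]
    rw [mul_assoc, ← QuotientGroup.eq, s1]
    conv_lhs => rw [← s1 ω]
    rfl
  have hcm : ∀ g g' ω, c (g * g') ω = c g (g' • ω) * c g' ω := by
    intro g g' ω
    simp only [c, mul_smul]; group
  have hc1 : ∀ ω, c 1 ω = 1 := by intro ω; simp [c]
  have hci : ∀ g ω, c g⁻¹ ω = (c g (g⁻¹ • ω))⁻¹ := by
    intro g ω; simp [c, mul_assoc]
  have hOrbA : ∀ a ∈ A, ∀ ω, Orb (a • ω) ↔ Orb ω := by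
    intro a ha ω
    constructor
    · rintro ⟨b, hb, h⟩
      refine ⟨a⁻¹ * b, mul_mem (inv_mem ha) hb, ?_⟩
      rw [hsm, mul_smul, ← hsm, h, inv_smul_smul]
    · rintro ⟨b, hb, rfl⟩
      exact ⟨a * b, mul_mem ha hb, rfl⟩
  have hcA : ∀ a ∈ A, ∀ ω, Orb ω → c a ω ∈ A ⊓ H := by
    intro a ha ω hω
    refine ⟨?_, hcH a ω⟩
    obtain ⟨b, hb, rfl⟩ := hω
    show c a b ∈ A
    exact mul_mem (mul_mem (inv_mem (s3 (a * b) (mul_mem ha hb))) ha) (s3 b hb)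
  let C' : Subgroup K := Subgroup.closure ({x | ∃ a ∈ A, ∃ ω, ¬ Orb ω ∧ x = c a ω} ∪ {x | ∃ b ∈ B, ∃ ω, x = c b ω})
  have hC1 : ∀ a ∈ A, ∀ ω, ¬ Orb ω → c a ω ∈ C' := fun a ha ω hω => Subgroup.subset_closure (Or.inl ⟨a, ha, ω, hω, rfl⟩)
  have hC2 : ∀ b ∈ B, ∀ ω, c b ω ∈ C' := fun a ha ω => Subgroup.subset_closure (Or.inr ⟨a, ha, ω, rfl⟩)
  have hC'H : C' ≤ H := by
    rw [Subgroup.closure_le]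
    rintro x (⟨a, -, ω, -, rfl⟩ | ⟨b, -, ω, rfl⟩) <;> exact hcH _ _
  have hind : ∀ (p : K → Prop), (∀ a ∈ A, p a) → (∀ b ∈ B, p b) → (∀ x y, p x → p y → p (x * y)) → (∀ x, p x → p x⁻¹) → ∀ x, p x := by
    intro p p1 p2 p3 p4 x
    have hx : x ∈ A ⊔ B := by rw [hgen]; trivial
    rw [Subgroup.sup_eq_closure] at hx
    induction hx using Subgroup.closure_induction with
    | mem x hx => exact hx.elim (p1 x) (p2 x)
    | one => exact p1 1 A.one_mem
    | mul x y _ _ h1 h2 => exact p3 x y h1 h2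
    | inv x _ h1 => exact p4 x h1
  have hcω0 : ∀ h ∈ H, c h ω0 = h := by
    intro h hh
    have : h • ω0 = ω0 := by
      rw [← hsm, hω0]; rw [QuotientGroup.eq]; simpa using hh
    simp only [c, this, s2]; simp
  refine ⟨inf_le_right, C', hC'H, ?_, ?_⟩
  · apply le_antisymm (sup_le inf_le_right hC'H)
    have key : ∀ g, ∀ ω, c g ω ∈ (A ⊓ H) ⊔ C' := by
      apply hind
      · intro a ha ω
        by_cases hω : Orb ω
        · exact Subgroup.mem_sup_left (hcA a ha ω hω)
        · exact Subgroup.mem_sup_right (hC1 a ha ω hω)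
      · intro b hb ω; exact Subgroup.mem_sup_right (hC2 b hb ω)
      · intro x y hx hy ω; rw [hcm]; exact mul_mem (hx _) (hy _)
      · intro x hx ω; rw [hci]; exact inv_mem (hx _)
    intro h hh
    rw [← hcω0 h hh]; exact key _ _
  · intro P _ f g
    let dA : K → K ⧸ H → P := fun a ω => if Orb ω then ext1 f (c a ω) else ext1 g (c a ω)
    let dB : K → K ⧸ H → P := fun a ω => ext1 g (c a ω)
    obtain ⟨rA, hrA⟩ := skew_rep A dA (by intro ω; simp only [dA, hc1, ext1_one, ite_self]) (by
      intro a ha b hb ω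
      simp only [dA, hcm, hOrbA b hb]
      by_cases hω : Orb ω
      · simp only [if_pos hω]
        exact ext1_mul f (hcA a ha _ ((hOrbA b hb ω).2 hω)) (hcA b hb _ hω)
      · simp only [if_neg hω]
        exact ext1_mul g (hC1 a ha _ (fun hh => hω ((hOrbA b hb ω).1 hh))) (hC1 b hb _ hω))
    obtain ⟨rB, hrB⟩ := skew_rep B dB (by intro ω; simp only [dB, hc1, ext1_one]) (by
      intro a ha b hb ω
      simp only [dB, hcm]
      exact ext1_mul g (hC2 a ha _) (hC2 b hb _))
    obtain ⟨D0, hD1, hD2⟩ := hex _ rA rB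
    let D : K →* Equiv.Perm ((K ⧸ H) × P) := D0.comp Subgroup.topEquiv.symm.toMonoidHom
    have hDA : ∀ a ∈ A, ∀ ω p, D a (ω, p) = (a • ω, dA a ω * p) := by
      intro a ha ω p
      have : D a = rA ⟨a, ha⟩ := hD1 a ha trivial
      rw [this, hrA]
    have hDB : ∀ a ∈ B, ∀ ω p, D a (ω, p) = (a • ω, dB a ω * p) := by
      intro a ha ω p
      have : D a = rB ⟨a, ha⟩ := hD2 a ha trivial
      rw [this, hrB]
    have hDex : ∀ x : K, ∃ δ : K ⧸ H → P, ∀ ω p, D x (ω, p) = (x • ω, δ ω * p) := by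
      apply hind
      · intro a ha; exact ⟨dA a, hDA a ha⟩
      · intro a ha; exact ⟨dB a, hDB a ha⟩
      · rintro x y ⟨δ, hδ⟩ ⟨ε, hε⟩
        refine ⟨fun ω => δ (y • ω) * ε ω, fun ω p => ?_⟩
        rw [map_mul, Equiv.Perm.mul_apply, hε, hδ, mul_smul, mul_assoc]
      · rintro x ⟨δ, hδ⟩
        refine ⟨fun ω => (δ (x⁻¹ • ω))⁻¹, fun ω p => ?_⟩
        rw [map_inv, Equiv.Perm.inv_eq_iff_eq, hδ]
        simp
    choose Δ hΔ using hDex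
    have hΔA : ∀ a ∈ A, ∀ ω, Δ a ω = dA a ω := by
      intro a ha ω
      have := (hΔ a ω 1).symm.trans (hDA a ha ω 1)
      simpa using this
    have hΔB : ∀ a ∈ B, ∀ ω, Δ a ω = dB a ω := by
      intro a ha ω
      have := (hΔ a ω 1).symm.trans (hDB a ha ω 1)
      simpa using this
    have hΔm : ∀ x y ω, Δ (x * y) ω = Δ x (y • ω) * Δ y ω := by
      intro x y ω
      have e := hΔ (x * y) ω 1
      rw [map_mul, Equiv.Perm.mul_apply, hΔ, hΔ] at e
      simpa using (congrArg Prod.snd e).symm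
    have hΔ1 : ∀ ω, Δ 1 ω = 1 := by
      intro ω
      have := hΔm 1 1 ω
      simpa using this
    have hsω : ∀ ω, σ ω • ω0 = ω := by intro ω; rw [← hsm, s1]
    have hu : ∀ ω, Δ (σ ω) ω0 = 1 := by
      intro ω
      induction hn : dd ω using Nat.strong_induction_on generalizing ω with
      | _ n ih =>
        by_cases hω : Orb ω
        · obtain ⟨a, ha, rfl⟩ := hω
          have hm := s3 a ha
          rw [hΔA _ hm]
          have ho : Orb ω0 := ⟨1, A.one_mem, rfl⟩
          simp only [dA, if_pos ho, c, hsω, s2]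
          simp [ext1_one]
        · obtain ⟨s, ω', hs, e1, e2, hlt⟩ := s4 ω hω
          have hi := ih (dd ω') (by omega) ω' rfl
          rw [e2, hΔm, hi, hsω, mul_one]
          have hcs : c s ω' = 1 := by
            simp only [c]; rw [← e1, e2]; simp
          rcases hs with hs | hs
          · have : ¬ Orb ω' := fun hh => hω (by rw [e1]; exact (hOrbA s hs ω').2 hh)
            rw [hΔA s hs]; simp only [dA, if_neg this, hcs, ext1_one]
          · rw [hΔB s hs]; simp only [dB, hcs, ext1_one]
    have hu' : ∀ ω, Δ (σ ω)⁻¹ ω = 1 := by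
      intro ω
      have := hΔm (σ ω)⁻¹ (σ ω) ω0
      rw [hsω, hu, mul_one, inv_mul_cancel, hΔ1] at this
      exact this.symm
    have hH0 : ∀ h ∈ H, h • ω0 = ω0 := by
      intro h hh
      rw [← hsm, hω0]; rw [QuotientGroup.eq]; simpa using hh
    have hΔc : ∀ x ω, Δ (c x ω) ω0 = Δ x ω := by
      intro x ω
      simp only [c]
      rw [mul_assoc, hΔm, hΔm, hu, mul_smul, hsω, hu', mul_one, one_mul]
    let F : H →* P :=
      { toFun := fun h => Δ h ω0
        map_one' := hΔ1 ω0
        map_mul' := by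
          intro x y
          show Δ (x * y : K) ω0 = _
          rw [hΔm, hH0 y y.2] }
    refine ⟨F, ?_, ?_⟩
    · intro a ha ha'
      show Δ a ω0 = _
      have ho : Orb ω0 := ⟨1, A.one_mem, rfl⟩
      rw [hΔA a ha.1]; simp only [dA, if_pos ho]
      rw [hcω0 a ha', ext1_mem f ha]
    · have key : ∀ a (ha : a ∈ C'), Δ a ω0 = g ⟨a, ha⟩ := by
        intro a ha
        induction ha using Subgroup.closure_induction with
        | mem x hx =>
          rcases hx with ⟨a, ha, ω, hω, rfl⟩ | ⟨b, hb, ω, rfl⟩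
          · rw [hΔc, hΔA a ha]; simp only [dA, if_neg hω]; rw [ext1_mem]
          · rw [hΔc, hΔB b hb]; simp only [dB]; rw [ext1_mem]
        | one => rw [hΔ1]; exact (map_one g).symm
        | mul x y hx hy h1 h2 =>
          rw [hΔm, hH0 y (hC'H hy), h1, h2, ← map_mul]; rfl
        | inv x hx h1 =>
          have := hΔm x⁻¹ x ω0
          rw [inv_mul_cancel, hΔ1, hH0 x (hC'H hx), h1] at this
          rw [eq_inv_of_mul_eq_one_left this.symm, ← map_inv]; rfl
      intro a ha ha'
      exact key a ha

end Kurosh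

section Rank
universe u
variable {K : Type u} [Group K]

/-- the group with two elements -/
abbrev ZZ2 : Type u := ULift.{u} (Multiplicative (ZMod 2))

/-- a proxy for the rank -/
noncomputable def rk (A : Subgroup K) : ℕ := Nat.card (A →* ZZ2.{u})

theorem RFF.retract_fg {A H : Subgroup K} (h : RFF A H) (hH : H.FG) : A.FG := by
  obtain ⟨hAH, C, hC, hgen, hex⟩ := h
  obtain ⟨F, h1, h2⟩ := hex A (MonoidHom.id A) 1
  rw [← Group.fg_iff_subgroup_fg] at hH ⊢
  apply Group.fg_of_surjective (f := F)
  intro a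
  exact ⟨⟨a, hAH a.2⟩, by rw [h1 a a.2]; rfl⟩

theorem fg_hom_finite (G : Type u) [Group G] (hG : Group.FG G) : Finite (G →* ZZ2.{u}) := by
  obtain ⟨S, hS⟩ := hG.out
  apply Finite.of_injective (fun (f : G →* ZZ2.{u}) (s : S) => f s)
  intro f g hfg
  apply MonoidHom.eq_of_eqOn_dense hS
  intro s hs
  exact congrFun hfg ⟨s, hs⟩

theorem free_hom_nontriv [IsFreeGroup K] (C : Subgroup K) (hC : C ≠ ⊥) : ∃ f : C →* ZZ2.{u}, f ≠ 1 := by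
  haveI := subgroupIsFreeOfIsFree C
  have hne : Nonempty (IsFreeGroup.Generators C) := by
    by_contra hcon
    rw [not_nonempty_iff] at hcon
    apply hC
    rw [Subgroup.eq_bot_iff_forall]
    intro x hx
    have : (⟨x, hx⟩ : C) = 1 := by
      apply (IsFreeGroup.toFreeGroup C).injective
      exact Subsingleton.elim _ _
    simpa using congrArg Subtype.val this
  obtain ⟨x⟩ := hne
  refine ⟨IsFreeGroup.lift (fun _ => ⟨Multiplicative.ofAdd 1⟩), fun hh => ?_⟩
  have := DFunLike.congr_fun hh (IsFreeGroup.of x)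
  rw [IsFreeGroup.lift_of] at this
  have h2 := congrArg ULift.down this
  have h3 : (1 : ZMod 2) = 0 := h2
  exact absurd h3 (by decide)

theorem RFF.rk_lt [IsFreeGroup K] {A H : Subgroup K} (h : RFF A H) (hH : H.FG) (hne : A ≠ H) : rk A < rk H := by
  haveI := fg_hom_finite H ((Group.fg_iff_subgroup_fg H).2 hH)
  obtain ⟨hAH, C, hC, hgen, hex⟩ := h
  let res : (H →* ZZ2.{u}) → (A →* ZZ2.{u}) := fun f => f.comp (Subgroup.inclusion hAH)
  have hsurj : Function.Surjective res := by
    intro f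
    obtain ⟨F, h1, h2⟩ := hex _ f 1
    refine ⟨F, ?_⟩
    ext1 a
    exact h1 a a.2 _
  by_contra hle
  have hbij := hsurj.bijective_of_nat_card_le (not_lt.1 hle)
  have hCne : C ≠ ⊥ := by
    rintro rfl
    apply hne
    rw [← hgen]; simp
  obtain ⟨g, hg⟩ := free_hom_nontriv C hCne
  obtain ⟨F, h1, h2⟩ := hex _ 1 g
  have : F = 1 := by
    apply hbij.1
    ext1 a
    exact h1 a a.2 _
  apply hg
  ext1 c
  rw [← h2 c c.2 (hC c.2), this]; rfl

theorem rk_map (A : Subgroup K) (e : MulAut K) : rk (A.map e.toMonoidHom) = rk A := by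
  exact Nat.card_congr (MulEquiv.monoidHomCongrLeft (MulEquiv.subgroupMap e A)).symm.toEquiv

theorem fg_cut {l : K → ℕ} (h : TreeLen l) {A : Subgroup K} (hA : A.FG) : ∃ D, ∀ α β, α * β ∈ A →
    l (α * β) = l α + l β → ∃ x, l x ≤ D ∧ α * x ∈ A := by
  obtain ⟨S, hS⟩ := hA
  obtain ⟨D, hD⟩ := (S.finite_toSet.image l).bddAbove
  refine ⟨D, fun α β hm hl => ?_⟩
  have hm' := hm
  rw [← hS, ← Subgroup.mem_toSubmonoid, Subgroup.closure_toSubmonoid] at hm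
  obtain ⟨L, h1, h2⟩ := Submonoid.exists_list_of_mem_closure hm
  have hLA : ∀ x ∈ L, x ∈ A := by
    intro x hx
    rw [← hS]
    rcases h1 x hx with h3 | h3
    · exact Subgroup.subset_closure h3
    · rw [← inv_inv x]; exact inv_mem (Subgroup.subset_closure h3)
  have hLD : ∀ x ∈ L, l x ≤ D := by
    intro x hx
    rcases h1 x hx with h3 | h3
    · exact hD ⟨x, h3, rfl⟩
    · have := hD ⟨x⁻¹, h3, rfl⟩
      simpa [h.inv] using this
  obtain ⟨i, hi, hz⟩ := h.cut D (fun i => (L.take i).prod) L.length α (by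
    intro i hi
    show td l (L.take i).prod (L.take (i + 1)).prod ≤ D
    rw [List.prod_take_succ L i hi, TreeLen.d_mul]
    exact hLD _ (List.getElem_mem hi)) (by
    simp only [List.take_zero, List.prod_nil, List.take_length, h2, TreeLen.d_one]
    simp [td, hl])
  refine ⟨α⁻¹ * (L.take i).prod, ?_, ?_⟩
  · rw [h.d_comm] at hz; exact hz
  · rw [mul_inv_cancel_left]
    exact Subgroup.list_prod_mem _ fun x hx => hLA x (List.mem_of_mem_take hx)

end Rank

section Trim
universe u
variable {K : Type u} [Group K] {l : K → ℕ}

theorem TreeLen.tripod (h : TreeLen l) {p x y z : K} {B : ℕ} (h1 : td l p x + td l x y ≤ td l p y + B)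
    (h2 : td l x z + td l z y = td l x y) (h3 : B < 2 * td l x z) : td l p z + td l z y = td l p y := by
  have f1 := h.four p z y x
  have f2 := h.four p x y z
  have f3 := h.four p y z x
  have f4 := h.four p x z y
  have := h.d_comm z x
  have := h.d_comm y x
  have := h.d_comm z y
  have := h.d_tri p z y
  omega

theorem TreeLen.trim (h : TreeLen l) (e : MulAut K) : ∃ (b : ℕ) (T : K → K),
    (∀ u, ∃ α β, e u = α * T u * β ∧ l α ≤ 2 * b + 1 ∧ l β ≤ 2 * b + 1) ∧
    (∀ u, 2 * b + 1 ≤ l (e u) → l (e u) ≤ l (T u) + 2 * b ∧ ∀ a c, l (a * u * c) = l a + l u + l c →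
      ∃ a' c', e (a * u * c) = a' * T u * c' ∧ l (a' * T u * c') = l a' + l (T u) + l c') := by
  obtain ⟨B, hB⟩ := h.bcl h e
  have key : ∀ u, ∃ t, (∃ α β, e u = α * t * β ∧ l α ≤ 2 * (B + 1) + 1 ∧ l β ≤ 2 * (B + 1) + 1) ∧
    (2 * (B + 1) + 1 ≤ l (e u) → l (e u) ≤ l t + 2 * (B + 1) ∧ ∀ a c, l (a * u * c) = l a + l u + l c →
      ∃ a' c', e (a * u * c) = a' * t * c' ∧ l (a' * t * c') = l a' + l t + l c') := by
    intro u
    by_cases hu : 2 * (B + 1) + 1 ≤ l (e u)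
    · obtain ⟨α, t, β, h1, h2, h3, h4⟩ := h.split3 (e u) (B + 1) (l (e u) - 2 * (B + 1)) (by omega)
      refine ⟨t, ⟨α, β, h1, by omega, by omega⟩, fun _ => ⟨by omega, fun a c hac => ?_⟩⟩
      have m1 := h.mul_le (a * u) c
      have m2 := h.mul_le a u
      have m3 := h.mul_le a (u * c)
      have m4 := h.mul_le u c
      rw [← mul_assoc] at m3
      have b1 := hB 1 a (a * u) (by simp only [TreeLen.d_one, TreeLen.d_mul]; omega)
      have b2 := hB a (a * u) (a * u * c) (by
        simp only [TreeLen.d_mul]; rw [mul_assoc, TreeLen.d_mul]; omega)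
      set x := e a with hx
      set y := e (a * u) with hy
      set E := e (a * u * c) with hE
      rw [map_one] at b1
      have exy : y = x * α * t * β := by rw [hy, map_mul, h1]; simp only [mul_assoc, hx]
      have exE : E = y * e c := by rw [hE, map_mul]
      have d1 : td l x (x * α) = B + 1 := by rw [TreeLen.d_mul, h2]
      have d2 : td l (x * α) (x * α * t) = l t := TreeLen.d_mul _ _
      have d3 : td l (x * α * t) y = l β := by rw [exy]; exact TreeLen.d_mul _ _
      have d4 : td l x y = l (e u) := by
        rw [hy, map_mul]; exact TreeLen.d_mul _ _
      have t1 := h.d_tri x (x * α) (x * α * t)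
      have t2 := h.d_tri (x * α) (x * α * t) y
      have t3 := h.d_tri x (x * α) y
      have t4 := h.d_tri x (x * α * t) y
      have r1 := h.tripod (p := 1) (x := x) (y := y) (z := x * α) b1 (by omega) (by omega)
      have r2 := h.tripod (p := E) (x := y) (y := x) (z := x * α * t) (B := B)
        (by rw [h.d_comm E y, h.d_comm y x, h.d_comm E x]; omega)
        (by rw [h.d_comm y _, h.d_comm _ x, h.d_comm y x]; omega) (by rw [h.d_comm]; omega)
      rw [h.d_comm E _, h.d_comm _ x, h.d_comm E x] at r2
      have q1 := h.d_tri 1 (x * α) (x * α * t)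
      have q2 := h.d_tri 1 (x * α * t) y
      have q3 := h.d_tri (x * α) (x * α * t) E
      have q4 := h.d_tri x (x * α) E
      refine ⟨x * α, (x * α * t)⁻¹ * E, by group, ?_⟩
      apply h.add_red
      · have : l (x * α * t) = td l 1 (x * α * t) := (TreeLen.d_one _).symm
        rw [this, ← d2, ← TreeLen.d_one (l := l) (x * α)]; omega
      · have e1 : t * ((x * α * t)⁻¹ * E) = (x * α)⁻¹ * E := by group
        rw [e1]
        show td l (x * α) E = l t + td l (x * α * t) E
        omega
      · rintro rfl
        rw [h.one] at h3; omega
    · exact ⟨1, ⟨e u, 1, by simp, by omega, by simp [h.one]⟩, fun hh => absurd hh hu⟩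
  choose T hT using key
  exact ⟨B + 1, T, fun u => (hT u).1, fun u => (hT u).2⟩

/-- subdivision -/
theorem TreeLen.subdiv (h : TreeLen l) (Φ : MulAut K) {B L0 : ℕ}
    (hB : ∀ x y, l (x * y) = l x + l y → l (Φ x) + l (Φ y) ≤ l (Φ (x * y)) + B) :
    ∀ w, L0 ≤ l w → l (Φ w) ≤ l w + B → ∃ a u c, w = a * u * c ∧ l (a * u * c) = l a + l u + l c ∧
      L0 ≤ l u ∧ l u ≤ 2 * L0 + 1 ∧ l (Φ u) ≤ l u + B := by
  intro w
  induction hn : l w using Nat.strong_induction_on generalizing w with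
  | _ n ih =>
    intro h1 h2
    by_cases hs : l w ≤ 2 * L0 + 1
    · exact ⟨1, w, 1, by simp, by simp [h.one], by omega, by omega, by omega⟩
    · obtain ⟨w1, w2, e1, e2, e3⟩ := h.split w (L0 + 1) (by omega)
      have hb := hB w1 w2 (by rw [← e1]; omega)
      rw [← e1] at hb
      by_cases hc : l (Φ w1) ≤ l w1 + B
      · exact ⟨1, w1, w2, by simp [e1], by simp [h.one, ← e1]; omega, by omega, by omega, hc⟩
      · obtain ⟨a, u, c, f1, f2, f3, f4, f5⟩ := ih (l w2) (by omega) w2 rfl (by omega) (by omega)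
        refine ⟨w1 * a, u, c, by rw [e1, f1]; group, ?_, f3, f4, f5⟩
        have g1 : w1 * a * u * c = w := by rw [e1, f1]; group
        rw [g1]
        have g2 := h.mul_le w1 a
        have g3 := h.mul_le (w1 * a * u) c
        have g4 := h.mul_le (w1 * a) u
        rw [g1] at g3
        rw [← f1] at f2
        omega

theorem fg_cut2 {l : K → ℕ} (h : TreeLen l) {A : Subgroup K} (hA : A.FG) (D : ℕ) : ∃ D', ∀ x y α β, l x ≤ D → l y ≤ D →
    x * (α * β) * y ∈ A → l (α * β) = l α + l β → ∃ ξ, l ξ ≤ D' ∧ x * α * ξ ∈ A := by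
  obtain ⟨S, hS⟩ := hA
  obtain ⟨D1, hD1⟩ := (S.finite_toSet.image l).bddAbove
  refine ⟨2 * (D + D1), fun x y α β hx hy hm hl => ?_⟩
  have hm' := hm
  rw [← hS, ← Subgroup.mem_toSubmonoid, Subgroup.closure_toSubmonoid] at hm
  obtain ⟨L, h1, h2⟩ := Submonoid.exists_list_of_mem_closure hm
  have hLA : ∀ x ∈ L, x ∈ A := by
    intro x hx
    rw [← hS]
    rcases h1 x hx with h3 | h3
    · exact Subgroup.subset_closure h3
    · rw [← inv_inv x]; exact inv_mem (Subgroup.subset_closure h3)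
  have hLD : ∀ x ∈ L, l x ≤ D1 := by
    intro x hx
    rcases h1 x hx with h3 | h3
    · exact hD1 ⟨x, h3, rfl⟩
    · have := hD1 ⟨x⁻¹, h3, rfl⟩
      simpa [h.inv] using this
  set z : ℕ → K := fun i => if i = 0 then 1 else if i ≤ L.length + 1 then x⁻¹ * (L.take (i - 1)).prod else α * β with hz
  have hz0 : z 0 = 1 := by simp [hz]
  have hz1 : ∀ j, j ≤ L.length → z (j + 1) = x⁻¹ * (L.take j).prod := by
    intro j hj
    simp [hz, hj]
  have hz2 : z (L.length + 2) = α * β := by simp [hz]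
  obtain ⟨i, hi, hzi⟩ := h.cut (D + D1) z (L.length + 2) α (by
    intro i hi
    rcases i with _ | i
    · rw [hz0, hz1 0 (by omega)]
      simp [TreeLen.d_one, h.inv]; omega
    · by_cases hi2 : i + 1 ≤ L.length
      · rw [hz1 i (by omega), hz1 (i+1) hi2, TreeLen.d_left]
        rw [List.prod_take_succ L i (by omega), TreeLen.d_mul]
        have := hLD _ (List.getElem_mem (l := L) (n := i) (by omega))
        omega
      · have : i = L.length := by omega
        subst this
        rw [hz2, hz1 _ le_rfl]
        simp only [List.take_length, h2]
        have e : (x⁻¹ * (x * (α * β) * y))⁻¹ * (α * β) = y⁻¹ := by group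
        rw [td, e, h.inv]; omega) (by
    rw [hz0, hz2, TreeLen.d_one, TreeLen.d_one, TreeLen.d_mul, hl])
  have hin : ∃ g, x * g ∈ A ∧ td l (z i) g ≤ D := by
    simp only [hz]
    split_ifs with c1 c2
    · exact ⟨x⁻¹, by simp, by rw [TreeLen.d_one, h.inv]; exact hx⟩
    · refine ⟨x⁻¹ * (L.take (i - 1)).prod, ?_, by rw [h.d_self]; omega⟩
      rw [mul_inv_cancel_left]
      exact Subgroup.list_prod_mem _ fun x hx => hLA x (List.mem_of_mem_take hx)
    · exact ⟨α * β * y, by simpa [mul_assoc] using hm', by rw [TreeLen.d_mul]; exact hy⟩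
  obtain ⟨g, hg, hg2⟩ := hin
  refine ⟨α⁻¹ * g, ?_, by simpa [mul_assoc] using hg⟩
  have t := h.d_tri α (z i) g
  have t2 := h.d_comm α (z i)
  show td l α g ≤ _
  omega

end Trim

section Irr
universe u
variable {K : Type u} [Group K] {l : K → ℕ}

theorem TreeLen.mul3_le (h : TreeLen l) (x y z : K) : l (x * y * z) ≤ l x + l y + l z := by
  have := h.mul_le (x * y) z
  have := h.mul_le x y
  omega

theorem TreeLen.bcl' (h : TreeLen l) (Φ : MulAut K) : ∃ B, ∀ x y, l (x * y) = l x + l y →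
    l (Φ x) + l (Φ y) ≤ l (Φ (x * y)) + B := by
  obtain ⟨B, hB⟩ := h.bcl h Φ
  refine ⟨B, fun x y hxy => ?_⟩
  have := hB 1 x (x * y) (by rw [TreeLen.d_one, TreeLen.d_one, TreeLen.d_mul, hxy])
  simpa only [map_one, map_mul, TreeLen.d_one, TreeLen.d_mul] using this

theorem exists_trim (h : TreeLen l) {Φ : MulAut K} {C0 : ℕ} (hF : Fl l Φ C0) :
    ∃ (T : K → K) (R E1 L0 : ℕ) (P : K → Prop),
      (∀ v, ∃ α β, Φ (T v) = α * v * β ∧ l α ≤ E1 ∧ l β ≤ E1) ∧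
      (∀ u, P u → P (T u) ∧ 1 ≤ l u ∧ 2 * l u ≤ l (T u) ∧ ∀ a c, l (a * u * c) = l a + l u + l c →
        ∃ a' c', Φ⁻¹ (a * u * c) = a' * T u * c' ∧ l (a' * T u * c') = l a' + l (T u) + l c') ∧
      (∀ w, L0 ≤ l w → l (Φ w) < l w → ∃ a u c, w = a * u * c ∧ l (a * u * c) = l a + l u + l c ∧ P u ∧ l u ≤ R) := by
  obtain ⟨b, T, hT1, hT2⟩ := h.trim Φ⁻¹
  obtain ⟨L1, hL1, hL⟩ := h.lip h (Φ : MulAut K).toMonoidHom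
  have hL : ∀ x, l (Φ x) ≤ L1 * l x := hL
  obtain ⟨B, hB⟩ := h.bcl' Φ
  set b' := 2 * b + 1 with hb'
  set B2 := B + 2 * (L1 * b') with hB2
  set L0 := B2 + C0 + 2 * b' + 1 with hL0
  have hT3 : ∀ v, ∃ α β, Φ (T v) = α * v * β ∧ l α ≤ L1 * b' ∧ l β ≤ L1 * b' := by
    intro v
    obtain ⟨α, β, h1, h2, h3⟩ := hT1 v
    refine ⟨Φ α⁻¹, Φ β⁻¹, ?_, ?_, ?_⟩
    · have : v = Φ α * Φ (T v) * Φ β := by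
        rw [← map_mul, ← map_mul, ← h1]; simp
      rw [map_inv, map_inv]
      nth_rewrite 2 [this]
      group
    · exact (hL _).trans (by rw [h.inv]; exact Nat.mul_le_mul_left _ h2)
    · exact (hL _).trans (by rw [h.inv]; exact Nat.mul_le_mul_left _ h3)
  refine ⟨T, 2 * L0 + 1, L1 * b', L0, fun u => L0 ≤ l u ∧ l (Φ u) ≤ l u + B2, hT3, ?_, ?_⟩
  · rintro u ⟨hu1, hu2⟩
    have f := hF u
    obtain ⟨h1, h2⟩ := hT2 u (by omega)
    obtain ⟨α, β, h3, h4, h5⟩ := hT3 u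
    have := h.mul3_le α u β
    rw [← h3] at this
    exact ⟨⟨by omega, by omega⟩, by omega, by omega, h2⟩
  · intro w hw hw2
    obtain ⟨a, u, c, h1, h2, h3, h4, h5⟩ := h.subdiv Φ (B := B2) (L0 := L0) (fun x y hxy => (hB x y hxy).trans (by omega)) w hw (by omega)
    exact ⟨a, u, c, h1, h2, ⟨h3, h5⟩, h4⟩

def Contr (l : K → ℕ) (Φ : MulAut K) (A : Subgroup K) : Prop :=
  ∃ D, ∀ n L : ℕ, ∃ v, (∃ x y, l x ≤ D ∧ l y ≤ D ∧ x * v * y ∈ A) ∧ L ≤ l v ∧ l ((Φ ^ (n + 1)) v) < l ((Φ ^ n) v)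

def Ct (l : K → ℕ) (T : K → K) (R : ℕ) (A : Subgroup K) : Prop :=
  ∃ D, ∀ n : ℕ, ∃ u, l u ≤ R ∧ 1 ≤ l u ∧ (∀ j < n, 2 * l (T^[j] u) ≤ l (T^[j + 1] u)) ∧
    ∃ x y, l x ≤ D ∧ l y ≤ D ∧ x * T^[n] u * y ∈ A

theorem Contr.ct (h : TreeLen l) {Φ : MulAut K} {T : K → K} {R L0 : ℕ} {P : K → Prop}
    (hP : ∀ u, P u → P (T u) ∧ 1 ≤ l u ∧ 2 * l u ≤ l (T u) ∧ ∀ a c, l (a * u * c) = l a + l u + l c →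
        ∃ a' c', Φ⁻¹ (a * u * c) = a' * T u * c' ∧ l (a' * T u * c') = l a' + l (T u) + l c')
    (hS : ∀ w, L0 ≤ l w → l (Φ w) < l w → ∃ a u c, w = a * u * c ∧ l (a * u * c) = l a + l u + l c ∧ P u ∧ l u ≤ R)
    {A : Subgroup K} (hA : A.FG) (hc : Contr l Φ A) : Ct l T R A := by
  obtain ⟨D, hD⟩ := hc
  obtain ⟨D', hD'⟩ := fg_cut2 h hA D
  refine ⟨D', fun n => ?_⟩
  obtain ⟨L, hL1, hL⟩ := lip_pow h Φ n
  obtain ⟨v, ⟨x, y, hx, hy, hxy⟩, hv, hlt⟩ := hD n (L * L0)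
  have h1 : L0 ≤ l ((Φ ^ n) v) := by
    have := hL n le_rfl v
    exact Nat.le_of_mul_le_mul_left (hv.trans this) hL1
  obtain ⟨a, u, c, e1, e2, e3, e4⟩ := hS ((Φ ^ n) v) h1 (by
    rw [pow_succ'] at hlt; exact hlt)
  have key : ∀ j, P (T^[j] u) ∧ ∃ a c, ((Φ⁻¹) ^ j) ((Φ ^ n) v) = a * T^[j] u * c ∧
      l (a * T^[j] u * c) = l a + l (T^[j] u) + l c := by
    intro j
    induction j with
    | zero => exact ⟨e3, a, c, by simpa using e1, by simpa using e2⟩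
    | succ j ih =>
      obtain ⟨p1, a, c, p2, p3⟩ := ih
      obtain ⟨q1, q2, q3, q4⟩ := hP _ p1
      obtain ⟨a', c', q5, q6⟩ := q4 a c p3
      rw [Function.iterate_succ_apply']
      refine ⟨q1, a', c', ?_, q6⟩
      rw [pow_succ', MulAut.mul_apply, p2, q5]
  refine ⟨u, e4, (hP u e3).2.1, fun j _ => ?_, ?_⟩
  · rw [Function.iterate_succ_apply']
    exact (hP _ (key j).1).2.2.1
  · obtain ⟨_, a, c, p2, p3⟩ := key n
    have p4 : v = a * T^[n] u * c := by
      rw [← p2, inv_pow]; simp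
    subst p4
    set t := T^[n] u with ht
    have m1 := h.mul_le a t
    have m2 := h.mul_le t c
    have m3 := h.mul_le (a * t) c
    have m4 := h.mul_le a (t * c)
    obtain ⟨ξ, g1, g2⟩ := hD' x y a (t * c) hx hy (by simpa only [mul_assoc] using hxy) (by
      rw [← mul_assoc] at m4 ⊢; omega)
    obtain ⟨ξ', g3, g4⟩ := hD' x y (a * t) c hx hy hxy (by omega)
    refine ⟨ξ⁻¹, ξ', by rwa [h.inv], g3, ?_⟩
    have := mul_mem (inv_mem g2) g4
    have e : (x * a * ξ)⁻¹ * (x * (a * t) * ξ') = ξ⁻¹ * t * ξ' := by group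
    rwa [e] at this

theorem Ct.map (h : TreeLen l) {Φ : MulAut K} {T : K → K} {R E1 : ℕ}
    (hT : ∀ v, ∃ α β, Φ (T v) = α * v * β ∧ l α ≤ E1 ∧ l β ≤ E1)
    {A : Subgroup K} (hc : Ct l T R A) : Ct l T R (A.map Φ.toMonoidHom) := by
  obtain ⟨D, hD⟩ := hc
  obtain ⟨L1, hL1, hL⟩ := h.lip h (Φ : MulAut K).toMonoidHom
  have hL : ∀ x, l (Φ x) ≤ L1 * l x := hL
  refine ⟨L1 * D + E1, fun n => ?_⟩
  obtain ⟨u, h1, h2, h3, x, y, hx, hy, hxy⟩ := hD (n + 1)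
  refine ⟨u, h1, h2, fun j hj => h3 j (by omega), ?_⟩
  obtain ⟨α, β, h4, h5, h6⟩ := hT (T^[n] u)
  refine ⟨Φ x * α, β * Φ y, ?_, ?_, ?_⟩
  · have := h.mul_le (Φ x) α
    have := hL x
    have := Nat.mul_le_mul_left L1 hx
    omega
  · have := h.mul_le β (Φ y)
    have := hL y
    have := Nat.mul_le_mul_left L1 hy
    omega
  · refine ⟨_, hxy, ?_⟩
    show Φ _ = _
    rw [Function.iterate_succ_apply', map_mul, map_mul, h4]
    group

theorem Ct.map_pow (h : TreeLen l) {Φ : MulAut K} {T : K → K} {R E1 : ℕ}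
    (hT : ∀ v, ∃ α β, Φ (T v) = α * v * β ∧ l α ≤ E1 ∧ l β ≤ E1)
    {A : Subgroup K} (hc : Ct l T R A) (i : ℕ) : Ct l T R (A.map (Φ ^ i : MulAut K).toMonoidHom) := by
  induction i with
  | zero =>
    have : A.map ((Φ ^ 0 : MulAut K)).toMonoidHom = A := by
      rw [pow_zero]; exact Subgroup.map_id A
    rwa [this]
  | succ i ih =>
    have := ih.map h hT
    rw [Subgroup.map_map] at this
    rw [pow_succ']
    exact this

theorem trim_pow (h : TreeLen l) {Φ : MulAut K} {T : K → K} {E1 : ℕ}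
    (hT : ∀ v, ∃ α β, Φ (T v) = α * v * β ∧ l α ≤ E1 ∧ l β ≤ E1) (m : ℕ) :
    ∃ E, ∀ x, ∃ α β, (Φ ^ m) (T^[m] x) = α * x * β ∧ l α ≤ E ∧ l β ≤ E := by
  induction m with
  | zero => exact ⟨0, fun x => ⟨1, 1, by simp, by simp [h.one], by simp [h.one]⟩⟩
  | succ m ih =>
    obtain ⟨E, hE⟩ := ih
    obtain ⟨L1, hL1, hL⟩ := h.lip h (Φ ^ m : MulAut K).toMonoidHom
    have hL : ∀ x, l ((Φ ^ m) x) ≤ L1 * l x := hL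
    refine ⟨L1 * E1 + E, fun x => ?_⟩
    obtain ⟨α, β, h1, h2, h3⟩ := hE x
    obtain ⟨γ, δ, h4, h5, h6⟩ := hT (T^[m] x)
    refine ⟨(Φ ^ m) γ * α, β * (Φ ^ m) δ, ?_, ?_, ?_⟩
    · rw [Function.iterate_succ_apply', pow_succ, MulAut.mul_apply, h4, map_mul, map_mul, h1]
      group
    · have := h.mul_le ((Φ ^ m) γ) α
      have := hL γ
      have := Nat.mul_le_mul_left L1 h5
      omega
    · have := h.mul_le β ((Φ ^ m) δ)
      have := hL δ
      have := Nat.mul_le_mul_left L1 h6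
      omega

end Irr

section Irr2
universe u
variable {K : Type u} [Group K] {l : K → ℕ}

theorem Ct.coincide (h : TreeLen l) {Φ : MulAut K} {T : K → K} {R E1 : ℕ}
    (hT : ∀ v, ∃ α β, Φ (T v) = α * v * β ∧ l α ≤ E1 ∧ l β ≤ E1)
    {A : Subgroup K} (hc : Ct l T R A) : ∃ (i i' : ℕ) (x x' : K), i < i' ∧
      Contr l Φ (A.map (MulAut.conj x⁻¹ * Φ ^ i : MulAut K).toMonoidHom ⊓
        A.map (MulAut.conj x'⁻¹ * Φ ^ i' : MulAut K).toMonoidHom) := by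
  choose D0 hD0 using fun i => hc.map_pow h hT i
  haveI : Finite {x : K // l x ≤ R} := h.fin R
  set J := Nat.card {x : K // l x ≤ R} with hJ
  obtain ⟨D, hD⟩ : ∃ D, ∀ i : Fin (J + 1), D0 i ≤ D := by
    obtain ⟨D, hD⟩ := (Set.finite_range (fun i : Fin (J + 1) => D0 i)).bddAbove
    exact ⟨D, fun i => hD ⟨i, rfl⟩⟩
  haveI : Finite {x : K // l x ≤ D} := h.fin D
  have hdat : ∀ n, ∃ f : Fin (J + 1) → {x : K // l x ≤ R} × {x : K // l x ≤ D} × {x : K // l x ≤ D},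
      ∀ i, 1 ≤ l (f i).1.1 ∧ (∀ j < n, 2 * l (T^[j] (f i).1.1) ≤ l (T^[j + 1] (f i).1.1)) ∧
        (f i).2.1.1 * T^[n] (f i).1.1 * (f i).2.2.1 ∈ A.map (Φ ^ (i : ℕ) : MulAut K).toMonoidHom := by
    intro n
    choose u h1 h2 h3 x y hx hy hxy using fun i : Fin (J + 1) => hD0 i n
    exact ⟨fun i => ⟨⟨u i, h1 i⟩, ⟨x i, (hx i).trans (hD i)⟩, ⟨y i, (hy i).trans (hD i)⟩⟩,
      fun i => ⟨h2 i, h3 i, hxy i⟩⟩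
  choose F hF using hdat
  obtain ⟨f, hf⟩ := Finite.exists_infinite_fiber F
  have hinf : (F ⁻¹' {f}).Infinite := Set.infinite_coe_iff.mp hf
  obtain ⟨i, i', hne, heq⟩ : ∃ i i' : Fin (J + 1), i ≠ i' ∧ (f i).1 = (f i').1 := by
    by_contra! hcon
    have : Function.Injective (fun i => (f i).1) := fun i i' h => by
      by_contra hh; exact hcon i i' hh h
    have := Nat.card_le_card_of_injective _ this
    simp at this
    omega
  wlog hlt : i < i' generalizing i i' with hw
  · exact hw i' i hne.symm heq.symm (lt_of_le_of_ne (not_lt.mp hlt) hne.symm)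
  set u := (f i).1.1 with hu
  have hu' : (f i').1.1 = u := by rw [hu, heq]
  set x := (f i).2.1.1 with hx
  set x' := (f i').2.1.1 with hx'
  refine ⟨i, i', x, x', hlt, ?_⟩
  obtain ⟨N1, hN1⟩ := hinf.nonempty
  have hN1 : F N1 = f := hN1
  have hfib : ∀ n, F n = f → 1 ≤ l u ∧ (∀ j < n, 2 * l (T^[j] u) ≤ l (T^[j + 1] u)) ∧
      x * T^[n] u * (f i).2.2.1 ∈ A.map (Φ ^ (i : ℕ) : MulAut K).toMonoidHom ∧
      x' * T^[n] u * (f i').2.2.1 ∈ A.map (Φ ^ (i' : ℕ) : MulAut K).toMonoidHom := by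
    intro n hn
    have a1 := hF n i
    have a2 := hF n i'
    rw [hn] at a1 a2
    rw [hu'] at a2
    exact ⟨a1.1, a1.2.1, a1.2.2, a2.2.2⟩
  have hdbl : ∀ j, 2 * l (T^[j] u) ≤ l (T^[j + 1] u) := by
    intro j
    obtain ⟨n, hn, hj⟩ := hinf.exists_gt j
    exact (hfib n hn).2.1 j hj
  have hgrow : ∀ j, j < l (T^[j] u) := by
    intro j
    induction j with
    | zero => exact (hfib N1 hN1).1
    | succ j ih => have := hdbl j; omega
  have hmem : ∀ (x y : K) (i : ℕ) (v v1 : K), x * v * y ∈ A.map (Φ ^ i : MulAut K).toMonoidHom →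
      x * v1 * y ∈ A.map (Φ ^ i : MulAut K).toMonoidHom →
      1 * v * v1⁻¹ ∈ A.map (MulAut.conj x⁻¹ * Φ ^ i : MulAut K).toMonoidHom := by
    intro x y i v v1 hv hv1
    obtain ⟨a, ha, hae⟩ := mul_mem hv (inv_mem hv1)
    refine ⟨a, ha, ?_⟩
    have hae : (Φ ^ i) a = x * v * y * (x * v1 * y)⁻¹ := hae
    show MulAut.conj x⁻¹ ((Φ ^ i) a) = _
    rw [hae, MulAut.conj_apply]
    group
  refine ⟨l (T^[N1] u), fun n L => ?_⟩
  obtain ⟨E, hE⟩ := trim_pow h hT n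
  obtain ⟨E', hE'⟩ := trim_pow h hT (n + 1)
  obtain ⟨N, hN, hNL⟩ := hinf.exists_gt (L + n + 1 + 2 * E + 2 * E')
  refine ⟨T^[N] u, ⟨1, (T^[N1] u)⁻¹, by simp [h.one], by rw [h.inv], ?_⟩, ?_, ?_⟩
  · obtain ⟨-, -, b1, b2⟩ := hfib N hN
    obtain ⟨-, -, c1, c2⟩ := hfib N1 hN1
    exact ⟨hmem _ _ _ _ _ b1 c1, hmem _ _ _ _ _ b2 c2⟩
  · have := hgrow N; omega
  · obtain ⟨k, rfl⟩ : ∃ k, N = n + 1 + k := ⟨N - (n + 1), by omega⟩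
    obtain ⟨α', β', a1, a2, a3⟩ := hE' (T^[k] u)
    obtain ⟨α, β, b1, b2, b3⟩ := hE (T^[k + 1] u)
    rw [← Function.iterate_add_apply] at a1 b1
    rw [show n + (k + 1) = n + 1 + k by omega] at b1
    have c1 := h.mul3_le α' (T^[k] u) β'
    have c2 := h.mul3_le α⁻¹ (α * T^[k+1] u * β) β⁻¹
    rw [show α⁻¹ * (α * T^[k+1] u * β) * β⁻¹ = T^[k+1] u by group, h.inv, h.inv] at c2
    rw [a1, b1]
    have := hdbl k
    have := hgrow k
    omega

theorem TreeLen.top_fg (h : TreeLen l) : (⊤ : Subgroup K).FG := by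
  have hfin : {x | l x ≤ 1}.Finite := h.fin 1
  refine ⟨hfin.toFinset, ?_⟩
  rw [eq_top_iff]
  intro k _
  obtain ⟨w, h1, h2, h3⟩ := h.letters _ k rfl
  rw [← h1]
  exact Subgroup.list_prod_mem _ fun x hx => Subgroup.subset_closure (by simpa using h3 x hx)

theorem no_contr (h : TreeLen l) [IsFreeGroup K] {φ : MulAut K} (hirr : FullyIrreducibleAut φ) {n0 C0 : ℕ}
    (hn : 1 ≤ n0) (hF : Fl l (φ ^ n0) C0) : ∀ (r : ℕ) (A : Subgroup K), rk A = r → RFF A ⊤ → A ≠ ⊤ →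
      ¬ Contr l (φ ^ n0) A := by
  intro r
  induction r using Nat.strong_induction_on with
  | _ r ih =>
  intro A hr hA hAt hc
  obtain ⟨T, R, E1, L0, P, hT, hP, hS⟩ := exists_trim h hF
  have hAfg := hA.retract_fg h.top_fg
  have hct := hc.ct h hP hS hAfg
  obtain ⟨i, i', x, x', hlt, hcc⟩ := hct.coincide h hT
  set f : MulAut K := MulAut.conj x⁻¹ * (φ ^ n0) ^ i with hf
  set f' : MulAut K := MulAut.conj x'⁻¹ * (φ ^ n0) ^ i' with hf'
  have hA1 := hA.map f
  have hA2 := hA.map f'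
  have htop : ∀ g : MulAut K, A.map g.toMonoidHom ≠ ⊤ := by
    intro g hg
    apply hAt
    rw [eq_top_iff]
    intro z _
    have : g z ∈ A.map g.toMonoidHom := by rw [hg]; trivial
    obtain ⟨a, ha, hae⟩ := this
    have : a = z := g.injective hae
    rwa [← this]
  have e1 : A.map f.toMonoidHom ⊓ A.map f'.toMonoidHom = A.map f'.toMonoidHom := by
    by_contra hne
    have h1 := hA1.inter (A.map f'.toMonoidHom)
    have h2 := h1.rk_lt (hA2.retract_fg h.top_fg) hne
    rw [rk_map, hr] at h2
    refine ih _ h2 _ rfl (h1.trans hA2) ?_ hcc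
    intro ht
    exact htop f' (eq_top_iff.mpr (by rw [← ht]; exact inf_le_right))
  have e2 : A.map f.toMonoidHom ⊓ A.map f'.toMonoidHom = A.map f.toMonoidHom := by
    by_contra hne
    have h1 := hA2.inter (A.map f.toMonoidHom)
    rw [inf_comm] at h1
    have h2 := h1.rk_lt (hA1.retract_fg h.top_fg) hne
    rw [rk_map, hr] at h2
    refine ih _ h2 _ rfl (h1.trans hA1) ?_ hcc
    intro ht
    exact htop f (eq_top_iff.mpr (by rw [← ht]; exact inf_le_left))
  have e3 : A.map f.toMonoidHom = A.map f'.toMonoidHom := e2.symm.trans e1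
  have hAb : A ≠ ⊥ := by
    rintro rfl
    obtain ⟨D, hD⟩ := hc
    obtain ⟨v, ⟨x, y, hx, hy, hxy⟩, hv, -⟩ := hD 0 (2 * D + 1)
    rw [Subgroup.mem_bot] at hxy
    have e : v = x⁻¹ * y⁻¹ := by
      have : v = x⁻¹ * (x * v * y) * y⁻¹ := by group
      rw [this, hxy]; group
    have := h.mul_le x⁻¹ y⁻¹
    rw [← e, h.inv, h.inv] at this
    omega
  refine hirr (n0 * (i' - i)) (by have : 0 < i' - i := by omega
                                  positivity) A hA.toFF hAb hAt (((φ ^ n0) ^ i)⁻¹ (x * x'⁻¹))⁻¹ ?_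
  have e4 : f⁻¹ * f' = MulAut.conj (((φ ^ n0) ^ i)⁻¹ (x * x'⁻¹)) * φ ^ (n0 * (i' - i)) := by
    have e5 : (φ ^ n0) ^ i' = (φ ^ n0) ^ i * φ ^ (n0 * (i' - i)) := by
      rw [← pow_mul, ← pow_mul, ← pow_add, ← mul_add]; congr; omega
    have e6 : MulAut.conj (((φ ^ n0) ^ i)⁻¹ (x * x'⁻¹)) = ((φ ^ n0) ^ i)⁻¹ * MulAut.conj (x * x'⁻¹) * (φ ^ n0) ^ i := by
      ext z
      simp [MulAut.mul_apply]
    rw [hf, hf', e5, e6, map_mul, map_inv]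
    simp only [map_inv]
    group
  set k := ((φ ^ n0) ^ i)⁻¹ (x * x'⁻¹) with hk
  have mm : ∀ (g g' : MulAut K), A.map (g * g').toMonoidHom = (A.map g'.toMonoidHom).map g.toMonoidHom := by
    intro g g'; rw [Subgroup.map_map]; rfl
  have e7 : φ ^ (n0 * (i' - i)) = MulAut.conj k⁻¹ * (f⁻¹ * f') := by
    rw [e4, map_inv]; group
  have e8 : A.map (f⁻¹ * f').toMonoidHom = A := by
    rw [mm, ← e3, ← mm, inv_mul_cancel]; exact Subgroup.map_id A
  have e9 : A.map (φ ^ (n0 * (i' - i)) : MulAut K).toMonoidHom = A.map (MulAut.conj k⁻¹).toMonoidHom := by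
    rw [e7, mm, e8]
  exact e9

theorem irr_grow (h : TreeLen l) [IsFreeGroup K] {φ : MulAut K} (hirr : FullyIrreducibleAut φ) {n0 C0 : ℕ}
    (hn : 1 ≤ n0) (hF : Fl l (φ ^ n0) C0) {A : Subgroup K} (hA : RFF A ⊤) (hAt : A ≠ ⊤) :
    ∃ k L, ∀ y ∈ A, L ≤ l y → l (((φ ^ n0) ^ k) y) ≤ l (((φ ^ n0) ^ (k + 1)) y) := by
  by_contra! hcon
  refine no_contr h hirr hn hF _ A rfl hA hAt ⟨0, fun n L => ?_⟩
  obtain ⟨y, h1, h2, h3⟩ := hcon n L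
  exact ⟨y, ⟨1, 1, by simp [h.one], by simp [h.one], by simpa⟩, h2, h3⟩

theorem FullyIrreducibleAut.inv {φ : MulAut K} (hirr : FullyIrreducibleAut φ) : FullyIrreducibleAut φ⁻¹ := by
  intro p hp A hA hb ht k hk
  refine hirr p hp A hA hb ht ((φ ^ p) k)⁻¹ ?_
  have mm : ∀ (g g' : MulAut K), A.map (g * g').toMonoidHom = (A.map g'.toMonoidHom).map g.toMonoidHom := by
    intro g g'; rw [Subgroup.map_map]; rfl
  have hk : A.map (φ⁻¹ ^ p : MulAut K).toMonoidHom = A.map (MulAut.conj k).toMonoidHom := hk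
  have e1 : A = A.map (φ ^ p * MulAut.conj k : MulAut K).toMonoidHom := by
    rw [mm, ← hk, ← mm, inv_pow, mul_inv_cancel]; exact (Subgroup.map_id A).symm
  have e2 : φ ^ p * MulAut.conj k = MulAut.conj ((φ ^ p) k) * φ ^ p := by
    ext z; simp [MulAut.mul_apply]
  rw [e2, mm] at e1
  show A.map (φ ^ p : MulAut K).toMonoidHom = A.map (MulAut.conj ((φ ^ p) k)⁻¹).toMonoidHom
  conv_rhs => rw [e1]
  rw [Subgroup.map_map]
  have : (MulAut.conj ((φ ^ p) k)⁻¹).toMonoidHom.comp (MulAut.conj ((φ ^ p) k)).toMonoidHom = MonoidHom.id K := by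
    ext z; simp [mul_assoc]
  rw [this, Subgroup.map_id]
end Irr2

section FP
universe u
variable {K : Type u} [Group K]

/-- value of a syllable -/
def sval {A B : Subgroup K} : A ⊕ B → K := Sum.elim (fun x => (x : K)) (fun x => (x : K))

/-- alternating lists of nontrivial syllables -/
def Alt {A B : Subgroup K} (L : List (A ⊕ B)) : Prop :=
  (∀ s ∈ L, sval s ≠ 1) ∧ L.IsChain (fun s t => s.isLeft ≠ t.isLeft)

theorem alt_mul {A B : Subgroup K} (s : A ⊕ B) (L : List (A ⊕ B)) (hL : Alt L) :
    ∃ L' : List (A ⊕ B), Alt L' ∧ (L'.map sval).prod = sval s * (L.map sval).prod := by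
  by_cases hs : sval s = 1
  · exact ⟨L, hL, by rw [hs, one_mul]⟩
  rcases L with _ | ⟨t, L⟩
  · exact ⟨[s], ⟨by simpa using hs, by simp⟩, by simp⟩
  · by_cases hst : s.isLeft = t.isLeft
    · obtain ⟨r, hr1, hr2⟩ : ∃ r : A ⊕ B, sval r = sval s * sval t ∧ r.isLeft = t.isLeft := by
        rcases s with s | s <;> rcases t with t | t
        · exact ⟨Sum.inl (s * t), by simp [sval], rfl⟩
        · simp at hst
        · simp at hst
        · exact ⟨Sum.inr (s * t), by simp [sval], rfl⟩
      have htail : Alt L := ⟨fun x hx => hL.1 x (by simp [hx]), hL.2.tail⟩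
      by_cases hr : sval r = 1
      · refine ⟨L, htail, ?_⟩
        rw [List.map_cons, List.prod_cons, ← mul_assoc, ← hr1, hr, one_mul]
      · refine ⟨r :: L, ⟨?_, ?_⟩, ?_⟩
        · intro x hx
          rcases List.mem_cons.mp hx with rfl | hx
          · exact hr
          · exact hL.1 x (by simp [hx])
        · have := hL.2
          rcases L with _ | ⟨z, L⟩
          · simp
          · rw [List.isChain_cons_cons] at this ⊢
            exact ⟨by rw [hr2]; exact this.1, this.2⟩
        · rw [List.map_cons, List.prod_cons, List.map_cons, List.prod_cons, hr1, mul_assoc]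
    · refine ⟨s :: t :: L, ⟨?_, ?_⟩, by simp⟩
      · intro x hx
        rcases List.mem_cons.mp hx with rfl | hx
        · exact hs
        · exact hL.1 x hx
      · rw [List.isChain_cons_cons]
        exact ⟨hst, hL.2⟩

theorem alt_exists {A B : Subgroup K} (hAB : Function.Surjective (Monoid.Coprod.lift A.subtype B.subtype)) (p : K) :
    ∃ L : List (A ⊕ B), Alt L ∧ (L.map sval).prod = p := by
  obtain ⟨q, rfl⟩ := hAB p
  induction q using Monoid.Coprod.induction_on' with
  | one => exact ⟨[], ⟨by simp, by simp⟩, by simp⟩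
  | inl_mul m x ih =>
    obtain ⟨L, h1, h2⟩ := ih
    obtain ⟨L', h3, h4⟩ := alt_mul (Sum.inl m) L h1
    exact ⟨L', h3, by rw [h4, h2, map_mul]; simp [sval]⟩
  | inr_mul m x ih =>
    obtain ⟨L, h1, h2⟩ := ih
    obtain ⟨L', h3, h4⟩ := alt_mul (Sum.inr m) L h1
    exact ⟨L', h3, by rw [h4, h2, map_mul]; simp [sval]⟩

/-- free products of free groups are free -/
noncomputable def fpEquiv (α β : Type) : Monoid.Coprod (FreeGroup α) (FreeGroup β) ≃* FreeGroup (α ⊕ β) :=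
  MonoidHom.toMulEquiv (Monoid.Coprod.lift (FreeGroup.map Sum.inl) (FreeGroup.map Sum.inr))
    (FreeGroup.lift (Sum.elim (fun x => Monoid.Coprod.inl (FreeGroup.of x)) (fun x => Monoid.Coprod.inr (FreeGroup.of x))))
    (by ext <;> simp) (by ext x; rcases x with x | x <;> simp)

theorem map_word {α β : Type} [DecidableEq α] [DecidableEq β] (f : α → β) (hf : Function.Injective f) (x : FreeGroup α) :
    (FreeGroup.map f x).toWord = x.toWord.map (fun p => (f p.1, p.2)) := by
  have hr : FreeGroup.IsReduced (x.toWord.map (fun p => (f p.1, p.2))) := by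
    unfold FreeGroup.IsReduced
    rw [List.isChain_map]
    refine (FreeGroup.isReduced_toWord (x := x)).imp ?_
    intro a b hab h
    exact hab (hf h)
  conv_lhs => rw [← FreeGroup.mk_toWord (x := x)]
  rw [FreeGroup.map.mk, FreeGroup.toWord_mk, hr.reduce_eq]

structure FPData (A B : Subgroup K) (l : K → ℕ) : Prop where
  tree : TreeLen l
  treeA : TreeLen (fun x : A => l x)
  treeB : TreeLen (fun x : B => l x)
  add : ∀ L : List (A ⊕ B), Alt L → l (L.map sval).prod = (L.map (fun s => l (sval s))).sum
  ex : ∀ p, ∃ L : List (A ⊕ B), Alt L ∧ (L.map sval).prod = p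
  free : IsFreeGroup K
  tf : IsMulTorsionFree K
  tfA : IsMulTorsionFree A
  tfB : IsMulTorsionFree B
  infA : Infinite A
  ffA : RFF A ⊤
  ffB : RFF B ⊤
  neA : A ≠ ⊤
  neB : B ≠ ⊤

theorem fp_setup (A B : Subgroup K)
    (hAB : Function.Bijective (Monoid.Coprod.lift A.subtype B.subtype))
    (a b : ℕ) (ha : 3 ≤ a) (hb : 3 ≤ b)
    (eA : ↥A ≃* FreeGroup (Fin a)) (eB : ↥B ≃* FreeGroup (Fin b)) : ∃ l : K → ℕ, FPData A B l := by
  let e0 : Monoid.Coprod A B ≃* K := MulEquiv.ofBijective _ hAB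
  let e : K ≃* FreeGroup (Fin a ⊕ Fin b) := e0.symm.trans ((MulEquiv.coprodCongr eA eB).trans (fpEquiv _ _))
  have heA : ∀ x : A, e x = FreeGroup.map Sum.inl (eA x) := by
    intro x
    have : e0.symm x = Monoid.Coprod.inl x := by
      rw [MulEquiv.symm_apply_eq]; simp [e0]
    simp [e, this, fpEquiv]
  have heB : ∀ x : B, e x = FreeGroup.map Sum.inr (eB x) := by
    intro x
    have : e0.symm x = Monoid.Coprod.inr x := by
      rw [MulEquiv.symm_apply_eq]; simp [e0]
    simp [e, this, fpEquiv]
  have hlA : ∀ x : A, (e x).norm = (eA x).norm := by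
    intro x; rw [heA, FreeGroup.norm, map_word _ Sum.inl_injective, List.length_map]; rfl
  have hlB : ∀ x : B, (e x).norm = (eB x).norm := by
    intro x; rw [heB, FreeGroup.norm, map_word _ Sum.inr_injective, List.length_map]; rfl
  have hsw : ∀ s : A ⊕ B, ∀ y ∈ (e (sval s)).toWord, y.1.isLeft = s.isLeft := by
    intro s y hy
    rcases s with s | s
    · have : e (sval (Sum.inl s : A ⊕ B)) = _ := heA s
      rw [this, map_word _ Sum.inl_injective] at hy
      simp only [List.mem_map] at hy
      obtain ⟨z, -, rfl⟩ := hy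
      rfl
    · have : e (sval (Sum.inr s : A ⊕ B)) = _ := heB s
      rw [this, map_word _ Sum.inr_injective] at hy
      simp only [List.mem_map] at hy
      obtain ⟨z, -, rfl⟩ := hy
      rfl
  have hadd : ∀ L : List (A ⊕ B), Alt L → (e (L.map sval).prod).toWord = (L.map (fun s => (e (sval s)).toWord)).flatten := by
    intro L hL
    have h1 : e (L.map sval).prod = FreeGroup.mk (L.map (fun s => (e (sval s)).toWord)).flatten := by
      clear hL
      induction L with
      | nil => simp [FreeGroup.one_eq_mk]
      | cons s L ih =>
        rw [List.map_cons, List.prod_cons, map_mul, ih, List.map_cons, List.flatten_cons, ← FreeGroup.mul_mk, FreeGroup.mk_toWord]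
    have h2 : FreeGroup.IsReduced (L.map (fun s => (e (sval s)).toWord)).flatten := by
      unfold FreeGroup.IsReduced
      rw [List.isChain_flatten]
      · constructor
        · intro w hw
          obtain ⟨s, hs, rfl⟩ := List.mem_map.mp hw
          exact FreeGroup.isReduced_toWord
        · rw [List.isChain_map]
          refine hL.2.imp ?_
          intro s t hst x hx y hy hxy
          exfalso
          apply hst
          rw [← hsw s x (List.mem_of_getLast? hx), ← hsw t y (List.mem_of_mem_head? hy), hxy]
      · intro hmem
        obtain ⟨s, hs, he⟩ := List.mem_map.mp hmem
        rw [FreeGroup.toWord_eq_nil_iff] at he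
        exact hL.1 s hs (by simpa using he)
    rw [h1, FreeGroup.toWord_mk, h2.reduce_eq]
  haveI : NeZero a := ⟨by omega⟩
  haveI : NeZero b := ⟨by omega⟩
  have hneA : A ≠ ⊤ := by
    intro hA
    have h1 : ((eB.symm (FreeGroup.of 0) : B) : K) ∈ A := by rw [hA]; trivial
    have h2 := heB (eB.symm (FreeGroup.of 0))
    have h3 := heA ⟨_, h1⟩
    rw [h2] at h3
    have h4 := congrArg (fun x => x.toWord) h3
    simp only [map_word _ Sum.inl_injective, map_word _ Sum.inr_injective] at h4
    have h5 : ((Sum.inr 0, true) : (Fin a ⊕ Fin b) × Bool) ∈ (eB (eB.symm (FreeGroup.of 0))).toWord.map (fun p => ((Sum.inr p.1 : Fin a ⊕ Fin b), p.2)) := by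
      simp
    rw [h4] at h5
    simp at h5
  have hneB : B ≠ ⊤ := by
    intro hB
    have h1 : ((eA.symm (FreeGroup.of 0) : A) : K) ∈ B := by rw [hB]; trivial
    have h2 := heA (eA.symm (FreeGroup.of 0))
    have h3 := heB ⟨_, h1⟩
    rw [h2] at h3
    have h4 := congrArg (fun x => x.toWord) h3
    simp only [map_word _ Sum.inl_injective, map_word _ Sum.inr_injective] at h4
    have h5 : ((Sum.inl 0, true) : (Fin a ⊕ Fin b) × Bool) ∈ (eA (eA.symm (FreeGroup.of 0))).toWord.map (fun p => ((Sum.inl p.1 : Fin a ⊕ Fin b), p.2)) := by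
      simp
    rw [h4] at h5
    simp at h5
  refine ⟨fun x => (e x).norm, ?_, ?_, ?_, ?_, alt_exists hAB.2, ?_, ?_, ?_, ?_, ?_, ?_, ?_, hneA, hneB⟩
  · exact treeLen_norm.comap e
  · simp only [hlA]; exact treeLen_norm.comap eA
  · simp only [hlB]; exact treeLen_norm.comap eB
  · intro L hL
    simp only [FreeGroup.norm]
    rw [hadd L hL, List.length_flatten, List.map_map]
    rfl
  · exact IsFreeGroup.ofMulEquiv e.symm
  · exact Function.Injective.isMulTorsionFree e.toMonoidHom e.injective
  · exact Function.Injective.isMulTorsionFree eA.toMonoidHom eA.injective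
  · exact Function.Injective.isMulTorsionFree eB.toMonoidHom eB.injective
  · exact Infinite.of_injective eA.symm eA.symm.injective
  · exact IsFreeFactor.toRFF ⟨B, hAB⟩
  · refine IsFreeFactor.toRFF ⟨A, ?_⟩
    have : (Monoid.Coprod.lift B.subtype A.subtype) = (Monoid.Coprod.lift A.subtype B.subtype).comp (Monoid.Coprod.swap B A) := by
      ext <;> simp
    rw [this]
    exact hAB.comp (MulEquiv.coprodComm B A).bijective
end FP

section Mix
universe u
variable {K : Type u} [Group K] {A B : Subgroup K} {l : K → ℕ}

/-- `α` restricts to `β` on `A` -/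
def Restr (A : Subgroup K) (α : MulAut K) (β : MulAut A) : Prop := ∀ x : A, α (x : K) = ((β x : A) : K)

theorem Restr.pow {α : MulAut K} {β : MulAut A} (h : Restr A α β) (n : ℕ) : Restr A (α ^ n) (β ^ n) := by
  induction n with
  | zero => intro x; simp
  | succ n ih => intro x; rw [pow_succ, pow_succ, MulAut.mul_apply, MulAut.mul_apply, h, ih]

theorem Restr.inv {α : MulAut K} {β : MulAut A} (h : Restr A α β) : Restr A α⁻¹ β⁻¹ := by
  intro x
  have := h (β⁻¹ x)
  rw [MulAut.apply_inv_self] at this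
  rw [← this, MulAut.inv_apply_self]

theorem FPData.pres_len (D : FPData A B l) {α : MulAut K} {αA : MulAut A} {αB : MulAut B} (hA : Restr A α αA)
    (hB : Restr B α αB) {L : List (A ⊕ B)} (hL : Alt L) :
    l (α (L.map sval).prod) = (L.map (fun s => l (α (sval s)))).sum := by
  set f : A ⊕ B → A ⊕ B := Sum.map αA αB with hf
  have hv : ∀ s, sval (f s) = α (sval s) := by
    rintro (s | s)
    · exact (hA s).symm
    · exact (hB s).symm
  have hL' : Alt (L.map f) := by
    constructor
    · intro s hs
      obtain ⟨t, ht, rfl⟩ := List.mem_map.mp hs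
      rw [hv]
      intro h1
      exact hL.1 t ht (by simpa using h1)
    · rw [List.isChain_map]
      refine hL.2.imp ?_
      intro s t hst
      rcases s with s | s <;> rcases t with t | t <;> simpa [f] using hst
  have := D.add _ hL'
  rw [List.map_map, List.map_map] at this
  have e1 : (sval ∘ f : A ⊕ B → K) = α ∘ sval := funext hv
  rw [e1, ← List.map_map, ← map_list_prod] at this
  rw [this]
  congr 1
  apply List.map_congr_left
  intro s _
  simp [hv]

theorem sum_le_sum_list {ι : Type*} (L : List ι) (f g : ι → ℕ) (h : ∀ s ∈ L, f s ≤ g s) : (L.map f).sum ≤ (L.map g).sum :=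
  List.sum_le_sum h

theorem sum_add_list {ι : Type*} (L : List ι) (f g : ι → ℕ) : (L.map (fun s => f s + g s)).sum = (L.map f).sum + (L.map g).sum := by
  induction L with
  | nil => simp
  | cons s L ih => simp [ih]; omega

theorem sum_mul_list {ι : Type*} (L : List ι) (c : ℕ) (f : ι → ℕ) : (L.map (fun s => c * f s)).sum = c * (L.map f).sum := by
  induction L with
  | nil => simp
  | cons s L ih => simp [ih]; ring

/-- flaring for the reducible automorphism -/
theorem FPData.psi_flare (D : FPData A B l) {ψ : MulAut K} {ψA : MulAut A} {ψB : MulAut B} (hA : Restr A ψ ψA)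
    (hB : Restr B ψ ψB) (atA : AtoroidalAut ψA) (atB : AtoroidalAut ψB) :
    ∃ N, ∀ n, N ≤ n → (∀ p, 16 * l p ≤ l ((ψ ^ n) p) + l ((ψ ^ n)⁻¹ p)) := by
  haveI := D.tfA
  haveI := D.tfB
  obtain ⟨nA, hnA, CA, hFA⟩ := exists_Fl D.treeA ψA atA
  obtain ⟨nB, hnB, CB, hFB⟩ := exists_Fl D.treeB ψB atB
  obtain ⟨NA, hNA⟩ := all_either D.treeA hnA hFA 16
  obtain ⟨NB, hNB⟩ := all_either D.treeB hnB hFB 16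
  refine ⟨max NA NB, fun n hn p => ?_⟩
  obtain ⟨L, hL, rfl⟩ := D.ex p
  rw [D.add L hL, D.pres_len (hA.pow n) (hB.pow n) hL, D.pres_len (hA.pow n).inv (hB.pow n).inv hL,
    ← sum_add_list, ← sum_mul_list]
  apply sum_le_sum_list
  rintro (s | s) -
  · have h1 := hNA n (by omega) s
    have h2 : (ψ ^ n) (sval (Sum.inl s : A ⊕ B)) = _ := hA.pow n s
    have h3 : (ψ ^ n)⁻¹ (sval (Sum.inl s : A ⊕ B)) = _ := (hA.pow n).inv s
    rw [h2, h3]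
    show 16 * l s ≤ _
    omega
  · have h1 := hNB n (by omega) s
    have h2 : (ψ ^ n) (sval (Sum.inr s : A ⊕ B)) = _ := hB.pow n s
    have h3 : (ψ ^ n)⁻¹ (sval (Sum.inr s : A ⊕ B)) = _ := (hB.pow n).inv s
    rw [h2, h3]
    show 16 * l s ≤ _
    omega

/-- growth of long elements of `A` and `B` under an irreducible automorphism -/
theorem FPData.irr (D : FPData A B l) {φ : MulAut K} (hirr : FullyIrreducibleAut φ) {n0 C0 : ℕ} (hn : 1 ≤ n0)
    (hF : Fl l (φ ^ n0) C0) (M : ℕ) :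
    ∃ N C, ∀ m, N ≤ m → ∀ s : A ⊕ B, C ≤ l (sval s) → M * l (sval s) ≤ l ((φ ^ m) (sval s)) := by
  haveI := D.free
  obtain ⟨kA, LA, hA⟩ := irr_grow D.tree hirr hn hF D.ffA D.neA
  obtain ⟨kB, LB, hB⟩ := irr_grow D.tree hirr hn hF D.ffB D.neB
  obtain ⟨N, C, h⟩ := grow1 D.tree φ hn hF M (max kA kB)
  refine ⟨N, max C (max LA LB), fun m hm s hs => ?_⟩
  rcases s with s | s
  · exact h m hm s ((le_max_left _ _).trans hs) kA (le_max_left _ _)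
      (hA s s.2 (((le_max_left _ _).trans (le_max_right _ _)).trans hs))
  · exact h m hm s ((le_max_left _ _).trans hs) kB (le_max_right _ _)
      (hB s s.2 (((le_max_right _ _).trans (le_max_right _ _)).trans hs))

open Classical in
theorem FPData.long_part (D : FPData A B l) (Ψ : MulAut K) (R B0 : ℕ)
    (hB : ∀ x y, l (x * y) = l x + l y → l (Ψ x) + l (Ψ y) ≤ l (Ψ (x * y)) + B0) (hR : B0 ≤ R)
    (hlong : ∀ s : A ⊕ B, R < l (sval s) → 64 * l (sval s) ≤ l (Ψ (sval s))) :
    ∀ (L : List (A ⊕ B)), Alt L → ∀ u, l (u * (L.map sval).prod) = l u + l (L.map sval).prod →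
      (L.map (fun s => if R < l (sval s) then 2 * l (sval s) else 0)).sum ≤ l (Ψ (u * (L.map sval).prod)) := by
  intro L
  induction L with
  | nil => intro _ u _; simp
  | cons y L ih =>
    intro hL u hu
    have hL' : Alt L := ⟨fun x hx => hL.1 x (by simp [hx]), hL.2.tail⟩
    have e1 := D.add _ hL
    have e2 := D.add _ hL'
    simp only [List.map_cons, List.prod_cons, List.sum_cons] at e1 hu ⊢
    rw [← e2] at e1
    set q := (L.map sval).prod with hq
    have m1 := D.tree.mul_le u (sval y)
    have m2 := D.tree.mul_le (u * sval y) q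
    rw [mul_assoc] at m2
    split_ifs with hy
    · have h1 := hB u _ hu
      have h2 := hB _ _ e1
      have h3 := ih hL' 1 (by simp [D.tree.one])
      rw [one_mul] at h3
      have h4 := hlong y hy
      omega
    · have h3 := ih hL' (u * sval y) (by rw [mul_assoc]; omega)
      rw [mul_assoc] at h3
      omega

open Classical in
theorem FPData.mixed (D : FPData A B l) {ψ : MulAut K} {ψA : MulAut A} {ψB : MulAut B} (hA : Restr A ψ ψA)
    (hB : Restr B ψ ψB) (atA : AtoroidalAut ψA) (atB : AtoroidalAut ψB)
    {φ : MulAut K} (hirr : FullyIrreducibleAut φ) {n0 C0 : ℕ} (hn : 1 ≤ n0) (hF : Fl l (φ ^ n0) C0) :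
    ∃ N C, ∀ m n, N ≤ m → N ≤ n → ∀ p, C ≤ l p → (8 * l p ≤ l ((ψ ^ n) p) ∧ 8 * l p ≤ l ((ψ ^ n)⁻¹ p)) ∨
      8 * l p ≤ l ((φ ^ m) p) := by
  haveI := D.tfA
  haveI := D.tfB
  obtain ⟨nA, hnA, CA, hFA⟩ := exists_Fl D.treeA ψA atA
  obtain ⟨nB, hnB, CB, hFB⟩ := exists_Fl D.treeB ψB atB
  obtain ⟨N1, C1, h1⟩ := D.irr hirr hn hF 64
  set q := N1 + 1 with hq
  obtain ⟨B0, hB0⟩ := D.tree.bcl' ((φ ^ n0) ^ q)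
  set R := max C1 B0 with hR
  obtain ⟨N2, C2, h2⟩ := grow1 D.tree φ hn hF 8 q
  obtain ⟨NA, hNA⟩ := short_grow D.treeA hFA R 16
  obtain ⟨NB, hNB⟩ := short_grow D.treeB hFB R 16
  refine ⟨max N2 (max NA NB), C2, fun m n hm hn' p hp => ?_⟩
  obtain ⟨L, hL, rfl⟩ := D.ex p
  have hlp := D.long_part ((φ ^ n0) ^ q) R B0 hB0 (by omega) (by
    intro s hs
    rw [← pow_mul]
    refine h1 _ ?_ s (by omega)
    have : 1 * q ≤ n0 * q := Nat.mul_le_mul_right _ hn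
    omega) L hL 1 (by simp [D.tree.one])
  rw [one_mul] at hlp
  set p := (L.map sval).prod with hpdef
  have e1 := D.add L hL
  set Sl := (L.map (fun s => if R < l (sval s) then 2 * l (sval s) else 0)).sum with hSl
  set Ss := (L.map (fun s => if R < l (sval s) then 0 else 16 * l (sval s))).sum with hSs
  have hsum : 16 * l p = 8 * Sl + Ss := by
    rw [e1, hSl, hSs, ← sum_mul_list, ← sum_mul_list, ← sum_add_list]
    congr 1
    apply List.map_congr_left
    intro s _
    split_ifs <;> omega
  by_cases hc : l p ≤ Sl
  · right
    have hstep : ∃ j, j < q ∧ l (((φ ^ n0) ^ j) p) ≤ l (((φ ^ n0) ^ (j + 1)) p) := by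
      by_contra! hcon
      have : ∀ j, j ≤ q → l (((φ ^ n0) ^ j) p) + j ≤ l p := by
        intro j
        induction j with
        | zero => intro _; simp
        | succ j ih =>
          intro hj
          have a1 := ih (by omega)
          have a2 := hcon j (by omega)
          omega
      have := this q le_rfl
      omega
    obtain ⟨j, hj, hjj⟩ := hstep
    exact h2 m (by omega) p hp j hj.le hjj
  · left
    have hbig : 8 * l p ≤ Ss := by omega
    constructor
    · refine hbig.trans ?_
      rw [D.pres_len (hA.pow n) (hB.pow n) hL]
      apply sum_le_sum_list
      rintro (s | s) -
      · split_ifs with hs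
        · omega
        · have b1 := (hNA n (by omega) s (not_lt.mp hs)).1
          have b2 : (ψ ^ n) (sval (Sum.inl s : A ⊕ B)) = _ := hA.pow n s
          rw [b2]; exact b1
      · split_ifs with hs
        · omega
        · have b1 := (hNB n (by omega) s (not_lt.mp hs)).1
          have b2 : (ψ ^ n) (sval (Sum.inr s : A ⊕ B)) = _ := hB.pow n s
          rw [b2]; exact b1
    · refine hbig.trans ?_
      rw [D.pres_len (hA.pow n).inv (hB.pow n).inv hL]
      apply sum_le_sum_list
      rintro (s | s) -
      · split_ifs with hs
        · omega
        · have b1 := (hNA n (by omega) s (not_lt.mp hs)).2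
          have b2 : (ψ ^ n)⁻¹ (sval (Sum.inl s : A ⊕ B)) = _ := (hA.pow n).inv s
          rw [b2]; exact b1
      · split_ifs with hs
        · omega
        · have b1 := (hNB n (by omega) s (not_lt.mp hs)).2
          have b2 : (ψ ^ n)⁻¹ (sval (Sum.inr s : A ⊕ B)) = _ := (hB.pow n).inv s
          rw [b2]; exact b1

/-- subwords of elements of `A` lie in `A` -/
theorem FPData.sub_mem (D : FPData A B l) {k a p b : K} (hk : k ∈ A) (e : k = a * p * b)
    (hl : l a + l p + l b = l k) : p ∈ A := by
  have h := D.tree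
  have pre : ∀ x y, x * y = k → l x + l y = l k → x ∈ A := by
    intro x y hxy hlxy
    obtain ⟨x', y', h1, h2, h3⟩ := D.treeA.split ⟨k, hk⟩ (l x) (by show l x ≤ l k; omega)
    have h1' : k = (x' : K) * y' := congrArg Subtype.val h1
    have f := h.four 1 x k x'
    rw [TreeLen.d_one, TreeLen.d_one, TreeLen.d_one] at f
    have g1 : td l x k = l y := by rw [← hxy, TreeLen.d_mul]
    have g2 : td l (x' : K) k = l (y' : K) := by rw [h1', TreeLen.d_mul]
    have g3 := h.d_comm k (x' : K)
    have g4 : l (x' : K) = l x := h2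
    have h3' : l x + l (y' : K) = l k := by
      have : l (y' : K) + l x = l k := h3
      omega
    have : x = x' := h.d_eq (by omega)
    rw [this]; exact x'.2
  have m1 := h.mul_le a p
  have m2 := h.mul_le p b
  have m3 := h.mul_le (a * p) b
  have m4 := h.mul_le a (p * b)
  rw [← e] at m3
  rw [← mul_assoc, ← e] at m4
  have h1 := pre a (p * b) (by rw [e, mul_assoc]) (by omega)
  have h2 := pre (a * p) b e.symm (by omega)
  have := mul_mem (inv_mem h1) h2
  simpa using this
end Mix

section PingPong

variable {K : Type*} [Group K] {l : K → ℕ} {E : Type*}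

/-- strong distinctness -/
def Dist8 (l : K → ℕ) (th : E → MulAut K) (C : ℕ) : Prop :=
  ∀ s s', s ≠ s' → ∀ p, 8 * l p ≤ l (thb th s p) + l (thb th s' p) + C

theorem Dist8.distinct {th : E → MulAut K} {C : ℕ} (h : Dist8 l th C) : CD.Distinct l th C := by
  intro s s' hs p
  have := h s s' hs p
  omega

theorem lift_mk_thb (th : E → MulAut K) (w : List (E × Bool)) :
    FreeGroup.lift th (FreeGroup.mk w) = (w.map (thb th)).prod := by
  rw [FreeGroup.lift_mk]
  congr 1
  apply List.map_congr_left
  rintro ⟨e, _ | _⟩ _ <;> rfl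

theorem ping {th : E → MulAut K} {C : ℕ} (h : Dist8 l th C) (p : K) (sr : E × Bool)
    (hp : C < l p) (hs : l p ≤ l (thb th sr p)) (w : List (E × Bool)) :
    ∀ t, FreeGroup.IsReduced (t :: w) → (t :: w).getLast? = some sr →
      l ((w.map (thb th)).prod p) ≤ l (((t :: w).map (thb th)).prod p) ∧
      C < l (((t :: w).map (thb th)).prod p) ∧
      l (thb th sr p) ≤ l (((t :: w).map (thb th)).prod p) := by
  induction w with
  | nil =>
    intro t _ ht
    simp at ht
    subst ht
    simp
    omega
  | cons t' w ih =>
    intro t hr ht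
    rw [FreeGroup.isReduced_cons_cons] at hr
    obtain ⟨h1, h2, h3⟩ := ih t' hr.2 (by simpa using ht)
    set q := (((t' :: w).map (thb th)).prod p) with hq
    have e1 : (((t :: t' :: w).map (thb th)).prod p) = thb th t q := by
      simp [hq]
    have e2 : thb th (labInv t') q = (w.map (thb th)).prod p := by
      rw [hq]
      simp only [List.map_cons, List.prod_cons, MulAut.mul_apply]
      rw [thb_labInv_apply]
    have hne : t ≠ labInv t' := by
      rintro rfl
      have := hr.1 rfl
      simp [labInv] at this
    have := h t (labInv t') hne q
    rw [e2] at this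
    rw [e1]
    omega

theorem reduced_invRev {w : List (E × Bool)} (h : FreeGroup.IsReduced w) :
    FreeGroup.IsReduced (FreeGroup.invRev w) := by
  classical
  rw [FreeGroup.isReduced_iff_reduce_eq] at *
  rw [FreeGroup.reduce_invRev, h]

theorem cyc_flare {th : E → MulAut K} {C : ℕ} (h : Dist8 l th C) {w : List (E × Bool)}
    (hw : w ≠ []) (hc : FreeGroup.IsCyclicallyReduced w) (p : K) :
    3 * l p ≤ l (FreeGroup.lift th (FreeGroup.mk w) p) + l ((FreeGroup.lift th (FreeGroup.mk w))⁻¹ p) + 3 * C := by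
  by_cases hp : C < l p
  swap
  · omega
  obtain ⟨s1, w1, rfl⟩ := List.exists_cons_of_ne_nil hw
  obtain ⟨sr, hsr⟩ : ∃ sr, (s1 :: w1).getLast? = some sr := by
    cases h : (s1 :: w1).getLast? with
    | none => simp at h
    | some x => exact ⟨x, rfl⟩
  have hne : sr ≠ labInv s1 := by
    rintro rfl
    have := hc.2 (labInv s1) hsr s1 rfl rfl
    simp [labInv] at this
  have hd := h sr (labInv s1) hne p
  have hX : l p ≤ l (thb th sr p) → l (thb th sr p) ≤ l (FreeGroup.lift th (FreeGroup.mk (s1 :: w1)) p) := by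
    intro hx
    rw [lift_mk_thb]
    exact (ping h p sr hp hx w1 s1 hc.1 hsr).2.2
  have hY : l p ≤ l (thb th (labInv s1) p) →
      l (thb th (labInv s1) p) ≤ l ((FreeGroup.lift th (FreeGroup.mk (s1 :: w1)))⁻¹ p) := by
    intro hx
    rw [← map_inv, FreeGroup.inv_mk, lift_mk_thb]
    have hr := reduced_invRev hc.1
    have hl : (FreeGroup.invRev (s1 :: w1)).getLast? = some (labInv s1) := by
      simp [FreeGroup.invRev, labInv]
    cases hv : FreeGroup.invRev (s1 :: w1) with
    | nil => rw [hv] at hl; simp at hl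
    | cons t v =>
      rw [hv] at hl hr
      exact (ping h p (labInv s1) hp hx v t hr hl).2.2
  by_cases h1 : l p ≤ l (thb th sr p)
  · by_cases h2 : l p ≤ l (thb th (labInv s1) p)
    · have := hX h1; have := hY h2; omega
    · have := hX h1; omega
  · have := hY (by omega); omega

theorem free_flare {th : E → MulAut K} {C : ℕ} (h : Dist8 l th C) (W : FreeGroup E) (hW : W ≠ 1) :
    ∃ γ : MulAut K, ∀ p, 3 * l (γ p) ≤ l (γ (FreeGroup.lift th W p)) +
      l (γ ((FreeGroup.lift th W)⁻¹ p)) + 3 * C := by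
  classical
  set L := W.toWord with hL
  have hr : FreeGroup.IsReduced L := FreeGroup.isReduced_toWord
  have hc := FreeGroup.reduceCyclically.isCyclicallyReduced hr
  have he := FreeGroup.reduceCyclically.conj_conjugator_reduceCyclically L
  set g := FreeGroup.mk (FreeGroup.reduceCyclically.conjugator L)
  set v := FreeGroup.reduceCyclically L
  have hWe : W = g * FreeGroup.mk v * g⁻¹ := by
    rw [FreeGroup.inv_mk, FreeGroup.mul_mk, FreeGroup.mul_mk, he, hL, FreeGroup.mk_toWord]
  have hv : v ≠ [] := by
    intro hv
    apply hW
    rw [hWe, hv, ← FreeGroup.one_eq_mk]; simp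
  refine ⟨(FreeGroup.lift th g)⁻¹, fun p => ?_⟩
  have := cyc_flare h hv hc ((FreeGroup.lift th g)⁻¹ p)
  have e1 : (FreeGroup.lift th g)⁻¹ (FreeGroup.lift th W p) =
      FreeGroup.lift th (FreeGroup.mk v) ((FreeGroup.lift th g)⁻¹ p) := by
    rw [hWe]
    simp [MulAut.mul_apply]
  have e2 : (FreeGroup.lift th g)⁻¹ ((FreeGroup.lift th W)⁻¹ p) =
      (FreeGroup.lift th (FreeGroup.mk v))⁻¹ ((FreeGroup.lift th g)⁻¹ p) := by
    rw [hWe, map_mul, map_mul, map_inv, mul_inv_rev, mul_inv_rev]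
    simp [MulAut.mul_apply]
  rw [e1, e2]
  exact this

theorem lift_inj (hT : TreeLen l) [Infinite K] {th : E → MulAut K} {C : ℕ} (h : Dist8 l th C) :
    Function.Injective (FreeGroup.lift th) := by
  rw [injective_iff_map_eq_one]
  intro W hW
  by_contra hne
  obtain ⟨γ, hγ⟩ := free_flare h W hne
  rw [hW] at hγ
  apply (hT.fin (3 * C)).not_infinite
  have : {x | l x ≤ 3 * C} = Set.univ := by
    ext x
    simp only [Set.mem_setOf_eq, Set.mem_univ, iff_true]
    have := hγ (γ⁻¹ x)
    simp at this
    omega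
  rw [this]
  exact Set.infinite_univ

end PingPong

section Semi

variable {K : Type*} [Group K] {l : K → ℕ} {E : Type*} {Q : Type*} [Group Q]

theorem GExt.semi (h : TreeLen l) (f : Q →* MulAut K) (q : E → Q)
    (hq : Subgroup.closure (Set.range q) = ⊤) (hi : Function.Injective (FreeGroup.lift q)) :
    GExt l (SemidirectProduct.inl : K →* K ⋊[f] Q) (fun e => SemidirectProduct.inr (q e)) (fun e => f (q e)) where
  inj := SemidirectProduct.inl_injective
  rel e k := by
    rw [SemidirectProduct.inl_aut]
    simp [mul_assoc]
  gen := by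
    rw [eq_top_iff]
    rintro g -
    rw [← SemidirectProduct.inl_left_mul_inr_right g]
    apply Subgroup.mul_mem
    · exact stdGen_closure h _ _ _
    · have : g.right ∈ Subgroup.closure (Set.range q) := by rw [hq]; trivial
      have h2 := Subgroup.mem_map_of_mem (SemidirectProduct.inr : Q →* K ⋊[f] Q) this
      rw [MonoidHom.map_closure] at h2
      refine Subgroup.closure_mono ?_ h2
      rintro _ ⟨_, ⟨e, rfl⟩, rfl⟩
      exact Or.inr ⟨e, rfl⟩
  proj w k hw := by
    apply hi
    rw [map_one]
    have h1 := congrArg (SemidirectProduct.rightHom : K ⋊[f] Q →* Q) hw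
    rw [SemidirectProduct.rightHom_inl, map_list_prod] at h1
    rw [← h1]
    clear h1 hw
    induction w with
    | nil => simp [CD.proj, ← FreeGroup.one_eq_mk]
    | cons x w ih =>
      rcases x with x | ⟨e, _ | _⟩
      · have e0 : CD.proj (E := E) (Sum.inl x :: w) = CD.proj w := by
          simp [CD.proj, List.filterMap_cons, Sum.getRight?]
        rw [e0, ih]
        simp [evG]
      · simp only [CD.proj, FreeGroup.lift_mk, List.map_cons, List.prod_cons] at ih ⊢
        rw [← ih]
        simp [evG]
      · simp only [CD.proj, FreeGroup.lift_mk, List.map_cons, List.prod_cons] at ih ⊢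
        rw [← ih]
        simp [evG]

theorem zgen : Subgroup.closure (Set.range (fun _ : Unit => Multiplicative.ofAdd (1:ℤ))) = ⊤ := by
  rw [eq_top_iff]
  intro x _
  rw [Set.range_const, Subgroup.mem_closure_singleton]
  refine ⟨x.toAdd, ?_⟩
  rw [← ofAdd_zsmul]
  simp

theorem zinj : Function.Injective (FreeGroup.lift (fun _ : Unit => Multiplicative.ofAdd (1:ℤ))) := by
  have hall : ∀ x : FreeGroup Unit, ∃ n : ℤ, x = FreeGroup.of () ^ n := by
    intro x
    exact ⟨FreeGroup.freeGroupUnitEquivInt x, (FreeGroup.freeGroupUnitEquivInt.symm_apply_apply x).symm⟩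
  rw [injective_iff_map_eq_one]
  intro x hx
  obtain ⟨n, rfl⟩ := hall x
  rw [map_zpow, FreeGroup.lift_apply_of, ← ofAdd_zsmul] at hx
  have : n = 0 := by simpa using hx
  subst this; simp

theorem zext (h : TreeLen l) (c : MulAut K) :
    GExt l (SemidirectProduct.inl : K →* K ⋊[zpowersHom (MulAut K) c] Multiplicative ℤ)
      (fun _ : Unit => SemidirectProduct.inr (Multiplicative.ofAdd (1:ℤ))) (fun _ => c) := by
  have := GExt.semi h (zpowersHom (MulAut K) c) _ zgen zinj
  simpa [zpowersHom_apply] using this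

theorem unit_distinct (c : MulAut K) (C : ℕ) (h : ∀ p, 3 * l p ≤ l (c p) + l (c⁻¹ p) + C) :
    CD.Distinct l (fun _ : Unit => c) C := by
  rintro ⟨⟨⟩, _ | _⟩ ⟨⟨⟩, _ | _⟩ hs p
  · exact absurd rfl hs
  · have := h p; simp only [thb]; simp only [if_true, if_false, Bool.false_eq_true]; omega
  · have := h p; simp only [thb]; simp only [if_true, if_false, Bool.false_eq_true]; omega
  · exact absurd rfl hs

theorem atoroidal_of (h : TreeLen l) (c : MulAut K) (C : ℕ) (hc : ∀ p, 3 * l p ≤ l (c p) + l (c⁻¹ p) + C) :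
    AtoroidalAut c :=
  (zext h c).hyp h (unit_distinct c C hc)

theorem atoroidal_lift (h : TreeLen l) {th : E → MulAut K} {C : ℕ} (hd : Dist8 l th C) (W : FreeGroup E)
    (hW : W ≠ 1) : AtoroidalAut (FreeGroup.lift th W) := by
  obtain ⟨γ, hγ⟩ := free_flare hd W hW
  exact atoroidal_of (h.comap γ) _ _ hγ

theorem closure_eq_lift (x y : MulAut K) :
    Subgroup.closure ({x, y} : Set (MulAut K)) = (FreeGroup.lift (fun b : Bool => cond b x y)).range := by
  rw [FreeGroup.range_lift_eq_closure]
  congr 1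
  ext z
  simp [or_comm, eq_comm]

/-- generators of the subgroup -/
def gq (x y : MulAut K) (b : Bool) : Subgroup.closure ({x, y} : Set (MulAut K)) :=
  ⟨cond b x y, Subgroup.subset_closure (by cases b <;> simp)⟩

theorem ext_hyp (h : TreeLen l) [Infinite K] (x y : MulAut K) {C : ℕ}
    (hd : Dist8 l (fun b : Bool => cond b x y) C) :
    IsHypGroup (K ⋊[(Subgroup.closure ({x, y} : Set (MulAut K))).subtype]
          ↥(Subgroup.closure ({x, y} : Set (MulAut K)))) := by
  have hinj := lift_inj h hd
  have e : (Subgroup.closure ({x, y} : Set (MulAut K))).subtype.comp (FreeGroup.lift (gq x y)) =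
      FreeGroup.lift (fun b : Bool => cond b x y) := by
    ext b; simp [gq]
  have hi : Function.Injective (FreeGroup.lift (gq x y)) := by
    rw [← e] at hinj
    exact Function.Injective.of_comp (f := (Subgroup.closure ({x, y} : Set (MulAut K))).subtype) hinj
  have hg : Subgroup.closure (Set.range (gq x y)) = ⊤ := by
    apply Subgroup.map_injective (Subgroup.subtype_injective (Subgroup.closure ({x, y} : Set (MulAut K))))
    rw [MonoidHom.map_closure, ← MonoidHom.range_eq_map, Subgroup.range_subtype]
    congr 1
    ext z
    simp [gq, eq_comm, or_comm]
  exact (GExt.semi h _ (gq x y) hg hi).hyp h (C := C) hd.distinct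

end Semi

section Final

variable {K : Type*} [Group K] {l : K → ℕ} {E : Type*} {G : Type*} [Group G] {A B : Subgroup K}

theorem qi_of_bound (h : TreeLen l) (hA : TreeLen (fun x : A => l x)) [Finite E] {i : K →* G} {t : E → G}
    {th : E → MulAut K} (hx : GExt l i t th) {C : ℕ}
    (hC : ∀ k ∈ A, l k ≤ C * (wordLength (stdGen l i t) (i k) + 1)) : QIEmbSubgroup (A.map i) := by
  set j : A ≃* A.map i := A.equivMapOfInjective i hx.inj with hj
  have hjv : ∀ x : A, ((j x : A.map i) : G) = i x := fun x => rfl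
  set T : Set (A.map i) := j '' {x : A | l x ≤ 1} with hT
  have hlet : ∀ x : A, ∃ w : List (A.map i), w.prod = j x ∧ w.length = l x ∧ ∀ y ∈ w, y ∈ T := by
    intro x
    obtain ⟨w, h1, h2, h3⟩ := hA.letters _ x rfl
    refine ⟨w.map j, ?_, by simp [h2], ?_⟩
    · rw [← h1, map_list_prod]
    · intro y hy
      obtain ⟨z, hz, rfl⟩ := List.mem_map.1 hy
      exact ⟨z, h3 z hz, rfl⟩
  have hTg : Subgroup.closure T = ⊤ := by
    rw [eq_top_iff]
    intro y _
    obtain ⟨x, rfl⟩ := j.surjective y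
    obtain ⟨w, h1, h2, h3⟩ := hlet x
    rw [← h1]
    exact Subgroup.list_prod_mem _ (fun y hy => Subgroup.subset_closure (h3 y hy))
  refine ⟨stdGen l i t, T, ⟨stdGen_finite h i t, hx.gen⟩, ⟨(hA.fin 1).image _, hTg⟩, ((C + 1 : ℕ) : ℝ), ?_, ?_⟩
  · push_cast; linarith [Nat.cast_nonneg (α := ℝ) C]
  have up : ∀ y : A.map i, wordLength (stdGen l i t) (y : G) ≤ wordLength T y := by
    intro y
    obtain ⟨w, h1, h2, h3⟩ := wl_exists hTg y
    have := wl_le (S := stdGen l i t) (w.map Subtype.val) (by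
      intro x hx
      obtain ⟨z, hz, rfl⟩ := List.mem_map.1 hx
      rcases h1 z hz with ⟨u, hu, e⟩ | ⟨u, hu, e⟩
      · left; left; exact ⟨u, hu, by rw [← e]; rfl⟩
      · right; left; exact ⟨u, hu, by rw [← hjv, e]; rfl⟩)
    have e : (w.map Subtype.val).prod = (y : G) := by
      rw [← h3]; exact (map_list_prod (A.map i).subtype w).symm
    rw [e] at this
    simpa [h2] using this
  have lo : ∀ y : A.map i, wordLength T y ≤ C * (wordLength (stdGen l i t) (y : G) + 1) := by
    intro y
    obtain ⟨x, rfl⟩ := j.surjective y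
    obtain ⟨w, h1, h2, h3⟩ := hlet x
    have := wl_le (S := T) w (fun y hy => Or.inl (h3 y hy))
    rw [h1, h2] at this
    exact this.trans (hC x x.2)
  intro y y'
  have u := up (y⁻¹ * y')
  have v := lo (y⁻¹ * y')
  have hco : ((y⁻¹ * y' : A.map i) : G) = (y : G)⁻¹ * y' := rfl
  rw [hco] at u v
  simp only [wordDist]
  have u' : (wordLength (stdGen l i t) ((y : G)⁻¹ * y') : ℝ) ≤ wordLength T (y⁻¹ * y') := by exact_mod_cast u
  have v' : (wordLength T (y⁻¹ * y') : ℝ) ≤ C * (wordLength (stdGen l i t) ((y : G)⁻¹ * y') + 1) := by exact_mod_cast v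
  set P : ℝ := (wordLength (stdGen l i t) ((y : G)⁻¹ * y') : ℝ)
  set R : ℝ := (wordLength T (y⁻¹ * y') : ℝ)
  have hP : 0 ≤ P := Nat.cast_nonneg _
  have hR : 0 ≤ R := Nat.cast_nonneg _
  have hC0 : (0:ℝ) ≤ C := Nat.cast_nonneg _
  push_cast
  constructor
  · have : R / ((C:ℝ) + 1) ≤ P + 1 := by
      rw [div_le_iff₀ (by linarith)]
      nlinarith
    linarith
  · nlinarith

theorem FPData.qi (D : FPData A B l) (c : MulAut K) (C : ℕ)
    (hd : ∀ p, 3 * l p ≤ l (c p) + l (c⁻¹ p) + C)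
    (h1 : ∀ p ∈ A, 3 * l p ≤ l (c p) + C) (h2 : ∀ p ∈ A, 3 * l p ≤ l (c⁻¹ p) + C) :
    QIEmbSubgroup (A.map (SemidirectProduct.inl :
        K →* K ⋊[zpowersHom (MulAut K) c] Multiplicative ℤ)) := by
  obtain ⟨C', hC'⟩ := (zext D.tree c).qi D.tree (unit_distinct c C hd)
  refine qi_of_bound D.tree D.treeA (zext D.tree c) (C := C') ?_
  intro k hk
  apply hC'
  intro a p b e hl s
  have hp := D.sub_mem hk e hl
  rcases s with ⟨⟨⟩, _ | _⟩
  · exact h2 p hp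
  · exact h1 p hp

theorem main_thm (A B : Subgroup K)
    (hAB : Function.Bijective (Monoid.Coprod.lift A.subtype B.subtype))
    (a b : ℕ) (ha : 3 ≤ a) (hb : 3 ≤ b)
    (hAfree : Nonempty (↥A ≃* FreeGroup (Fin a)))
    (hBfree : Nonempty (↥B ≃* FreeGroup (Fin b)))
    (ψA : MulAut ↥A) (ψB : MulAut ↥B)
    (hψA : FullyIrreducibleAut ψA ∧ AtoroidalAut ψA)
    (hψB : FullyIrreducibleAut ψB ∧ AtoroidalAut ψB)
    (ψ : MulAut K)
    (hψA' : ∀ x : ↥A, ψ (x : K) = ((ψA x : ↥A) : K))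
    (hψB' : ∀ x : ↥B, ψ (x : K) = ((ψB x : ↥B) : K))
    (φ : MulAut K) (hφ : FullyIrreducibleAut φ ∧ AtoroidalAut φ) :
    ∃ N : ℕ, ∀ m l : ℕ, N ≤ m → N ≤ l →
      (∀ c ∈ Subgroup.closure ({φ ^ m, ψ ^ l} : Set (MulAut K)), c ≠ 1 →
        AtoroidalAut c) ∧
      IsHypGroup
        (K ⋊[(Subgroup.closure ({φ ^ m, ψ ^ l} : Set (MulAut K))).subtype]
          ↥(Subgroup.closure ({φ ^ m, ψ ^ l} : Set (MulAut K)))) ∧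
      QIEmbSubgroup (A.map (SemidirectProduct.inl :
        K →* K ⋊[zpowersHom (MulAut K) (φ ^ m)] Multiplicative ℤ)) ∧
      ¬ QIEmbSubgroup ((⊤ : Subgroup ↥A).map (SemidirectProduct.inl :
        ↥A →* ↥A ⋊[zpowersHom (MulAut ↥A) (ψA ^ l)] Multiplicative ℤ)) ∧
      ¬ QIEmbSubgroup (A.map (SemidirectProduct.inl :
        K →* K ⋊[(Subgroup.closure ({φ ^ m, ψ ^ l} : Set (MulAut K))).subtype]
          ↥(Subgroup.closure ({φ ^ m, ψ ^ l} : Set (MulAut K))))) := by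
  obtain ⟨eA⟩ := hAfree
  obtain ⟨eB⟩ := hBfree
  obtain ⟨len, D⟩ := fp_setup A B hAB a b ha hb eA eB
  haveI := D.infA
  haveI := D.tfA
  haveI : Infinite K := Infinite.of_injective (Subtype.val : A → K) Subtype.val_injective
  have rA : Restr A ψ ψA := hψA'
  have rB : Restr B ψ ψB := hψB'
  obtain ⟨n0, hn, C0, hF⟩ := exists_Fl D.tree φ hφ.2
  have hF' : Fl len (φ⁻¹ ^ n0) C0 := by rw [inv_pow]; exact hF.inv
  obtain ⟨N1, C1, H1⟩ := long_either D.tree hn hF 8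
  obtain ⟨N2, H2⟩ := D.psi_flare rA rB hψA.2 hψB.2
  obtain ⟨N3, C3, H3⟩ := D.mixed rA rB hψA.2 hψB.2 hφ.1 hn hF
  obtain ⟨N4, C4, H4⟩ := D.mixed rA rB hψA.2 hψB.2 hφ.1.inv hn hF'
  obtain ⟨N5, C5, H5⟩ := D.irr hφ.1 hn hF 3
  obtain ⟨N6, C6, H6⟩ := D.irr hφ.1.inv hn hF' 3
  obtain ⟨nA, hnA, CA, hFA⟩ := exists_Fl D.treeA ψA hψA.2
  obtain ⟨N7, H7⟩ := all_either D.treeA hnA hFA 16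
  refine ⟨N1 + N2 + N3 + N4 + N5 + N6 + N7, fun m n hm hn' => ?_⟩
  have hFl : Fl (fun x : A => len x) (ψA ^ n) 0 := by
    intro w
    have := H7 n (by omega) w
    simp only at this ⊢
    omega
  set C := 8 * (C1 + C3 + C4 + C5 + C6) with hC
  have p1 : ∀ p, 8 * len p ≤ len ((φ ^ m) p) + len ((φ ^ m)⁻¹ p) + C := by
    intro p
    by_cases h : C1 ≤ len p
    · have := H1 m (by omega) p h; omega
    · omega
  have p2 : ∀ p, 8 * len p ≤ len ((ψ ^ n) p) + len ((ψ ^ n)⁻¹ p) + C := by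
    intro p
    have := H2 n (by omega) p; omega
  have p3 : ∀ p, 8 * len p ≤ len ((φ ^ m) p) + len ((ψ ^ n) p) + C ∧
      8 * len p ≤ len ((φ ^ m) p) + len ((ψ ^ n)⁻¹ p) + C := by
    intro p
    by_cases h : C3 ≤ len p
    · have := H3 m n (by omega) (by omega) p h; omega
    · omega
  have p4 : ∀ p, 8 * len p ≤ len ((φ ^ m)⁻¹ p) + len ((ψ ^ n) p) + C ∧
      8 * len p ≤ len ((φ ^ m)⁻¹ p) + len ((ψ ^ n)⁻¹ p) + C := by
    intro p
    by_cases h : C4 ≤ len p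
    · have := H4 m n (by omega) (by omega) p h
      rw [inv_pow] at this
      omega
    · omega
  have hd : Dist8 len (fun b : Bool => cond b (φ ^ m) (ψ ^ n)) C := by
    rintro ⟨_ | _, _ | _⟩ ⟨_ | _, _ | _⟩ hs p <;> first | exact absurd rfl hs | skip
    all_goals
      have q1 := p1 p
      have q2 := p2 p
      have q3 := p3 p
      have q4 := p4 p
      simp only [thb, if_true, if_false, Bool.false_eq_true, cond_true, cond_false]
      omega
  refine ⟨?_, ext_hyp D.tree _ _ hd, ?_, ?_, ?_⟩
  · intro c hc hc1
    rw [closure_eq_lift] at hc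
    obtain ⟨W, rfl⟩ := hc
    exact atoroidal_lift D.tree hd W (by rintro rfl; simp at hc1)
  · refine D.qi (φ ^ m) C (fun p => ?_) (fun p hp => ?_) (fun p hp => ?_)
    · have := p1 p; omega
    · by_cases h : C5 ≤ len p
      · have := H5 m (by omega) (Sum.inl ⟨p, hp⟩) h
        have e : sval (Sum.inl ⟨p, hp⟩ : A ⊕ B) = p := rfl
        rw [e] at this; omega
      · omega
    · by_cases h : C6 ≤ len p
      · have := H6 m (by omega) (Sum.inl ⟨p, hp⟩) h
        have e : sval (Sum.inl ⟨p, hp⟩ : A ⊕ B) = p := rfl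
        rw [e, inv_pow] at this; omega
      · omega
  · refine distorted D.treeA _ SemidirectProduct.inl_injective
      (SemidirectProduct.inr (Multiplicative.ofAdd (1:ℤ))) (ψA ^ n) ?_ hFl _ (MonoidHom.range_eq_map _).symm
    intro w
    rw [← map_inv, ← SemidirectProduct.inl_aut]
    simp [zpowersHom_apply]
  · refine distorted D.treeA (SemidirectProduct.inl.comp A.subtype)
      (SemidirectProduct.inl_injective.comp Subtype.val_injective)
      (SemidirectProduct.inr ⟨ψ ^ n, Subgroup.subset_closure (by simp)⟩) (ψA ^ n) ?_ hFl _ ?_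
    · intro w
      rw [← map_inv]
      simp only [MonoidHom.comp_apply]
      rw [← SemidirectProduct.inl_aut]
      simp only [Subgroup.subtype_apply]
      rw [rA.pow n w]
    · rw [MonoidHom.range_comp, Subgroup.range_subtype]

end Final

/-- the counterexample of Section 4.1. Let `Fₙ = A ∗ B` with both
factors free of rank `≥ 3`, let `ψ = ψ_A ∗ ψ_B` with `ψ_A, ψ_B` fully irreducible
atoroidal automorphisms of `A`, `B`, and let `φ` be a fully irreducible atoroidal
automorphism of `Fₙ`. Then for all sufficiently large `m, l`: the subgroup
`Q = ⟨φ^m, ψ^l⟩ < Out(Fₙ)` is purely atoroidal with hyperbolic extension `G`;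
`A` is quasiconvex in `G₁ = π⁻¹(⟨φ^m⟩) = K ⋊_{φ^m} ℤ`; `A` is distorted in
`A ⋊_{ψ_A^l} ℤ < G₂ = π⁻¹(⟨ψ^l⟩)`; and hence `A` is not quasiconvex in `G`. -/
theorem stmt_19 {K : Type*} [Group K]
    (A B : Subgroup K)
    (hAB : Function.Bijective (Monoid.Coprod.lift A.subtype B.subtype))
    (a b : ℕ) (ha : 3 ≤ a) (hb : 3 ≤ b)
    (hAfree : Nonempty (↥A ≃* FreeGroup (Fin a)))
    (hBfree : Nonempty (↥B ≃* FreeGroup (Fin b)))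
    (ψA : MulAut ↥A) (ψB : MulAut ↥B)
    (hψA : FullyIrreducibleAut ψA ∧ AtoroidalAut ψA)
    (hψB : FullyIrreducibleAut ψB ∧ AtoroidalAut ψB)
    (ψ : MulAut K)
    (hψA' : ∀ x : ↥A, ψ (x : K) = ((ψA x : ↥A) : K))
    (hψB' : ∀ x : ↥B, ψ (x : K) = ((ψB x : ↥B) : K))
    (φ : MulAut K) (hφ : FullyIrreducibleAut φ ∧ AtoroidalAut φ) :
    ∃ N : ℕ, ∀ m l : ℕ, N ≤ m → N ≤ l →
      -- Q = ⟨φ^m, ψ^l⟩ is purely atoroidal, with hyperbolic extension G = Fₙ ⋊ Q: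
      (∀ c ∈ Subgroup.closure ({φ ^ m, ψ ^ l} : Set (MulAut K)), c ≠ 1 →
        AtoroidalAut c) ∧
      IsHypGroup
        (K ⋊[(Subgroup.closure ({φ ^ m, ψ ^ l} : Set (MulAut K))).subtype]
          ↥(Subgroup.closure ({φ ^ m, ψ ^ l} : Set (MulAut K)))) ∧
      -- A is quasiconvex in G₁ = π⁻¹(⟨φ^m⟩) = K ⋊_{φ^m} ℤ:
      QIEmbSubgroup (A.map (SemidirectProduct.inl :
        K →* K ⋊[zpowersHom (MulAut K) (φ ^ m)] Multiplicative ℤ)) ∧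
      -- but A is distorted in A ⋊_{ψ_A^l} ℤ (which sits inside G₂ = π⁻¹(⟨ψ^l⟩)):
      ¬ QIEmbSubgroup ((⊤ : Subgroup ↥A).map (SemidirectProduct.inl :
        ↥A →* ↥A ⋊[zpowersHom (MulAut ↥A) (ψA ^ l)] Multiplicative ℤ)) ∧
      -- hence A is not quasiconvex in G:
      ¬ QIEmbSubgroup (A.map (SemidirectProduct.inl :
        K →* K ⋊[(Subgroup.closure ({φ ^ m, ψ ^ l} : Set (MulAut K))).subtype]
          ↥(Subgroup.closure ({φ ^ m, ψ ^ l} : Set (MulAut K))))) := by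
  exact main_thm A B hAB a b ha hb hAfree hBfree ψA ψB hψA hψB ψ hψA' hψB' φ hφ
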